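/- The covering radius of RM(4,8) in RM(5,8) equals 26; that is, every Boolean function on 8 variables of degree at most 5 has distance at most 26 to RM(4,8), and some Boolean function on 8 variables of degree at most 5 has distance exactly 26 to RM(4,8). -/

import Mathlib

open MvPolynomial

/-- A Boolean function on `m` variables over 𝔽₂. -/
abbrev BF (m : ℕ) := (Fin m → ZMod 2) → ZMod 2

/-- The unique multilinear polynomial over 𝔽₂ representing the Boolean function `f`
(obtained by interpolation: `∏ i (Xᵢ + vᵢ + 1)` is the indicator of the input `v`). -/
noncomputable def repPoly {m : ℕ} (f : BF m) : MvPolynomial (Fin m) (ZMod 2) :=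
  ∑ v : Fin m → ZMod 2, f v • ∏ i : Fin m, (X i + C (v i + 1))

/-- The degree of a Boolean function: the total degree of its multilinear representative. -/
noncomputable def deg {m : ℕ} (f : BF m) : ℕ := (repPoly f).totalDegree

/-- The weight of a Boolean function: the number of inputs on which it takes the value 1. -/
noncomputable def wt {m : ℕ} (f : BF m) : ℕ :=
  (Finset.univ.filter fun v => f v = 1).card

/-- The distance from `f` to the Reed–Muller code `RM(r,m)`: the minimum weight of
`f + p` over Boolean functions `p` of degree at most `r`. -/
noncomputable def distRM (m r : ℕ) (f : BF m) : ℕ :=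
  sInf {w | ∃ p : BF m, deg p ≤ r ∧ wt (f + p) = w}

section Degree

variable {m : ℕ}

/-- The moment `∑ᵥ f(v) ∏_{i ∈ T} vᵢ` of a Boolean function. -/
def moment (f : BF m) (T : Finset (Fin m)) : ZMod 2 := ∑ v, f v * ∏ i ∈ T, v i

lemma eval_repPoly (f : BF m) (v : Fin m → ZMod 2) : eval v (repPoly f) = f v := by
  have key : ∀ u : Fin m → ZMod 2, (∏ i, (v i + (u i + 1))) = if u = v then 1 else 0 := by
    intro u
    split_ifs with h
    · subst h
      refine Finset.prod_eq_one fun i _ => ?_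
      generalize u i = a
      revert a; decide
    · obtain ⟨i, hi⟩ : ∃ i, u i ≠ v i := by
        by_contra! hc
        exact h (funext hc)
      refine Finset.prod_eq_zero (Finset.mem_univ i) ?_
      revert hi
      generalize u i = a
      generalize v i = b
      revert a b; decide
  simp [repPoly, smul_eval, key]

lemma moment_eq_zero {f : BF m} {r : ℕ} (hf : deg f ≤ r) {T : Finset (Fin m)}
    (hT : r + T.card < m) : moment f T = 0 := by
  have h := MvPolynomial.sum_eval_eq_zero (K := ZMod 2)
    (repPoly f * ∏ i ∈ T, (X i : MvPolynomial (Fin m) (ZMod 2))) ?_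
  · simpa [moment, eval_repPoly, eval_prod] using h
  · have h1 : (∏ i ∈ T, (X i : MvPolynomial (Fin m) (ZMod 2))).totalDegree ≤ T.card := by
      refine (totalDegree_finsetProd _ _).trans ?_
      simp
    have h2 := totalDegree_mul (repPoly f) (∏ i ∈ T, (X i : MvPolynomial (Fin m) (ZMod 2)))
    have h3 : (repPoly f).totalDegree ≤ r := hf
    simp only [ZMod.card, Fintype.card_fin]
    omega

lemma deg_le_of_moment {f : BF m} {r : ℕ}
    (hf : ∀ T : Finset (Fin m), T.card + r < m → moment f T = 0) : deg f ≤ r := by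
  have expand : repPoly f = ∑ t : Finset (Fin m),
      (∏ i ∈ t, (X i : MvPolynomial (Fin m) (ZMod 2))) *
        C (∑ u ∈ tᶜ.powerset, moment f u) := by
    have h1 : ∀ (v : Fin m → ZMod 2) (t : Finset (Fin m)),
        ∏ i ∈ tᶜ, (v i + 1) = ∑ u ∈ tᶜ.powerset, ∏ i ∈ u, v i := by
      intro v t
      rw [Finset.prod_add_one]
    have h2 : ∀ t : Finset (Fin m), ∑ u ∈ tᶜ.powerset, moment f u
        = ∑ v, f v * ∏ i ∈ tᶜ, (v i + 1) := by
      intro t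
      simp only [h1, moment, Finset.mul_sum]
      exact Finset.sum_comm
    simp only [h2, repPoly, map_sum, Finset.mul_sum]
    rw [Finset.sum_comm]
    refine Finset.sum_congr rfl fun v _ => ?_
    rw [Finset.prod_add, Finset.smul_sum, Finset.powerset_univ]
    refine Finset.sum_congr rfl fun t _ => ?_
    rw [← Finset.compl_eq_univ_sdiff, ← map_prod, smul_eq_C_mul, C_mul]
    ring
  unfold deg
  rw [expand]
  refine totalDegree_finsetSum_le fun t _ => ?_
  by_cases ht : t.card ≤ r
  · refine (totalDegree_mul _ _).trans ?_
    rw [totalDegree_C, add_zero]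
    refine (totalDegree_finsetProd _ _).trans ?_
    simpa using ht
  · have h0 : ∑ u ∈ tᶜ.powerset, moment f u = 0 := by
      refine Finset.sum_eq_zero fun u hu => hf u ?_
      have h1 := Finset.card_le_card (Finset.mem_powerset.mp hu)
      have h2 := Finset.card_add_card_compl t
      simp only [Fintype.card_fin] at h2
      omega
    simp [h0]

lemma moment_add (f g : BF m) (T : Finset (Fin m)) :
    moment (f + g) T = moment f T + moment g T := by
  simp [moment, add_mul, Finset.sum_add_distrib]

end Degree

section Points

/-- Parity of the number of entries of a list satisfying a Boolean predicate. -/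
def par (A : List ℕ) (p : ℕ → Bool) : Bool := A.foldr (fun a b => p a ^^ b) false

@[simp] lemma par_nil (p : ℕ → Bool) : par [] p = false := rfl

@[simp] lemma par_cons (a : ℕ) (A : List ℕ) (p : ℕ → Bool) :
    par (a :: A) p = (p a ^^ par A p) := rfl

lemma par_append (A B : List ℕ) (p : ℕ → Bool) : par (A ++ B) p = (par A p ^^ par B p) := by
  induction A with
  | nil => simp
  | cons a A ih => simp [ih]

lemma par_xor (A : List ℕ) (p q : ℕ → Bool) :
    par A (fun a => p a ^^ q a) = (par A p ^^ par A q) := by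
  induction A with
  | nil => rfl
  | cons a A ih => simp only [par_cons, ih, Bool.xor_assoc, Bool.xor_left_comm (q a)]

lemma par_congr {A : List ℕ} {p q : ℕ → Bool} (h : ∀ a ∈ A, p a = q a) : par A p = par A q := by
  induction A with
  | nil => rfl
  | cons a A ih =>
    simp only [par_cons]
    rw [h a (by simp), ih fun b hb => h b (by simp [hb])]

lemma par_map (A : List ℕ) (g : ℕ → ℕ) (p : ℕ → Bool) :
    par (A.map g) p = par A (fun a => p (g a)) := by
  induction A with
  | nil => rfl
  | cons a A ih => simp [ih]

lemma par_perm {A B : List ℕ} (h : A.Perm B) (p : ℕ → Bool) : par A p = par B p := by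
  induction h with
  | nil => rfl
  | cons a _ ih => simp [ih]
  | swap a b l => simp only [par_cons]; exact Bool.xor_left_comm _ _ _
  | trans _ _ h1 h2 => exact h1.trans h2

/-- Cubic moment of a list of points of `𝔽₂⁸`, each coded by the bits of a number. -/
def mom (A : List ℕ) (i j k : ℕ) : Bool :=
  par A fun a => a.testBit i && a.testBit j && a.testBit k

/-- The point of `𝔽₂ᵐ` coded by the bits of a number. -/
def pt (m a : ℕ) : Fin m → ZMod 2 := fun i => (a.testBit i).toNat

/-- The sum of the indicator functions of the points in a list. -/
def ofPts (m : ℕ) (A : List ℕ) : BF m := fun v => (A.map fun a => if v = pt m a then 1 else 0).sum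

lemma wt_ofPts_le (m : ℕ) (A : List ℕ) : wt (ofPts m A) ≤ A.length := by
  classical
  have hsub : (Finset.univ.filter fun v => ofPts m A v = 1) ⊆ (A.map (pt m)).toFinset := by
    intro v hv
    simp only [Finset.mem_filter, Finset.mem_univ, true_and] at hv
    simp only [List.mem_toFinset, List.mem_map]
    by_contra! hc
    have : ofPts m A v = 0 := by
      unfold ofPts
      refine List.sum_eq_zero fun x hx => ?_
      obtain ⟨a, ha, rfl⟩ := List.mem_map.mp hx
      rw [if_neg fun h => hc a ha h.symm]
    rw [this] at hv
    exact absurd hv (by decide)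
  refine (Finset.card_le_card hsub).trans ((List.toFinset_card_le _).trans ?_)
  simp

lemma sum_ofPts_mul (m : ℕ) (A : List ℕ) (g : (Fin m → ZMod 2) → ZMod 2) :
    ∑ v, ofPts m A v * g v = (A.map fun a => g (pt m a)).sum := by
  induction A with
  | nil => simp [ofPts]
  | cons a A ih =>
    have : ∀ v, ofPts m (a :: A) v = (if v = pt m a then 1 else 0) + ofPts m A v := fun v => by
      simp [ofPts]
    simp [this, add_mul, Finset.sum_add_distrib, ih]

lemma sum_toNat_eq_par (A : List ℕ) (p : ℕ → Bool) :
    (A.map fun a => ((p a).toNat : ZMod 2)).sum = ((par A p).toNat : ZMod 2) := by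
  induction A with
  | nil => rfl
  | cons a A ih =>
    simp only [List.map_cons, List.sum_cons, ih, par_cons]
    generalize p a = x
    generalize par A p = y
    revert x y; decide

lemma sum_ofPts_mom (A : List ℕ) (i j k : Fin 8) :
    ∑ v, ofPts 8 A v * (v i * v j * v k) = ((mom A i j k).toNat : ZMod 2) := by
  rw [sum_ofPts_mul, mom, ← sum_toNat_eq_par]
  congr 1
  refine List.map_congr_left fun a _ => ?_
  simp only [pt]
  generalize a.testBit i = x
  generalize a.testBit j = y
  generalize a.testBit k = z
  revert x y z; decide

lemma exists_prod_eq {T : Finset (Fin 8)} (hT : T.card ≤ 3) (hne : T.Nonempty) :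
    ∃ i j k : Fin 8, T = {i, j, k} ∧ ∀ v : Fin 8 → ZMod 2, ∏ l ∈ T, v l = v i * v j * v k := by
  have sq : ∀ x : ZMod 2, x * x = x := by decide
  have h1 : 1 ≤ T.card := hne.card_pos
  obtain h | h | h : T.card = 1 ∨ T.card = 2 ∨ T.card = 3 := by omega
  · obtain ⟨a, rfl⟩ := Finset.card_eq_one.mp h
    exact ⟨a, a, a, by simp, fun v => by simp [sq]⟩
  · obtain ⟨a, b, hab, rfl⟩ := Finset.card_eq_two.mp h
    exact ⟨a, a, b, by simp, fun v => by simp [Finset.prod_pair hab, sq]⟩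
  · obtain ⟨a, b, c, hab, hac, hbc, rfl⟩ := Finset.card_eq_three.mp h
    refine ⟨a, b, c, rfl, fun v => ?_⟩
    rw [Finset.prod_insert (by simp [hab, hac]), Finset.prod_pair hbc, mul_assoc]

lemma prod_triple (i j k : Fin 8) (v : Fin 8 → ZMod 2) :
    ∏ l ∈ ({i, j, k} : Finset (Fin 8)), v l = v i * v j * v k := by
  have sq : ∀ x : ZMod 2, x * x = x := by decide
  have sq' : ∀ x y : ZMod 2, x * y = y * x * y := by decide
  by_cases hij : i = j
  · subst hij
    by_cases hik : i = k
    · subst hik; simp [sq]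
    · simp [Finset.prod_pair hik, sq]
  · by_cases hik : i = k
    · subst hik
      rw [Finset.insert_comm]
      simp only [Finset.pair_eq_singleton, Finset.prod_pair (Ne.symm hij)]
      exact sq' _ _
    · by_cases hjk : j = k
      · subst hjk
        rw [Finset.pair_eq_singleton, Finset.prod_pair hij, mul_assoc, sq]
      · rw [Finset.prod_insert (by simp [hij, hik]), Finset.prod_pair hjk, mul_assoc]

lemma sum_mul_triple (f : BF 8) (i j k : Fin 8) :
    ∑ v, f v * (v i * v j * v k) = moment f {i, j, k} := by
  simp only [moment, prod_triple]

lemma moment_ofPts_empty (A : List ℕ) :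
    moment (ofPts 8 A) ∅ = ((par A fun _ => true).toNat : ZMod 2) := by
  simp only [moment, Finset.prod_empty]
  rw [sum_ofPts_mul, ← sum_toNat_eq_par]
  simp

end Points

section Tensors

/-- Position of the triple `{i, j, k}` in the list `trips`. -/
def tix (i j k : ℕ) : ℕ :=
  let lo := min i (min j k)
  let hi := max i (max j k)
  let mid := i + j + k - lo - hi
  hi * (hi - 1) * (hi - 2) / 6 + mid * (mid - 1) / 2 + lo

/-- The triples `i < j < k < 8`, in colexicographic order. -/
def trips : List (ℕ × ℕ × ℕ) :=
  (List.range 8).flatMap fun k => (List.range k).flatMap fun j =>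
    (List.range j).map fun i => (i, j, k)

/-- For each triple containing `a` but not `b`, the position of the triple with `a` replaced
by `b`. -/
def plan (a b : ℕ) : List (Option ℕ) :=
  trips.map fun t =>
    bif b == t.1 || b == t.2.1 || b == t.2.2 then none
    else bif a == t.1 then some (tix b t.2.1 t.2.2)
    else bif a == t.2.1 then some (tix t.1 b t.2.2)
    else bif a == t.2.2 then some (tix t.1 t.2.1 b)
    else none

/-- Effect of the substitution `x_a ↦ x_a + x_b` on a list of cubic moments; the entries may be
taken from any structure with an addition. -/
def tau {α : Type} (x : α → α → α) (a b : ℕ) (L : List α) : List α :=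
  List.zipWith (fun p e => match p with
    | none => e
    | some u => x e (L.getD u e)) (plan a b) L

/-- Effect of a sequence of substitutions. -/
def act {α : Type} (x : α → α → α) (w : List (ℕ × ℕ)) (L : List α) : List α :=
  w.foldl (fun L p => tau x p.1 p.2 L) L

/-- Entry of an alternating tensor given by its list of coefficients. -/
def ent (L : List Bool) (i j k : ℕ) : Bool :=
  bif i == j || j == k || i == k then false else L.getD (tix i j k) false

/-- The list of points `A` has even length, vanishing moments of orders one and two, and cubic
moments `L`. -/
def Represents (A : List ℕ) (L : List Bool) : Prop :=
  (par A fun _ => true) = false ∧ ∀ i < 8, ∀ j < 8, ∀ k < 8, mom A i j k = ent L i j k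

/-- The cubic moments `L` are those of at most `n` points. -/
def Good (n : ℕ) (L : List Bool) : Prop := ∃ A : List ℕ, A.length ≤ n ∧ Represents A L

lemma length_plan (a b : ℕ) : (plan a b).length = 56 := by
  unfold plan; rw [List.length_map]; decide +kernel

lemma length_tau {α : Type} (x : α → α → α) (a b : ℕ) {L : List α} (hL : L.length = 56) :
    (tau x a b L).length = 56 := by
  simp [tau, length_plan, hL]

lemma length_act {α : Type} (x : α → α → α) (w : List (ℕ × ℕ)) {L : List α}
    (hL : L.length = 56) : (act x w L).length = 56 := by
  induction w generalizing L with
  | nil => exact hL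
  | cons p w ih => exact ih (length_tau x p.1 p.2 hL)

lemma map_tau {α β : Type} (x : α → α → α) (y : β → β → β) (h : α → β)
    (hxy : ∀ a b, h (x a b) = y (h a) (h b)) (a b : ℕ) (L : List α) :
    (tau x a b L).map h = tau y a b (L.map h) := by
  simp only [tau, List.map_zipWith, List.zipWith_map_right]
  congr 1
  funext p e
  cases p with
  | none => rfl
  | some u => simp [hxy, List.getD_eq_getElem?_getD, Option.getD_map]

lemma map_act {α β : Type} (x : α → α → α) (y : β → β → β) (h : α → β)
    (hxy : ∀ a b, h (x a b) = y (h a) (h b)) (w : List (ℕ × ℕ)) (L : List α) :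
    (act x w L).map h = act y w (L.map h) := by
  induction w generalizing L with
  | nil => rfl
  | cons p w ih =>
    have := ih (tau x p.1 p.2 L)
    rw [map_tau x y h hxy] at this
    exact this

lemma getD_tau (a b : ℕ) {L : List Bool} (hL : L.length = 56) {T : ℕ} (hT : T < 56) :
    (tau xor a b L).getD T false = match (plan a b).getD T none with
      | none => L.getD T false
      | some u => L.getD T false ^^ L.getD u (L.getD T false) := by
  have h1 : T < (plan a b).length := by rw [length_plan]; exact hT
  have h2 : T < L.length := by omega
  simp only [tau, List.getD_eq_getElem?_getD, List.getElem?_zipWith,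
    List.getElem?_eq_getElem h1, List.getElem?_eq_getElem h2]
  rfl

lemma tix_lt : ∀ i < 8, ∀ j < 8, ∀ k < 8, (i ≠ j ∧ j ≠ k ∧ i ≠ k → tix i j k < 56) := by
  decide +kernel

set_option synthInstance.maxSize 1000 in
lemma plan_tix : ∀ a < 8, ∀ b < 8, ∀ i < 8, ∀ j < 8, ∀ k < 8,
    (i ≠ j ∧ j ≠ k ∧ i ≠ k ∧ a ≠ b → (plan a b).getD (tix i j k) none =
      if b = i ∨ b = j ∨ b = k then none else if a = i then some (tix b j k) else
      if a = j then some (tix i b k) else if a = k then some (tix i j b) else none) := by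
  decide +kernel

/-- The substitution `x_a ↦ x_a + x_b` on coded points. -/
def tauPt (a b v : ℕ) : ℕ := if v.testBit b then v ^^^ 2 ^ a else v

lemma testBit_tauPt {a b : ℕ} (v i : ℕ) :
    (tauPt a b v).testBit i = if i = a then v.testBit a ^^ v.testBit b else v.testBit i := by
  unfold tauPt
  split_ifs with h1 h2 h2
  · subst h2; simp [Nat.testBit_xor, h1]
  · simp [Nat.testBit_xor, Ne.symm h2]
  · subst h2; simp at h1; simp [h1]
  · rfl

lemma mom_tauPt (A : List ℕ) (a b i j k : ℕ) :
    mom (A.map (tauPt a b)) i j k =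
      par A fun v => (if i = a then v.testBit a ^^ v.testBit b else v.testBit i) &&
        (if j = a then v.testBit a ^^ v.testBit b else v.testBit j) &&
        (if k = a then v.testBit a ^^ v.testBit b else v.testBit k) := by
  simp only [mom, par_map, testBit_tauPt]

lemma mom_swap12 (A : List ℕ) (i j k : ℕ) : mom A i j k = mom A j i k :=
  par_congr fun a _ => by rw [Bool.and_comm (a.testBit i)]

lemma mom_swap23 (A : List ℕ) (i j k : ℕ) : mom A i j k = mom A i k j :=
  par_congr fun a _ => by rw [Bool.and_assoc, Bool.and_assoc, Bool.and_comm (a.testBit j)]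

lemma tix_swap12 (i j k : ℕ) : tix i j k = tix j i k := by
  simp only [tix, min_left_comm i j k, max_left_comm i j k, Nat.add_comm i j]

lemma tix_swap23 (i j k : ℕ) : tix i j k = tix i k j := by
  simp only [tix, min_comm j k, max_comm j k, Nat.add_right_comm i j k]

lemma ent_swap12 (L : List Bool) (i j k : ℕ) : ent L i j k = ent L j i k := by
  simp only [ent, tix_swap12 i j k, Bool.beq_comm (a := i), cond_eq_ite, Bool.or_eq_true,
    beq_iff_eq]
  congr 1
  apply propext
  constructor <;> (rintro ((h | h) | h) <;> simp [h])

lemma ent_swap23 (L : List Bool) (i j k : ℕ) : ent L i j k = ent L i k j := by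
  simp only [ent, tix_swap23 i j k, cond_eq_ite, Bool.or_eq_true, beq_iff_eq]
  congr 1
  apply propext
  constructor <;> (rintro ((h | h) | h) <;> simp [h])

lemma ent_self (L : List Bool) (i k : ℕ) : ent L i i k = false := by simp [ent]

lemma ent_of_ne (L : List Bool) {i j k : ℕ} (h1 : i ≠ j) (h2 : j ≠ k) (h3 : i ≠ k) :
    ent L i j k = L.getD (tix i j k) false := by simp [ent, h1, h2, h3]

lemma represents_of_lt {A : List ℕ} {L : List Bool} (h0 : (par A fun _ => true) = false)
    (h1 : ∀ i < 8, ∀ k < 8, mom A i i k = false)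
    (h2 : ∀ k < 8, ∀ j < k, ∀ i < j, mom A i j k = L.getD (tix i j k) false) :
    Represents A L := by
  have h3 : ∀ k < 8, ∀ j < k, ∀ i < j, mom A i j k = ent L i j k := fun k hk j hj i hi => by
    rw [h2 k hk j hj i hi, ent_of_ne L (by omega) (by omega) (by omega)]
  have h4 : ∀ k < 8, ∀ j < 8, ∀ i < j, mom A i j k = ent L i j k := by
    intro k hk j hj i hi
    obtain h | h | h | h | h : k < i ∨ k = i ∨ (i < k ∧ k < j) ∨ k = j ∨ j < k := by omega
    · rw [mom_swap23, mom_swap12, ent_swap23, ent_swap12]; exact h3 j hj i hi k h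
    · subst h
      rw [mom_swap23, ent_swap23, ent_self, h1 k hk j hj]
    · rw [mom_swap23, ent_swap23]; exact h3 j hj k h.2 i h.1
    · subst h
      rw [mom_swap12, mom_swap23, ent_swap12, ent_swap23, ent_self, h1 k hk i (by omega)]
    · exact h3 k hk j h i hi
  refine ⟨h0, fun i hi j hj k hk => ?_⟩
  obtain h | h | h := lt_trichotomy i j
  · exact h4 k hk j hj i h
  · subst h; rw [h1 i hi k hk, ent_self]
  · rw [mom_swap12, ent_swap12]; exact h4 k hk i hi j h

lemma ent_tau {a b : ℕ} (ha : a < 8) (hb : b < 8) (hab : a ≠ b) {L : List Bool}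
    (hL : L.length = 56) {i j k : ℕ} (hi : i < 8) (hj : j < 8) (hk : k < 8) (hij : i ≠ j)
    (hjk : j ≠ k) (hik : i ≠ k) :
    ent (tau xor a b L) i j k =
      if b = i ∨ b = j ∨ b = k then ent L i j k else if a = i then ent L i j k ^^ ent L b j k else
      if a = j then ent L i j k ^^ ent L i b k else if a = k then ent L i j k ^^ ent L i j b
      else ent L i j k := by
  have hT := tix_lt i hi j hj k hk ⟨hij, hjk, hik⟩
  have key : ∀ u, u < 56 → L.getD u (L.getD (tix i j k) false) = L.getD u false := fun u hu => by
    rw [List.getD_eq_getElem _ _ (by omega), List.getD_eq_getElem _ _ (by omega)]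
  rw [ent_of_ne _ hij hjk hik, getD_tau a b hL hT, plan_tix a ha b hb i hi j hj k hk
    ⟨hij, hjk, hik, hab⟩, ent_of_ne _ hij hjk hik]
  by_cases h0 : b = i ∨ b = j ∨ b = k
  · simp [h0]
  · simp only [h0, if_false]
    push Not at h0
    split_ifs with h1 h2 h3
    · rw [ent_of_ne _ h0.2.1 hjk h0.2.2]
      simp only []
      rw [key _ (tix_lt b hb j hj k hk ⟨h0.2.1, hjk, h0.2.2⟩)]
    · rw [ent_of_ne _ (Ne.symm h0.1) h0.2.2 hik]
      simp only []
      rw [key _ (tix_lt i hi b hb k hk ⟨Ne.symm h0.1, h0.2.2, hik⟩)]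
    · rw [ent_of_ne _ hij (Ne.symm h0.2.1) (Ne.symm h0.1)]
      simp only []
      rw [key _ (tix_lt i hi j hj b hb ⟨hij, Ne.symm h0.2.1, Ne.symm h0.1⟩)]
    · rfl

lemma represents_tau {a b : ℕ} (ha : a < 8) (hb : b < 8) (hab : a ≠ b) {L : List Bool}
    (hL : L.length = 56) {A : List ℕ} (hA : Represents A (tau xor a b L)) :
    Represents (A.map (tauPt a b)) L := by
  obtain ⟨h0, hm⟩ := hA
  have hs : ∀ i < 8, ∀ k < 8, mom A i i k = false := fun i hi k hk => by
    rw [hm i hi i hi k hk, ent_self]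
  refine represents_of_lt (by rw [par_map]; exact h0) ?_ ?_
  · intro i hi k hk
    rw [mom_tauPt]
    by_cases h1 : i = a <;> by_cases h2 : k = a
    · simp only [h1, h2, if_true, Bool.and_self, par_xor]
      have e1 := hs a ha a ha
      have e2 := hs b hb b hb
      simp only [mom, Bool.and_self] at e1 e2
      rw [e1, e2]; rfl
    · simp only [h1, h2, if_true, if_false, Bool.and_self, Bool.and_xor_distrib_right, par_xor]
      have e1 := hs a ha k hk
      have e2 := hs b hb k hk
      simp only [mom, Bool.and_self] at e1 e2
      rw [e1, e2]; rfl
    · simp only [h1, h2, if_true, if_false, Bool.and_self, Bool.and_xor_distrib_left, par_xor]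
      have e1 := hs i hi a ha
      have e2 := hs i hi b hb
      simp only [mom, Bool.and_self] at e1 e2
      rw [e1, e2]; rfl
    · simp only [h1, h2, if_false]
      exact hs i hi k hk
  · intro k hk j hj i hi
    have hj8 : j < 8 := by omega
    have hi8 : i < 8 := by omega
    rw [← ent_of_ne L (by omega) (by omega) (by omega), mom_tauPt]
    by_cases h1 : i = a
    · have h2 : j ≠ a := by omega
      have h3 : k ≠ a := by omega
      simp only [h1, h2, h3, if_true, if_false, Bool.and_xor_distrib_right, par_xor]
      have e1 := hm a ha j hj8 k hk
      have e2 := hm b hb j hj8 k hk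
      simp only [mom] at e1 e2
      rw [e1, e2, ent_tau ha hb hab hL ha hj8 hk (by omega) (by omega) (by omega)]
      by_cases hbj : b = j
      · subst hbj; simp [ent_self]
      by_cases hbk : b = k
      · subst hbk
        simp [ent_swap23 _ b j b, ent_self]
      rw [ent_tau ha hb hab hL hb hj8 hk (by omega) (by omega) (by omega)]
      simp [hbj, hbk, Ne.symm hab]
    by_cases h2 : j = a
    · have h3 : k ≠ a := by omega
      simp only [h1, h2, h3, if_true, if_false, Bool.and_xor_distrib_left,
        Bool.and_xor_distrib_right, par_xor]
      have e1 := hm i hi8 a ha k hk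
      have e2 := hm i hi8 b hb k hk
      simp only [mom] at e1 e2
      rw [e1, e2, ent_tau ha hb hab hL hi8 ha hk (by omega) (by omega) (by omega)]
      by_cases hbi : b = i
      · subst hbi; simp [ent_self]
      by_cases hbk : b = k
      · subst hbk
        simp [ent_swap12 _ i b b, ent_swap23 _ b i b, ent_self]
      rw [ent_tau ha hb hab hL hi8 hb hk (by omega) (by omega) (by omega)]
      simp [hbi, hbk, Ne.symm hab, Ne.symm h1]
    by_cases h3 : k = a
    · simp only [h1, h2, h3, if_true, if_false, Bool.and_xor_distrib_left, par_xor]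
      have e1 := hm i hi8 j hj8 a ha
      have e2 := hm i hi8 j hj8 b hb
      simp only [mom] at e1 e2
      rw [e1, e2, ent_tau ha hb hab hL hi8 hj8 ha (by omega) (by omega) (by omega)]
      by_cases hbi : b = i
      · subst hbi; simp [ent_swap23 _ b j b, ent_self]
      by_cases hbj : b = j
      · subst hbj
        simp [ent_swap12 _ i b b, ent_swap23 _ b i b, ent_self]
      rw [ent_tau ha hb hab hL hi8 hj8 hb (by omega) (by omega) (by omega)]
      simp [hbi, hbj, Ne.symm hab, Ne.symm h1, Ne.symm h2]
    · simp only [h1, h2, h3, if_false]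
      have e1 := hm i hi8 j hj8 k hk
      simp only [mom] at e1
      rw [e1, ent_tau ha hb hab hL hi8 hj8 hk (by omega) (by omega) (by omega)]
      simp [Ne.symm h1, Ne.symm h2, Ne.symm h3]

lemma good_of_tau {n a b : ℕ} (ha : a < 8) (hb : b < 8) (hab : a ≠ b) {L : List Bool}
    (hL : L.length = 56) (h : Good n (tau xor a b L)) : Good n L := by
  obtain ⟨A, h1, h2⟩ := h
  exact ⟨A.map (tauPt a b), by simpa using h1, represents_tau ha hb hab hL h2⟩

end Tensors

section Stages

/-- The first 56 bits of a number. -/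
def bitsOf (c : ℕ) : List Bool := (List.range 56).map fun T => c.testBit T

/-- `n` choose `3`, the number of triples below `n`. -/
def ch3 (n : ℕ) : ℕ := n * (n - 1) * (n - 2) / 6

/-- Add the mask `m` to the list `W`, multiplied by the entry of `W` at position `p`. -/
def redWith {α : Type} (x : α → α → α) (z : α) (W : List α) (pm : ℕ × List Bool) : List α :=
  List.zipWith (fun b w => bif b then x w (W.getD pm.1 z) else w) pm.2 W

/-- Successive elimination of the pivot entries. -/
def redAll {α : Type} (x : α → α → α) (z : α) (pivs : List (ℕ × List Bool)) (W : List α) :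
    List α :=
  pivs.foldl (redWith x z) W

/-- The change of the tensor `r` under a sequence of substitutions. -/
def shearMask (r : ℕ) (w : List (ℕ × ℕ)) : List Bool :=
  List.zipWith xor (act xor w (bitsOf r)) (bitsOf r)

/-- Lexicographic comparison, last entry first, starting from the value `acc`. -/
def ltAcc {α : Type} (x y : α → α → α) : α → List α → List α → α
  | acc, u :: us, v :: vs => ltAcc x y (x (x v (y u v)) (x acc (y acc (x u v)))) us vs
  | acc, _, _ => acc

/-- Numbers whose bits at position `i`, taken together, are the `k` binary digits of `i`. -/
def truthCols : ℕ → List ℕ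
  | 0 => []
  | k + 1 => (truthCols k).map (fun v => v ||| v <<< 2 ^ k) ++ [(2 ^ 2 ^ k - 1) <<< 2 ^ k]

/-- All tensors that agree with `r` outside the positions in `free`, in bit-sliced form. -/
def slices (r : ℕ) (free : List ℕ) : List ℕ :=
  (List.range 56).map fun T =>
    bif free.contains T then (truthCols free.length).getD (free.idxOf T) 0
    else bif r.testBit T then 2 ^ 2 ^ free.length - 1 else 0

/-- Bit-sliced inequality of the tensors in `W` with the tensor coded by `c`. -/
def neqSlice (one : ℕ) (W : List ℕ) (c : ℕ) : ℕ :=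
  (List.zipWith (fun w b => w ^^^ (bif b then one else 0)) W (bitsOf c)).foldr (· ||| ·) 0

/-- Certificate check: every tensor extending `r` by one coordinate can be brought to one of
the tensors `mins` by substitutions, each step making it smaller. -/
def stageOk (n r : ℕ) (free : List ℕ) (pw : List (ℕ × List (ℕ × ℕ)))
    (gens : List (List (ℕ × ℕ))) (mins : List ℕ) : Bool :=
  let pivs := pw.map fun q => (q.1, shearMask r q.2)
  let one := 2 ^ 2 ^ free.length - 1
  let S := slices r free
  let out := (List.range 56).filter fun T => !free.contains T
  let img := gens.map fun g => redAll Nat.xor 0 pivs (act Nat.xor g S)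
  Nat.ble n 8 &&
  pw.all (fun q => q.2.all fun t => t.1 + 1 == n && Nat.blt t.2 t.1) &&
  pivs.all (fun q => pivs.all (fun q' => q.2.getD q'.1 false == (q.1 == q'.1)) &&
    !r.testBit q.1) &&
  pivs.all (fun q => q.2.length == 56 && (List.range 56).all fun T =>
    !(Nat.blt T (ch3 (n - 1)) || Nat.ble (ch3 n) T) || !q.2.getD T false) &&
  (List.range 56).all (fun T => Nat.blt T (ch3 (n - 1)) || Nat.ble (ch3 n) T ||
    free.contains T || pivs.any fun q => q.1 == T) &&
  free.all (fun T => Nat.ble (ch3 (n - 1)) T && Nat.blt T (ch3 n)) &&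
  gens.all (fun g => g.all fun t => Nat.blt t.1 n && Nat.blt t.2 n && !(t.1 == t.2)) &&
  img.all (fun F => out.all fun T => Nat.beq (F.getD T 0) (S.getD T 0)) &&
  Nat.beq one ((img.map fun F => ltAcc Nat.xor Nat.land 0 F S).foldr (· ||| ·) 0 |||
    (mins.map fun c => one ^^^ neqSlice one S c).foldr (· ||| ·) 0)

lemma length_bitsOf (c : ℕ) : (bitsOf c).length = 56 := by simp [bitsOf]

lemma getD_bitsOf (c : ℕ) {T : ℕ} (hT : T < 56) : (bitsOf c).getD T false = c.testBit T := by
  simp [bitsOf, List.getD_eq_getElem?_getD, hT]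

lemma ext_getD {L M : List Bool} (hL : L.length = 56) (hM : M.length = 56)
    (h : ∀ T < 56, L.getD T false = M.getD T false) : L = M := by
  refine List.ext_getElem (by omega) fun T h1 h2 => ?_
  have := h T (by omega)
  rwa [List.getD_eq_getElem _ _ h1, List.getD_eq_getElem _ _ h2] at this

lemma length_redWith {α : Type} (x : α → α → α) (z : α) {W : List α} (hW : W.length = 56)
    {pm : ℕ × List Bool} (hm : pm.2.length = 56) : (redWith x z W pm).length = 56 := by
  simp [redWith, hW, hm]

lemma map_redAll {α β : Type} (x : α → α → α) (y : β → β → β) (h : α → β)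
    (hxy : ∀ a b, h (x a b) = y (h a) (h b)) (z : α) (pivs : List (ℕ × List Bool)) (W : List α) :
    (redAll x z pivs W).map h = redAll y (h z) pivs (W.map h) := by
  induction pivs generalizing W with
  | nil => rfl
  | cons pm pivs ih =>
    have h1 : (redWith x z W pm).map h = redWith y (h z) (W.map h) pm := by
      simp only [redWith, List.map_zipWith, List.zipWith_map_right]
      congr 1
      funext b w
      cases b with
      | false => rfl
      | true => simp [hxy, List.getD_eq_getElem?_getD, Option.getD_map]
    have := ih (redWith x z W pm)
    rw [h1] at this
    exact this

lemma map_ltAcc {α β : Type} (x y : α → α → α) (x' y' : β → β → β) (h : α → β)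
    (hx : ∀ a b, h (x a b) = x' (h a) (h b)) (hy : ∀ a b, h (y a b) = y' (h a) (h b))
    (acc : α) (us vs : List α) :
    h (ltAcc x y acc us vs) = ltAcc x' y' (h acc) (us.map h) (vs.map h) := by
  induction us generalizing acc vs with
  | nil => simp [ltAcc]
  | cons u us ih =>
    cases vs with
    | nil => simp [ltAcc]
    | cons v vs => simp [ltAcc, ih, hx, hy]

/-- The number with given binary digits. -/
def val : List Bool → ℕ
  | [] => 0
  | b :: bs => b.toNat + 2 * val bs

lemma val_of_ltAcc (acc : Bool) {us vs : List Bool} (hl : us.length = vs.length)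
    (h : ltAcc xor and acc us vs = true) : val us < val vs ∨ (val us = val vs ∧ acc = true) := by
  induction us generalizing acc vs with
  | nil =>
    cases vs with
    | nil => exact Or.inr ⟨rfl, h⟩
    | cons _ _ => simp at hl
  | cons u us ih =>
    cases vs with
    | nil => simp at hl
    | cons v vs =>
      have := ih _ (by simpa using hl) h
      simp only [val]
      revert this
      cases u <;> cases v <;> cases acc <;> simp <;> omega

lemma truthCols_lt (k : ℕ) : ∀ v ∈ truthCols k, v < 2 ^ 2 ^ k := by
  induction k with
  | zero => simp [truthCols]
  | succ k ih =>
    have e : 2 ^ (k + 1) = 2 ^ k + 2 ^ k := by ring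
    intro v hv
    simp only [truthCols, List.mem_append, List.mem_map, List.mem_singleton] at hv
    rw [e]
    obtain ⟨u, hu, rfl⟩ | rfl := hv
    · refine Nat.or_lt_two_pow ((ih u hu).trans_le
        (Nat.pow_le_pow_right (by norm_num) (Nat.le_add_left _ _))) ?_
      rw [Nat.shiftLeft_eq, pow_add]
      exact Nat.mul_lt_mul_of_pos_right (ih u hu) (by positivity)
    · rw [Nat.shiftLeft_eq, pow_add]
      exact Nat.mul_lt_mul_of_pos_right (Nat.sub_lt (by positivity) one_pos) (by positivity)

lemma exists_index {k : ℕ} (bs : List Bool) (h : bs.length = k) :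
    ∃ i < 2 ^ k, (truthCols k).map (fun v => v.testBit i) = bs := by
  induction k generalizing bs with
  | zero => exact ⟨0, by norm_num, by simp [truthCols, List.length_eq_zero_iff.mp h]⟩
  | succ k ih =>
    obtain ⟨cs, b, rfl⟩ : ∃ cs b, bs = cs ++ [b] :=
      ⟨_, _, (List.dropLast_append_getLast (by rintro rfl; simp at h)).symm⟩
    obtain ⟨i, hi, hcs⟩ := ih cs (by simpa using h)
    refine ⟨i + b.toNat * 2 ^ k, ?_, ?_⟩
    · rw [pow_succ]
      have : b.toNat ≤ 1 := Bool.toNat_le b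
      nlinarith
    · simp only [truthCols, List.map_append, List.map_map, List.map_cons, List.map_nil]
      congr 1
      · rw [← hcs]
        refine List.map_congr_left fun v hv => ?_
        have hv' := truthCols_lt k v hv
        cases b with
        | false =>
          have h1 : ¬ 2 ^ k ≤ i := by omega
          simp [Nat.testBit_or, Nat.testBit_shiftLeft, h1]
        | true =>
          have h0 : v.testBit (i + 2 ^ k) = false :=
            Nat.testBit_lt_two_pow (hv'.trans_le (Nat.pow_le_pow_right (by norm_num) (by omega)))
          simp [Nat.testBit_or, Nat.testBit_shiftLeft, h0]
      · cases b with
        | false =>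
          have h1 : ¬ 2 ^ k ≤ i := by omega
          simp [Nat.testBit_shiftLeft, h1]
        | true => simp [Nat.testBit_shiftLeft, Nat.testBit_two_pow_sub_one, hi]

lemma exists_slice {r : ℕ} {free : List ℕ} {L : List Bool} (hL : L.length = 56)
    (h : ∀ T < 56, T ∉ free → L.getD T false = r.testBit T) :
    ∃ i < 2 ^ free.length, (slices r free).map (fun v => v.testBit i) = L := by
  obtain ⟨i, hi, hm⟩ := exists_index (free.map fun T => L.getD T false) (List.length_map _)
  refine ⟨i, hi, ext_getD (by simp [slices]) hL fun T hT => ?_⟩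
  have e : ((slices r free).map (fun v => v.testBit i)).getD T false =
      (bif free.contains T then (truthCols free.length).getD (free.idxOf T) 0
        else bif r.testBit T then 2 ^ 2 ^ free.length - 1 else 0).testBit i := by
    simp [slices, List.getD_eq_getElem?_getD, hT]
  rw [e]
  by_cases hf : T ∈ free
  · have h1 := List.idxOf_lt_length_of_mem hf
    have h2 : ((truthCols free.length).map (fun v => v.testBit i)).getD (free.idxOf T) false
        = ((truthCols free.length).getD (free.idxOf T) 0).testBit i := by
      simp only [List.getD_eq_getElem?_getD, List.getElem?_map, ← Nat.zero_testBit i,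
        Option.getD_map]
    have h3 : free.contains T = true := by simpa using hf
    rw [h3, cond_true, ← h2, hm]
    simp [List.getD_eq_getElem?_getD, h1]
  · rw [h T hT hf]
    have : free.contains T = false := by simpa using hf
    rw [this]
    cases r.testBit T <;> simp [Nat.testBit_two_pow_sub_one, hi]

lemma testBit_neqSlice {k i : ℕ} (hi : i < 2 ^ k) {W : List ℕ} (hW : W.length = 56) {c : ℕ}
    (h : (neqSlice (2 ^ 2 ^ k - 1) W c).testBit i = false) :
    W.map (fun v => v.testBit i) = bitsOf c := by
  have foldr_or : ∀ X : List ℕ, (X.foldr (· ||| ·) 0).testBit i = false →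
      ∀ v ∈ X, v.testBit i = false := by
    intro X
    induction X with
    | nil => simp
    | cons a X ih =>
      intro h v hv
      simp only [List.foldr_cons, Nat.testBit_or, Bool.or_eq_false_iff] at h
      rcases List.mem_cons.mp hv with rfl | hv
      · exact h.1
      · exact ih h.2 v hv
  have h1 := foldr_or _ h
  refine List.ext_getElem (by simp [hW, length_bitsOf]) fun T hT1 hT2 => ?_
  have h3 : T < W.length := by simpa using hT1
  have := h1 _ (List.getElem_mem (n := T) (by simp [h3, hT2]))
  simp only [List.getElem_zipWith, Nat.testBit_xor] at this
  simp only [List.getElem_map]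
  revert this
  cases (bitsOf c)[T] <;> simp [Nat.testBit_two_pow_sub_one, hi]

lemma plan_local : ∀ n < 9, ∀ b < n - 1, ∀ T < 56,
    ((plan (n - 1) b).getD T none).all
      (fun u => decide (u < 56 ∧ (u < ch3 (n - 1) ∨ ch3 n ≤ u))) = true := by
  decide +kernel

/-- The tensor `L` agrees with `r` outside the triples with largest entry `n - 1`. -/
def Extends (n r : ℕ) (L : List Bool) : Prop :=
  ∀ T < 56, (T < ch3 (n - 1) ∨ ch3 n ≤ T) → L.getD T false = r.testBit T

lemma getD_tau_xor {n b : ℕ} (hn : n < 9) (hb : b < n - 1) {L M : List Bool}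
    (hL : L.length = 56) (hM : M.length = 56)
    (h : ∀ T < 56, (T < ch3 (n - 1) ∨ ch3 n ≤ T) → L.getD T false = M.getD T false)
    {T : ℕ} (hT : T < 56) :
    ((tau xor (n - 1) b L).getD T false ^^ (tau xor (n - 1) b M).getD T false) =
      (L.getD T false ^^ M.getD T false) := by
  rw [getD_tau _ _ hL hT, getD_tau _ _ hM hT]
  have hp := plan_local n hn b hb T hT
  revert hp
  cases (plan (n - 1) b).getD T none with
  | none => simp
  | some u =>
    intro hp
    have hu : u < 56 ∧ (u < ch3 (n - 1) ∨ ch3 n ≤ u) := by simpa using hp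
    have key : ∀ K : List Bool, K.length = 56 → ∀ d, K.getD u d = K.getD u false := fun K hK d => by
      rw [List.getD_eq_getElem _ _ (by omega), List.getD_eq_getElem _ _ (by omega)]
    simp only [key L hL, key M hM, h u hu.1 hu.2]
    generalize L.getD T false = p
    generalize M.getD T false = q
    generalize M.getD u false = s
    revert p q s; decide

lemma getD_act_xor {n : ℕ} (hn : n < 9) (w : List (ℕ × ℕ))
    (hw : ∀ t ∈ w, t.1 = n - 1 ∧ t.2 < n - 1) {L M : List Bool}
    (hL : L.length = 56) (hM : M.length = 56)
    (h : ∀ T < 56, (T < ch3 (n - 1) ∨ ch3 n ≤ T) → L.getD T false = M.getD T false)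
    {T : ℕ} (hT : T < 56) :
    ((act xor w L).getD T false ^^ (act xor w M).getD T false) =
      (L.getD T false ^^ M.getD T false) := by
  induction w generalizing L M with
  | nil => rfl
  | cons t w ih =>
    obtain ⟨a, b⟩ := t
    obtain ⟨rfl, hb⟩ := hw (a, b) (by simp)
    have step := fun T hT => getD_tau_xor hn hb hL hM h (T := T) hT
    have := ih (fun t ht => hw t (by simp [ht])) (length_tau xor (n - 1) b hL)
      (length_tau xor (n - 1) b hM) (fun T hT hz => by
        have := step T hT
        rw [h T hT hz, Bool.xor_self] at this
        simpa using this)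
    exact this.trans (step T hT)

lemma act_shear {n r : ℕ} (hn : n < 9) {w : List (ℕ × ℕ)}
    (hw : ∀ t ∈ w, t.1 = n - 1 ∧ t.2 < n - 1) {L : List Bool} (hL : L.length = 56)
    (h : Extends n r L) : act xor w L = List.zipWith xor L (shearMask r w) := by
  have h1 := length_act xor w hL
  have h2 := length_act xor w (length_bitsOf r)
  refine ext_getD h1 (by simp [shearMask, h2, hL, length_bitsOf]) fun T hT => ?_
  have := getD_act_xor hn w hw hL (length_bitsOf r)
    (fun T hT hz => by rw [h T hT hz, getD_bitsOf r hT]) hT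
  have e : (List.zipWith xor L (shearMask r w)).getD T false = (L.getD T false ^^
      ((act xor w (bitsOf r)).getD T false ^^ (bitsOf r).getD T false)) := by
    have h3 : T < L.length := by omega
    have h4 : T < (act xor w (bitsOf r)).length := by omega
    have h5 : T < (bitsOf r).length := by rw [length_bitsOf]; omega
    simp only [shearMask, List.getD_eq_getElem?_getD, List.getElem?_zipWith,
      List.getElem?_eq_getElem h3, List.getElem?_eq_getElem h4, List.getElem?_eq_getElem h5]
    rfl
  rw [e]
  revert this
  generalize (act xor w L).getD T false = a
  generalize (act xor w (bitsOf r)).getD T false = b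
  generalize L.getD T false = c
  generalize (bitsOf r).getD T false = d
  revert a b c d; decide

lemma of_act {n : ℕ} {Q : List Bool → Prop}
    (hQ : ∀ a < n, ∀ b < n, a ≠ b → ∀ L : List Bool, L.length = 56 → Q (tau xor a b L) → Q L)
    (w : List (ℕ × ℕ)) (hw : ∀ t ∈ w, t.1 < n ∧ t.2 < n ∧ t.1 ≠ t.2) {L : List Bool}
    (hL : L.length = 56) (h : Q (act xor w L)) : Q L := by
  induction w generalizing L with
  | nil => exact h
  | cons t w ih =>
    obtain ⟨h1, h2, h3⟩ := hw t (by simp)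
    exact hQ _ h1 _ h2 h3 L hL
      (ih (fun t ht => hw t (by simp [ht])) (length_tau xor t.1 t.2 hL) h)

lemma getD_redWith {W : List Bool} (hW : W.length = 56) {pm : ℕ × List Bool}
    (hm : pm.2.length = 56) {T : ℕ} (hT : T < 56) :
    (redWith xor false W pm).getD T false =
      (W.getD T false ^^ (pm.2.getD T false && W.getD pm.1 false)) := by
  have h1 : T < W.length := by omega
  have h2 : T < pm.2.length := by omega
  simp only [redWith, List.getD_eq_getElem?_getD, List.getElem?_zipWith,
    List.getElem?_eq_getElem h1, List.getElem?_eq_getElem h2]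
  cases pm.2[T] <;> simp

lemma of_redWith {n r : ℕ} (hn : n < 9) {Q : List Bool → Prop}
    (hQ : ∀ a < n, ∀ b < n, a ≠ b → ∀ L : List Bool, L.length = 56 → Q (tau xor a b L) → Q L)
    {w : List (ℕ × ℕ)} (hw : ∀ t ∈ w, t.1 = n - 1 ∧ t.2 < n - 1)
    {W : List Bool} (hW : W.length = 56) (hE : Extends n r W) {p : ℕ}
    (h : Q (redWith xor false W (p, shearMask r w))) : Q W := by
  have hm : (shearMask r w).length = 56 := by
    simp [shearMask, length_act xor w (length_bitsOf r), length_bitsOf]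
  cases hp : W.getD p false with
  | false =>
    have : redWith xor false W (p, shearMask r w) = W :=
      ext_getD (length_redWith _ _ hW hm) hW fun T hT => by
        rw [getD_redWith hW hm hT]; simp only [hp, Bool.and_false, Bool.xor_false]
    rwa [this] at h
  | true =>
    refine of_act hQ w (fun t ht => ?_) hW ?_
    · obtain ⟨h1, h2⟩ := hw t ht
      omega
    · rw [act_shear hn hw hW hE]
      have : redWith xor false W (p, shearMask r w) = List.zipWith xor W (shearMask r w) := by
        simp only [redWith, hp]
        rw [List.zipWith_comm]
        congr 1
        funext a b
        cases b <;> simp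
      rwa [this] at h

lemma extends_redWith {n r : ℕ} {W : List Bool} (hW : W.length = 56) (hE : Extends n r W)
    {pm : ℕ × List Bool} (hm : pm.2.length = 56) (hz : Extends n 0 pm.2) :
    Extends n r (redWith xor false W pm) := fun T hT h => by
  rw [getD_redWith hW hm hT, hE T hT h, hz T hT h]
  simp

lemma length_shearMask (r : ℕ) (w : List (ℕ × ℕ)) : (shearMask r w).length = 56 := by
  simp [shearMask, length_act xor w (length_bitsOf r), length_bitsOf]

lemma of_redAll {n r : ℕ} (hn : n < 9) {Q : List Bool → Prop}
    (hQ : ∀ a < n, ∀ b < n, a ≠ b → ∀ L : List Bool, L.length = 56 → Q (tau xor a b L) → Q L)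
    (pw : List (ℕ × List (ℕ × ℕ))) (hw : ∀ q ∈ pw, ∀ t ∈ q.2, t.1 = n - 1 ∧ t.2 < n - 1)
    (hz : ∀ q ∈ pw, Extends n 0 (shearMask r q.2))
    {W : List Bool} (hW : W.length = 56) (hE : Extends n r W)
    (h : Q (redAll xor false (pw.map fun q => (q.1, shearMask r q.2)) W)) : Q W := by
  induction pw generalizing W with
  | nil => exact h
  | cons q pw ih =>
    have hm : ((q.1, shearMask r q.2) : ℕ × List Bool).2.length = 56 := length_shearMask r q.2
    have := ih (fun q' hq' => hw q' (by simp [hq'])) (fun q' hq' => hz q' (by simp [hq']))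
      (length_redWith xor false hW hm) (extends_redWith hW hE hm (hz q (by simp))) h
    exact of_redWith hn hQ (hw q (by simp)) hW hE this

lemma length_redAll (pivs : List (ℕ × List Bool)) (hl : ∀ q ∈ pivs, q.2.length = 56)
    {W : List Bool} (hW : W.length = 56) : (redAll xor false pivs W).length = 56 := by
  induction pivs generalizing W with
  | nil => exact hW
  | cons q pivs ih =>
    exact ih (fun q' hq' => hl q' (by simp [hq'])) (length_redWith xor false hW (hl q (by simp)))

lemma getD_redAll {n : ℕ} (pivs : List (ℕ × List Bool)) (hl : ∀ q ∈ pivs, q.2.length = 56)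
    (hz : ∀ q ∈ pivs, Extends n 0 q.2) {W : List Bool} (hW : W.length = 56)
    {T : ℕ} (hT : T < 56) (h : T < ch3 (n - 1) ∨ ch3 n ≤ T) :
    (redAll xor false pivs W).getD T false = W.getD T false := by
  induction pivs generalizing W with
  | nil => rfl
  | cons q pivs ih =>
    have h1 := ih (fun q' hq' => hl q' (by simp [hq'])) (fun q' hq' => hz q' (by simp [hq']))
      (length_redWith xor false hW (hl q (by simp)))
    rw [getD_redWith hW (hl q (by simp)) hT, hz q (by simp) T hT h,
      Nat.zero_testBit, Bool.false_and, Bool.xor_false] at h1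
    exact h1

lemma getD_redAll_pivot (pivs l : List (ℕ × List Bool)) (hsub : ∀ q ∈ l, q ∈ pivs)
    (hl : ∀ q ∈ pivs, q.2.length = 56 ∧ q.1 < 56)
    (hp : ∀ q ∈ pivs, ∀ q' ∈ pivs, q.2.getD q'.1 false = (q.1 == q'.1))
    {W : List Bool} (hW : W.length = 56) {q : ℕ × List Bool} (hq : q ∈ pivs)
    (h : W.getD q.1 false = false ∨ q ∈ l) : (redAll xor false l W).getD q.1 false = false := by
  induction l generalizing W with
  | nil => simpa [redAll] using h
  | cons s l ih =>
    have hs := hsub s (by simp)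
    refine ih (fun q' hq' => hsub q' (by simp [hq'])) (length_redWith xor false hW (hl s hs).1) ?_
    by_cases hql : q ∈ l
    · exact Or.inr hql
    · left
      rw [getD_redWith hW (hl s hs).1 (hl q hq).2, hp s hs q hq]
      by_cases e : s.1 = q.1
      · rw [e]; simp
      · have h1 : (s.1 == q.1) = false := by simpa using e
        rw [h1, Bool.false_and, Bool.xor_false]
        rcases h with h | h
        · exact h
        · rcases List.mem_cons.mp h with rfl | h
          · exact absurd rfl e
          · exact absurd h hql

lemma exists_mem_of_testBit_foldr {i : ℕ} (X : List ℕ)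
    (h : (X.foldr (· ||| ·) 0).testBit i = true) : ∃ v ∈ X, v.testBit i = true := by
  induction X with
  | nil => simp at h
  | cons a X ih =>
    simp only [List.foldr_cons, Nat.testBit_or, Bool.or_eq_true] at h
    rcases h with h | h
    · exact ⟨a, by simp, h⟩
    · obtain ⟨v, hv, hb⟩ := ih h
      exact ⟨v, by simp [hv], hb⟩

theorem stage_sound {n r : ℕ} {free : List ℕ} {pw : List (ℕ × List (ℕ × ℕ))}
    {gens : List (List (ℕ × ℕ))} {mins : List ℕ} (hok : stageOk n r free pw gens mins = true)
    {Q : List Bool → Prop}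
    (hQ : ∀ a < n, ∀ b < n, a ≠ b → ∀ L : List Bool, L.length = 56 → Q (tau xor a b L) → Q L)
    (hmin : ∀ c ∈ mins, Q (bitsOf c)) {L : List Bool} (hL : L.length = 56)
    (hE : Extends n r L) : Q L := by
  simp only [stageOk, Bool.and_eq_true, List.all_eq_true, List.mem_map, List.mem_range,
    List.mem_filter, Nat.ble_eq, Nat.blt_eq, beq_iff_eq, Bool.or_eq_true, Bool.not_eq_true',
    Nat.beq_eq, forall_exists_index, and_imp, forall_apply_eq_imp_iff₂, List.any_eq_true] at hok
  obtain ⟨⟨⟨⟨⟨⟨⟨⟨hn, hpw⟩, hpp⟩, hpz⟩, hcover⟩, hfz⟩, hgens⟩, himg⟩, hone⟩ := hok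
  have hn9 : n < 9 := by omega
  set pivs := pw.map fun q => (q.1, shearMask r q.2) with hpivs
  have hw : ∀ q ∈ pw, ∀ t ∈ q.2, t.1 = n - 1 ∧ t.2 < n - 1 := fun q hq t ht => by
    have := hpw q hq t ht
    omega
  have hz : ∀ q ∈ pw, Extends n 0 (shearMask r q.2) := fun q hq T hT h => by
    rw [Nat.zero_testBit]
    rcases (hpz q hq).2 T hT with h' | h'
    · simp only [Bool.or_eq_false_iff] at h'
      rcases h with h | h
      · have := Nat.blt_eq.mpr h
        rw [this] at h'
        exact absurd h'.1 (by decide)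
      · have := Nat.ble_eq.mpr h
        rw [this] at h'
        exact absurd h'.2 (by decide)
    · exact h'
  have hz' : ∀ q ∈ pivs, Extends n 0 q.2 := fun q hq => by
    obtain ⟨q', hq', rfl⟩ := List.mem_map.mp hq
    exact hz q' hq'
  have hp : ∀ q ∈ pivs, ∀ q' ∈ pivs, q.2.getD q'.1 false = (q.1 == q'.1) := fun q hq q' hq' => by
    obtain ⟨s, hs, rfl⟩ := List.mem_map.mp hq
    obtain ⟨s', hs', rfl⟩ := List.mem_map.mp hq'
    exact (hpp s hs).1 s' hs'
  have hl : ∀ q ∈ pivs, q.2.length = 56 ∧ q.1 < 56 := fun q hq => by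
    obtain ⟨s, hs, rfl⟩ := List.mem_map.mp hq
    refine ⟨length_shearMask r s.2, ?_⟩
    have h1 := hp _ hq _ hq
    simp only [BEq.rfl] at h1
    by_contra hc
    rw [List.getD_eq_default _ _ (by rw [length_shearMask]; exact not_lt.mp hc)] at h1
    exact absurd h1 (by decide)
  have main : ∀ N, ∀ L : List Bool, val L = N → L.length = 56 →
      (∀ T < 56, T ∉ free → L.getD T false = r.testBit T) → Q L := by
    intro N
    induction N using Nat.strong_induction_on with
    | _ N ih =>
    intro L hN hL hfree
    obtain ⟨i, hi, hS⟩ := exists_slice hL hfree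
    have hb := congrArg (fun x => x.testBit i) hone
    simp only [Nat.testBit_two_pow_sub_one, hi, decide_true, Nat.testBit_or] at hb
    rcases Bool.or_eq_true_iff.mp hb.symm with hb | hb
    · obtain ⟨v, hv, hvi⟩ := exists_mem_of_testBit_foldr _ hb
      simp only [List.map_map, List.mem_map, Function.comp] at hv
      obtain ⟨g, hg, rfl⟩ := hv
      have hF : (redAll Nat.xor 0 pivs (act Nat.xor g (slices r free))).map
          (fun v => v.testBit i) = redAll xor false pivs (act xor g L) := by
        rw [map_redAll Nat.xor xor (fun v => v.testBit i) (fun a b => Nat.testBit_xor a b i),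
          map_act Nat.xor xor (fun v => v.testBit i) (fun a b => Nat.testBit_xor a b i), hS,
          Nat.zero_testBit]
      set F := redAll xor false pivs (act xor g L) with hFdef
      have hgetF : ∀ T < 56, T ∉ free → F.getD T false = r.testBit T := fun T hT hTf => by
        have h1 := himg g hg T hT (by simpa using hTf)
        have h2 : ∀ W : List ℕ, (W.map fun v => v.testBit i).getD T false
            = (W.getD T 0).testBit i := fun W => by
          simp only [List.getD_eq_getElem?_getD, List.getElem?_map, ← Nat.zero_testBit i,
            Option.getD_map]
        rw [← hF, h2, h1, ← h2, hS, hfree T hT hTf]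
      rw [map_ltAcc Nat.xor Nat.land xor and (fun v => v.testBit i)
        (fun a b => Nat.testBit_xor a b i) (fun a b => Nat.testBit_and a b i), hF, hS,
        Nat.zero_testBit] at hvi
      have hact := length_act xor g hL
      have hFl : F.length = 56 :=
        length_redAll _ (fun q hq => (hl q hq).1) hact
      have hlt : val F < val L := by
        rcases val_of_ltAcc false (by omega) hvi with h | h
        · exact h
        · exact absurd h.2 (by decide)
      have hQF : Q F := ih (val F) (by omega) F rfl hFl hgetF
      refine of_act hQ g (fun t ht => ?_) hL (of_redAll hn9 hQ pw hw hz hact ?_ hQF)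
      · obtain ⟨⟨h1, h2⟩, h3⟩ := hgens g hg t ht
        exact ⟨h1, h2, by simpa using h3⟩
      · intro T hT h
        rw [← hgetF T hT fun hTf => ?_, hFdef,
          getD_redAll pivs (fun q hq => (hl q hq).1) hz' hact hT h]
        have := hfz T hTf
        omega
    · obtain ⟨v, hv, hvi⟩ := exists_mem_of_testBit_foldr _ hb
      obtain ⟨c, hc, rfl⟩ := List.mem_map.mp hv
      simp only [Nat.testBit_xor, Nat.testBit_two_pow_sub_one, hi, decide_true,
        Bool.true_xor, Bool.not_eq_true'] at hvi
      have := testBit_neqSlice hi (by simp [slices]) hvi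
      rw [← hS, this]
      exact hmin c hc
  have hl' := fun q hq => (hl q hq).1
  refine of_redAll hn9 hQ pw hw hz hL hE
    (main _ _ rfl (length_redAll pivs hl' hL) fun T hT hTf => ?_)
  rcases hcover T hT with ((h | h) | h) | ⟨q, hq, rfl⟩
  · rw [getD_redAll pivs hl' hz' hL hT (Or.inl h), hE T hT (Or.inl h)]
  · rw [getD_redAll pivs hl' hz' hL hT (Or.inr h), hE T hT (Or.inr h)]
  · exact absurd (by simpa using h) hTf
  · have hq' : q ∈ pivs := List.mem_map.mpr hq
    obtain ⟨s, hs, rfl⟩ := hq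
    rw [(hpp s hs).2]
    exact getD_redAll_pivot pivs pivs (fun _ h => h) hl hp hL hq' (Or.inr hq')

end Stages

section Classification

/-- Every property of tensors that can be checked after substitutions holds for `L`, if it holds
for all tensors coded by `R`. -/
def Reduces (n : ℕ) (R : List ℕ) (L : List Bool) : Prop :=
  ∀ Q : List Bool → Prop,
    (∀ a < n, ∀ b < n, a ≠ b → ∀ L : List Bool, L.length = 56 → Q (tau xor a b L) → Q L) →
    (∀ r ∈ R, Q (bitsOf r)) → Q L

/-- The numbers in `R` code representatives of all alternating tensors in `n` variables. -/
def Classifies (n : ℕ) (R : List ℕ) : Prop :=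
  ∀ L : List Bool, L.length = 56 → (∀ T < 56, ch3 n ≤ T → L.getD T false = false) → Reduces n R L

/-- Certificate check: the tensors in `mins` are equivalent to those in `R`. -/
def wordsOk (n : ℕ) (R : List ℕ) (mins : List (ℕ × ℕ × List (ℕ × ℕ))) : Bool :=
  mins.all fun c => R.contains c.2.1 &&
    c.2.2.all (fun t => Nat.blt t.1 n && Nat.blt t.2 n && !(t.1 == t.2)) &&
    act xor c.2.2 (bitsOf c.1) == bitsOf c.2.1

lemma reduces_of_stageOk {n r : ℕ} {free : List ℕ} {pw : List (ℕ × List (ℕ × ℕ))}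
    {gens : List (List (ℕ × ℕ))} {mins : List (ℕ × ℕ × List (ℕ × ℕ))} {R : List ℕ}
    (hok : (stageOk n r free pw gens (mins.map Prod.fst) && wordsOk n R mins) = true)
    (L : List Bool) (hL : L.length = 56) (hE : Extends n r L) : Reduces n R L := by
  rw [Bool.and_eq_true] at hok
  intro Q hQ hR
  refine stage_sound hok.1 hQ (fun c hc => ?_) hL hE
  obtain ⟨d, hd, rfl⟩ := List.mem_map.mp hc
  have := List.all_eq_true.mp hok.2 d hd
  simp only [Bool.and_eq_true, List.contains_iff_mem, List.all_eq_true, Nat.blt_eq,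
    Bool.not_eq_true', beq_eq_false_iff_ne, beq_iff_eq] at this
  obtain ⟨⟨h1, h2⟩, h3⟩ := this
  refine of_act hQ d.2.2 (fun t ht => ⟨(h2 t ht).1.1, (h2 t ht).1.2, (h2 t ht).2⟩)
    (length_bitsOf _) ?_
  rw [h3]
  exact hR _ h1

lemma plan_lower : ∀ n < 9, ∀ a < n - 1, ∀ b < n - 1, ∀ T < 56,
    ((plan a b).getD T none).all (fun u => decide (u < 56 ∧ (T < ch3 (n - 1) → u < ch3 (n - 1)) ∧
      (ch3 n ≤ T → ch3 n ≤ u))) = true := by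
  decide +kernel

/-- Reduction of a property of tensors in `n` variables to tensors in `n - 1` variables. -/
lemma of_classifies {n m : ℕ} (hn : n < 9) (hm : n - 1 = m) {R : List ℕ} (hC : Classifies m R)
    {Q : List Bool → Prop}
    (hQ : ∀ a < n, ∀ b < n, a ≠ b → ∀ L : List Bool, L.length = 56 → Q (tau xor a b L) → Q L)
    (hR : ∀ r ∈ R, ∀ L : List Bool, L.length = 56 →
      (∀ T < 56, T < ch3 m → L.getD T false = r.testBit T) →
      (∀ T < 56, ch3 n ≤ T → L.getD T false = false) → Q L)
    (L : List Bool) (hL : L.length = 56) (h0 : ∀ T < 56, ch3 n ≤ T → L.getD T false = false) :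
    Q L := by
  let K : List Bool := (List.range 56).map fun T => decide (T < ch3 m) && L.getD T false
  have hK : ∀ T < 56, K.getD T false = (decide (T < ch3 m) && L.getD T false) := fun T hT => by
    simp [K, List.getD_eq_getElem?_getD, hT]
  have hKl : K.length = 56 := by simp [K]
  have := hC K hKl (fun T hT h => by
    rw [hK T hT, decide_eq_false (not_lt.mpr h), Bool.false_and])
    (fun K => ∀ L : List Bool, L.length = 56 →
      (∀ T < 56, T < ch3 m → L.getD T false = K.getD T false) →
      (∀ T < 56, ch3 n ≤ T → L.getD T false = false) → K.length = 56 → Q L)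
    (fun a ha b hb hab K hK h L hL h1 h2 _ => ?_)
    (fun r hr L hL h1 h2 _ => hR r hr L hL
      (fun T hT h => by rw [h1 T hT h, getD_bitsOf r hT]) h2)
  · exact this L hL (fun T hT h => by rw [hK T hT, decide_eq_true h, Bool.true_and]) h0 hKl
  · have hp := plan_lower n hn a (by omega) b (by omega)
    have key : ∀ K : List Bool, K.length = 56 → ∀ u < 56, ∀ d, K.getD u d = K.getD u false :=
      fun K hK u hu d => by
        rw [List.getD_eq_getElem _ _ (by omega), List.getD_eq_getElem _ _ (by omega)]
    refine hQ a (by omega) b (by omega) hab L hL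
      (h _ (length_tau xor a b hL) (fun T hT hT' => ?_) (fun T hT hT' => ?_)
        (length_tau xor a b hK))
    · rw [getD_tau a b hL hT, getD_tau a b hK hT, h1 T hT hT']
      have := hp T hT
      revert this
      cases (plan a b).getD T none with
      | none => intro _; rfl
      | some u =>
        intro this
        have hu : u < 56 ∧ (T < ch3 (n - 1) → u < ch3 (n - 1)) ∧ (ch3 n ≤ T → ch3 n ≤ u) :=
          of_decide_eq_true this
        have := hu.2.1 (by rwa [hm])
        rw [hm] at this
        simp only [key L hL u hu.1, key K hK u hu.1, h1 u hu.1 this]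
    · rw [getD_tau a b hL hT, h2 T hT hT']
      have := hp T hT
      revert this
      cases (plan a b).getD T none with
      | none => intro _; rfl
      | some u =>
        intro this
        have hu : u < 56 ∧ (T < ch3 (n - 1) → u < ch3 (n - 1)) ∧ (ch3 n ≤ T → ch3 n ≤ u) :=
          of_decide_eq_true this
        simp only [h2 u hu.1 (hu.2.2 hT'), Bool.xor_false]

lemma Classifies.succ {n m : ℕ} (hn : n < 9) (hm : n - 1 = m) {R R' : List ℕ}
    (hC : Classifies m R) (hR : ∀ r ∈ R, r < 2 ^ ch3 m)
    (h : ∀ r ∈ R, ∀ L : List Bool, L.length = 56 → Extends n r L → Reduces n R' L) :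
    Classifies n R' := fun L hL h0 Q hQ hQR =>
  of_classifies hn hm hC hQ (fun r hr L hL h1 h2 => h r hr L hL (fun T hT hT' => by
    rw [hm] at hT'
    rcases hT' with hT' | hT'
    · exact h1 T hT hT'
    · rw [h2 T hT hT', Nat.testBit_lt_two_pow ((hR r hr).trans_le
        (Nat.pow_le_pow_right (by norm_num) (le_trans ?_ hT')))]
      rw [← hm]
      have : ∀ n < 9, ch3 (n - 1) ≤ ch3 n := by decide
      exact this n hn) Q hQ hQR) L hL h0

end Classification

section Certificates

/-- Codes of alternating tensors in 3 variables. -/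
def reps3 : List ℕ := [0, 1]

/-- Codes of alternating tensors in 4 variables. -/
def reps4 : List ℕ := [0, 1]

/-- Codes of alternating tensors in 5 variables. -/
def reps5 : List ℕ := [0, 1, 192]

/-- Codes of alternating tensors in 6 variables. -/
def reps6 : List ℕ := [0, 1, 192, 81921, 524289, 22720]

/-- Codes of alternating tensors in 7 variables. -/
def reps7 : List ℕ := [0, 1, 192, 81921, 524289, 22720, 1241513984, 1241513985,
  1610612737, 1090519232, 17202938048, 167854081]

lemma reduces_3_0 (L : List Bool) (hL : L.length = 56) (hE : Extends 3 0 L) :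
    Reduces 3 reps3 L :=
  reduces_of_stageOk (free := [0])
    (pw :=
      [])
    (gens :=
      [])
    (mins :=
      [(0, 0, [(1, 2), (0, 2), (2, 1), (2, 0), (1, 0), (0, 1)]), (1, 1, [])])
    (by decide +kernel) L hL hE

lemma reduces_4_0 (L : List Bool) (hL : L.length = 56) (hE : Extends 4 0 L) :
    Reduces 4 reps4 L :=
  reduces_of_stageOk (free := [1, 2, 3])
    (pw :=
      [])
    (gens :=
      [[(0, 1), (1, 0)], [(1, 2), (2, 1)]])
    (mins :=
      [(0, 0, [(1, 3), (3, 2), (1, 2), (2, 3), (3, 1), (2, 1), (3, 0), (1, 0), (0, 1)]), (2, 1,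
       [(2, 3), (1, 3), (3, 2), (1, 2), (0, 2), (2, 1), (1, 2), (2, 0), (1, 0), (0, 1)])])
    (by decide +kernel) L hL hE

lemma reduces_4_1 (L : List Bool) (hL : L.length = 56) (hE : Extends 4 1 L) :
    Reduces 4 reps4 L :=
  reduces_of_stageOk (free := [])
    (pw :=
      [(3, [(3, 0)]), (2, [(3, 1)]), (1, [(3, 2)])])
    (gens :=
      [])
    (mins :=
      [(1, 1, [(2, 3), (1, 3), (1, 2), (0, 2), (2, 0), (0, 2)])])
    (by decide +kernel) L hL hE

lemma reduces_5_0 (L : List Bool) (hL : L.length = 56) (hE : Extends 5 0 L) :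
    Reduces 5 reps5 L :=
  reduces_of_stageOk (free := [4, 5, 6, 7, 8, 9])
    (pw :=
      [])
    (gens :=
      [[(0, 1), (1, 0)], [(1, 2), (2, 1)], [(1, 3)], [(1, 3), (3, 1)]])
    (mins :=
      [(0, 0, [(3, 4), (1, 4), (4, 3), (2, 3), (1, 3), (0, 3), (3, 1), (2, 1), (1, 2), (3, 0),
       (2, 0)]), (16, 1, [(2, 4), (1, 4), (0, 3), (4, 2), (1, 2), (0, 2), (2, 4), (2, 1), (0,
       1), (1, 2), (2, 0)]), (192, 192, [])])
    (by decide +kernel) L hL hE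

lemma reduces_5_1 (L : List Bool) (hL : L.length = 56) (hE : Extends 5 1 L) :
    Reduces 5 reps5 L :=
  reduces_of_stageOk (free := [7, 8, 9])
    (pw :=
      [(6, [(4, 0)]), (5, [(4, 1)]), (4, [(4, 2)])])
    (gens :=
      [[(0, 1), (1, 0)], [(0, 2), (2, 0)]])
    (mins :=
      [(1, 1, [(3, 4), (2, 4), (1, 4), (4, 3), (2, 3), (1, 3), (0, 3), (3, 4), (0, 2), (0, 1),
       (2, 0), (1, 0)]), (129, 192, [(2, 4), (0, 4), (4, 3), (2, 3), (3, 4), (3, 2), (1, 2), (0,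
       2), (2, 3), (4, 1), (3, 1), (2, 1), (0, 1), (4, 0), (0, 4)])])
    (by decide +kernel) L hL hE

lemma reduces_6_0 (L : List Bool) (hL : L.length = 56) (hE : Extends 6 0 L) :
    Reduces 6 reps6 L :=
  reduces_of_stageOk (free := [10, 11, 12, 13, 14, 15, 16, 17, 18, 19])
    (pw :=
      [])
    (gens :=
      [[(0, 1), (1, 0)], [(1, 2), (2, 1)], [(2, 3), (3, 2)], [(3, 4), (4, 3)], [(0, 2), (2, 4)]])
    (mins :=
      [(0, 0, [(4, 5), (1, 5), (5, 4), (3, 4), (0, 4), (4, 5), (4, 3), (0, 3), (3, 4), (5, 2),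
       (3, 2), (1, 2), (5, 1), (3, 1), (2, 1), (5, 0), (4, 0), (3, 0), (1, 0)]), (1024, 1, [(4,
       5), (3, 5), (1, 5), (0, 5), (3, 4), (2, 4), (0, 4), (2, 3), (1, 3), (0, 3), (5, 2), (4,
       2), (1, 2), (0, 2), (2, 4), (2, 1), (1, 2), (2, 0), (1, 0), (0, 1)]), (12288, 192, [(4,
       5), (3, 5), (1, 5), (0, 5), (5, 4), (3, 4), (1, 4), (0, 4), (4, 3), (0, 3), (3, 2), (1,
       2), (3, 1), (4, 0), (2, 0), (1, 0)])])
    (by decide +kernel) L hL hE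

lemma reduces_6_1 (L : List Bool) (hL : L.length = 56) (hE : Extends 6 1 L) :
    Reduces 6 reps6 L :=
  reduces_of_stageOk (free := [13, 14, 15, 16, 17, 18, 19])
    (pw :=
      [(12, [(5, 0)]), (11, [(5, 1)]), (10, [(5, 2)])])
    (gens :=
      [[(0, 1), (1, 0)], [(1, 2), (2, 1)], [(0, 3), (3, 4)], [(0, 4), (3, 4), (4, 3)]])
    (mins :=
      [(1, 1, [(4, 3), (2, 3), (1, 3), (0, 3), (3, 4), (1, 2), (2, 1), (1, 2), (2, 0), (0, 2)]),
       (8193, 192, [(4, 5), (3, 5), (1, 5), (5, 4), (1, 3), (0, 3), (4, 2), (3, 2), (2, 1), (0,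
       1), (1, 2), (4, 0), (0, 4)]), (81921, 81921, []), (524289, 524289, [])])
    (by decide +kernel) L hL hE

lemma reduces_6_2 (L : List Bool) (hL : L.length = 56) (hE : Extends 6 192 L) :
    Reduces 6 reps6 L :=
  reduces_of_stageOk (free := [10, 11, 12, 14, 15])
    (pw :=
      [(19, [(5, 0)]), (18, [(5, 1)]), (17, [(5, 2)]), (16, [(5, 3)]), (13, [(5, 4)])])
    (gens :=
      [[(1, 2), (2, 1)], [(0, 3)], [(0, 3), (3, 0)], [(0, 1), (2, 3)], [(0, 2), (1, 3)]])
    (mins :=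
      [(192, 192, [(4, 5), (3, 5), (2, 5), (0, 5), (2, 3), (1, 3), (3, 2), (1, 2), (4, 1), (3,
       1), (2, 1), (0, 1), (1, 2), (4, 0), (1, 0)]), (1216, 81921, [(2, 5), (1, 5), (0, 5), (5,
       4), (4, 5), (4, 3), (0, 3), (3, 4), (4, 2), (3, 2), (0, 2), (5, 0), (1, 0)]), (4288,
       524289, [(4, 5), (1, 5), (0, 5), (5, 4), (4, 5), (5, 3), (4, 3), (3, 4), (5, 2), (4, 2),
       (3, 2), (1, 2), (0, 2), (2, 3), (2, 1), (5, 0), (4, 0), (3, 0), (0, 3)]), (22720, 22720,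
       [])])
    (by decide +kernel) L hL hE

lemma reduces_7_0 (L : List Bool) (hL : L.length = 56) (hE : Extends 7 0 L) :
    Reduces 7 reps7 L :=
  reduces_of_stageOk (free := [20, 21, 22, 23, 24, 25, 26, 27, 28, 29, 30, 31, 32, 33, 34])
    (pw :=
      [])
    (gens :=
      [[(0, 1), (1, 0)], [(1, 2), (2, 1)], [(2, 3), (3, 2)], [(0, 4)], [(3, 4), (4, 3)], [(2,
       4)], [(1, 0), (4, 5), (5, 4), (0, 4)], [(0, 2)], [(0, 3)]])
    (mins :=
      [(0, 0, [(5, 6), (4, 6), (2, 6), (4, 5), (3, 5), (6, 4), (2, 4), (1, 4), (0, 4), (4, 6),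
       (5, 3), (1, 3), (0, 3), (6, 2), (4, 2), (0, 2), (4, 1), (3, 1), (2, 1), (0, 1), (6, 0)]),
       (1048576, 1, [(5, 6), (3, 6), (2, 6), (0, 6), (6, 5), (4, 5), (3, 5), (2, 5), (3, 4), (1,
       4), (6, 3), (5, 3), (2, 3), (1, 3), (3, 5), (6, 2), (4, 2), (3, 2), (1, 2), (0, 2), (2,
       3), (2, 1), (1, 0)]), (12582912, 192, [(5, 6), (3, 6), (2, 6), (1, 6), (6, 5), (4, 5),
       (3, 5), (5, 6), (5, 4), (2, 4), (1, 4), (4, 3), (0, 3), (4, 2), (3, 2), (2, 3), (2, 1),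
       (4, 0), (3, 0), (1, 0), (0, 1)]), (1241513984, 1241513984, [])])
    (by decide +kernel) L hL hE

lemma reduces_7_1 (L : List Bool) (hL : L.length = 56) (hE : Extends 7 1 L) :
    Reduces 7 reps7 L :=
  reduces_of_stageOk (free := [23, 24, 25, 26, 27, 28, 29, 30, 31, 32, 33, 34])
    (pw :=
      [(22, [(6, 0)]), (21, [(6, 1)]), (20, [(6, 2)])])
    (gens :=
      [[(0, 1), (1, 0)], [(1, 2), (2, 1)], [(0, 3)], [(3, 4), (4, 3)], [(0, 5), (3, 5)], [(4,
       5)], [(4, 5), (5, 4)], [(3, 4)], [(0, 4)], [(1, 3)], [(1, 4)]])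
    (mins :=
      [(1, 1, [(5, 6), (4, 6), (2, 6), (4, 5), (2, 5), (6, 4), (5, 4), (2, 4), (4, 5), (6, 3),
       (5, 3), (0, 3), (3, 5), (1, 2), (2, 0), (1, 0)]), (8388609, 192, [(5, 6), (4, 6), (6, 5),
       (2, 5), (1, 5), (5, 6), (5, 4), (2, 4), (1, 4), (2, 3), (1, 3), (0, 3), (4, 2), (3, 2),
       (0, 2), (4, 1), (0, 1), (1, 4), (4, 0), (0, 4)]), (83886081, 81921, [(5, 6), (3, 6), (2,
       6), (1, 6), (0, 6), (6, 5), (3, 5), (2, 5), (5, 6), (5, 4), (3, 4), (1, 4), (4, 3), (2,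
       3), (0, 3), (3, 2), (1, 2), (5, 1), (1, 5), (5, 0), (1, 0), (0, 1)]), (536870913, 524289,
       [(5, 6), (3, 6), (6, 5), (4, 5), (2, 5), (5, 6), (3, 4), (2, 4), (0, 4), (5, 3), (2, 3),
       (1, 3), (0, 3), (3, 5), (5, 2), (1, 2), (0, 2), (2, 5), (5, 1), (4, 1), (1, 4), (5, 0),
       (4, 0), (3, 0), (0, 3)]), (1241513985, 1241513985, []), (1610612737, 1610612737, [])])
    (by decide +kernel) L hL hE

lemma reduces_7_2 (L : List Bool) (hL : L.length = 56) (hE : Extends 7 192 L) :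
    Reduces 7 reps7 L :=
  reduces_of_stageOk (free := [20, 21, 22, 24, 25, 30, 31, 32, 33, 34])
    (pw :=
      [(29, [(6, 0)]), (28, [(6, 1)]), (27, [(6, 2)]), (26, [(6, 3)]), (23, [(6, 4)])])
    (gens :=
      [[(1, 2), (2, 1)], [(0, 3), (3, 0)], [(0, 1), (4, 0), (2, 3)], [(2, 5)], [(1, 2), (3, 5)],
       [(0, 5), (1, 5)], [(0, 2), (1, 3)], [(0, 1), (2, 3), (3, 2), (1, 0)]])
    (mins :=
      [(192, 192, [(3, 6), (2, 6), (1, 6), (3, 5), (2, 5), (1, 5), (0, 5), (4, 3), (2, 3), (0,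
       3), (3, 2), (2, 1), (0, 1), (4, 0), (3, 0), (2, 0), (1, 0)]), (1048768, 81921, [(5, 6),
       (4, 6), (6, 5), (4, 5), (3, 5), (0, 5), (5, 6), (5, 4), (0, 4), (4, 5), (3, 2), (0, 2),
       (5, 1), (0, 1), (1, 5), (5, 0)]), (4194496, 524289, [(5, 6), (4, 6), (3, 6), (0, 6), (6,
       5), (3, 5), (1, 5), (0, 5), (5, 6), (3, 4), (2, 4), (1, 4), (0, 4), (5, 3), (1, 3), (4,
       2), (1, 2), (2, 4), (5, 1), (3, 1), (1, 3), (2, 0)]), (23068864, 22720, [(5, 6), (4, 6),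
       (1, 6), (6, 5), (2, 5), (0, 5), (5, 4), (3, 4), (2, 4), (1, 4), (0, 4), (4, 5), (0, 3),
       (3, 2), (1, 2), (2, 3), (4, 1), (0, 1), (1, 4), (5, 0), (0, 5)]), (1073742016,
       1610612737, [(5, 6), (0, 6), (3, 5), (2, 5), (1, 5), (0, 5), (6, 4), (0, 4), (4, 6), (5,
       3), (4, 3), (2, 3), (1, 3), (0, 3), (6, 2), (1, 2), (0, 2), (6, 1), (2, 1), (6, 0), (0,
       6)]), (1090519232, 1090519232, []), (17179869376, 1241513984, [(4, 6), (1, 6), (0, 6),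
       (6, 5), (4, 5), (2, 5), (0, 5), (5, 6), (6, 4), (4, 6), (6, 3), (2, 3), (1, 3), (0, 3),
       (6, 2), (5, 2), (4, 2), (3, 2), (2, 1), (5, 0), (4, 0), (2, 0), (0, 2)]), (17180917952,
       1241513985, [(5, 6), (3, 6), (6, 5), (6, 4), (4, 6), (6, 3), (5, 3), (2, 3), (1, 3), (0,
       3), (3, 5), (3, 2), (2, 3), (2, 1), (0, 1), (6, 0), (1, 0)]), (17184063680, 1610612737,
       [(4, 6), (6, 5), (3, 5), (2, 5), (1, 5), (2, 4), (6, 3), (1, 3), (0, 3), (4, 2), (3, 2),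
       (1, 2), (2, 3), (6, 1), (3, 1), (0, 1), (6, 0), (1, 0)]), (17202938048, 17202938048, [])])
    (by decide +kernel) L hL hE

lemma reduces_7_3 (L : List Bool) (hL : L.length = 56) (hE : Extends 7 81921 L) :
    Reduces 7 reps7 L :=
  reduces_of_stageOk (free := [21, 22, 23, 24, 25, 27, 28, 29, 32])
    (pw :=
      [(34, [(6, 0)]), (33, [(6, 1)]), (20, [(6, 2)]), (31, [(6, 3)]), (30, [(6, 4)]), (26, [(6,
       5)])])
    (gens :=
      [[(0, 2)], [(1, 3)], [(0, 1), (3, 4), (5, 3)], [(5, 1), (1, 5), (2, 4), (4, 2)], [(3, 4),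
       (0, 1), (4, 3), (1, 0)], [(0, 5), (3, 2)], [(1, 2)], [(1, 5), (4, 2), (5, 1), (2, 4)],
       [(0, 3), (1, 4)]])
    (mins :=
      [(81921, 81921, [(5, 6), (4, 6), (3, 6), (1, 6), (0, 6), (5, 4), (0, 4), (5, 3), (4, 3),
       (1, 3), (0, 3), (5, 2), (1, 2), (1, 0)]), (2179073, 1610612737, [(4, 6), (1, 6), (0, 6),
       (6, 5), (0, 5), (5, 6), (5, 4), (3, 4), (4, 5), (6, 3), (4, 3), (2, 3), (3, 4), (4, 2),
       (0, 2), (2, 4), (0, 1), (6, 0), (0, 6)]), (8470529, 1241513985, [(3, 6), (2, 6), (0, 6),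
       (6, 5), (3, 5), (0, 5), (5, 6), (5, 4), (3, 4), (2, 4), (4, 3), (2, 3), (0, 3), (3, 4),
       (6, 2), (4, 2), (0, 2), (2, 4), (6, 1), (2, 1), (0, 1), (6, 0), (0, 6)]), (12664833,
       1090519232, [(4, 6), (2, 6), (1, 6), (6, 5), (0, 5), (5, 6), (5, 4), (2, 4), (0, 4), (6,
       3), (4, 3), (2, 3), (1, 3), (0, 3), (6, 2), (4, 2), (1, 2), (0, 1)]), (33636353,
       1090519232, [(5, 6), (4, 6), (0, 6), (6, 5), (5, 6), (6, 4), (5, 4), (2, 4), (6, 3), (4,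
       3), (2, 3), (1, 3), (6, 2), (4, 2), (2, 4), (4, 1), (3, 1), (2, 1), (0, 1), (6, 0)]),
       (159465473, 17202938048, [(3, 6), (0, 6), (6, 5), (3, 5), (2, 5), (1, 5), (0, 5), (6, 4),
       (5, 4), (3, 4), (2, 4), (1, 4), (0, 4), (6, 2), (5, 2), (4, 2), (3, 2), (2, 3), (6, 1),
       (0, 1), (1, 6), (6, 0), (4, 0), (0, 4)]), (167854081, 167854081, [])])
    (by decide +kernel) L hL hE

lemma reduces_7_4 (L : List Bool) (hL : L.length = 56) (hE : Extends 7 524289 L) :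
    Reduces 7 reps7 L :=
  reduces_of_stageOk (free := [23, 24, 25, 26, 27, 28, 30, 31, 32])
    (pw :=
      [(22, [(6, 0)]), (21, [(6, 1)]), (20, [(6, 2)]), (34, [(6, 3)]), (33, [(6, 4)]), (29, [(6,
       5)])])
    (gens :=
      [[(0, 1), (1, 0)], [(1, 2), (2, 1)], [(3, 4)], [(3, 5)], [(4, 5)], [(3, 4), (4, 3)], [(4,
       5), (5, 4)]])
    (mins :=
      [(524289, 524289, [(3, 6), (1, 6), (4, 5), (3, 5), (5, 4), (3, 4), (5, 3), (4, 3), (3, 4),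
       (1, 2), (2, 0), (0, 2)]), (8912897, 1610612737, [(3, 6), (1, 6), (0, 6), (6, 5), (4, 5),
       (3, 5), (2, 5), (5, 6), (6, 4), (1, 4), (0, 4), (4, 6), (6, 3), (0, 3), (3, 6), (4, 2),
       (1, 2), (2, 4), (6, 1), (3, 1), (1, 3), (6, 0), (0, 6)]), (84410369, 1090519232, [(4, 6),
       (2, 6), (0, 6), (3, 5), (1, 5), (5, 4), (2, 4), (1, 4), (4, 5), (6, 3), (0, 3), (3, 6),
       (5, 2), (4, 2), (0, 2), (2, 4), (6, 1), (4, 1), (6, 0), (4, 0), (0, 4)]), (1242038273,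
       167854081, [(3, 6), (1, 5), (5, 4), (3, 4), (1, 4), (0, 4), (1, 3), (0, 3), (5, 2), (3,
       2), (0, 2), (2, 3), (6, 1), (1, 6), (6, 0), (5, 0), (3, 0), (2, 0)])])
    (by decide +kernel) L hL hE

lemma reduces_7_5 (L : List Bool) (hL : L.length = 56) (hE : Extends 7 22720 L) :
    Reduces 7 reps7 L :=
  reduces_of_stageOk (free := [20, 21, 22, 25, 26, 27, 28, 29, 34])
    (pw :=
      [(32, [(6, 0)]), (33, [(6, 0), (6, 1)]), (31, [(6, 3)]), (30, [(6, 2), (6, 3)]), (23, [(6,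
       4)]), (24, [(6, 5)])])
    (gens :=
      [[(0, 3), (1, 2)], [(4, 0), (5, 1)], [(1, 2), (0, 3), (2, 1), (3, 0)], [(0, 2), (1, 3),
       (0, 3)], [(3, 4), (2, 5), (5, 2), (4, 3)], [(2, 3), (3, 2), (0, 1), (1, 0)], [(2, 4), (3,
       5), (2, 5)], [(3, 0), (2, 1), (3, 4), (2, 5)], [(0, 4), (1, 4), (0, 5)], [(1, 0), (5, 4),
       (3, 2)]])
    (mins :=
      [(22720, 22720, [(4, 6), (3, 6), (2, 6), (0, 6), (4, 5), (2, 5), (0, 5), (5, 4), (3, 4),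
       (2, 4), (1, 4), (4, 5), (1, 3), (0, 3), (3, 2), (0, 2), (4, 1), (3, 1), (2, 1), (0, 1),
       (5, 0), (4, 0), (2, 0)]), (1071296, 17202938048, [(5, 6), (3, 6), (6, 5), (4, 5), (3, 5),
       (2, 5), (5, 6), (3, 4), (1, 4), (6, 3), (2, 3), (1, 3), (0, 3), (6, 2), (4, 2), (3, 2),
       (1, 2), (0, 2), (2, 3), (6, 1), (0, 1), (1, 6), (4, 0), (0, 4)]), (2119872, 1090519232,
       [(4, 6), (2, 6), (1, 6), (0, 6), (6, 5), (3, 5), (2, 5), (0, 5), (5, 6), (2, 4), (1, 4),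
       (0, 4), (4, 3), (2, 3), (1, 3), (3, 4), (6, 2), (0, 2), (2, 6)]), (100686016, 167854081,
       [(4, 6), (3, 6), (1, 6), (0, 6), (6, 5), (4, 5), (0, 5), (5, 6), (6, 4), (5, 4), (3, 4),
       (2, 4), (1, 4), (4, 3), (6, 2), (3, 2), (0, 2), (3, 1), (0, 1), (1, 3), (4, 0), (3, 0)])])
    (by decide +kernel) L hL hE

lemma classifies_two : Classifies 2 [0] := fun L hL h0 Q _ hR => by
  have : L = bitsOf 0 := ext_getD hL (length_bitsOf 0) fun T hT => by
    rw [h0 T hT (Nat.zero_le _), getD_bitsOf 0 hT, Nat.zero_testBit]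
  exact this ▸ hR 0 (by simp)

lemma classifies_three : Classifies 3 reps3 :=
  classifies_two.succ (by decide) rfl (by decide) (by
    simp only [List.forall_mem_cons]
    exact ⟨reduces_3_0, by simp⟩)

lemma classifies_four : Classifies 4 reps4 :=
  classifies_three.succ (by decide) rfl (by decide) (by
    simp only [reps3, List.forall_mem_cons]
    exact ⟨reduces_4_0, reduces_4_1, by simp⟩)

lemma classifies_five : Classifies 5 reps5 :=
  classifies_four.succ (by decide) rfl (by decide) (by
    simp only [reps4, List.forall_mem_cons]
    exact ⟨reduces_5_0, reduces_5_1, by simp⟩)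

lemma classifies_six : Classifies 6 reps6 :=
  classifies_five.succ (by decide) rfl (by decide) (by
    simp only [reps5, List.forall_mem_cons]
    exact ⟨reduces_6_0, reduces_6_1, reduces_6_2, by simp⟩)

lemma classifies_seven : Classifies 7 reps7 :=
  classifies_six.succ (by decide) rfl (by decide) (by
    simp only [reps6, List.forall_mem_cons]
    exact ⟨reduces_7_0, reduces_7_1, reduces_7_2, reduces_7_3, reduces_7_4, reduces_7_5, by simp⟩)

end Certificates

section UpperBound

/-- Certificate check: the points in the list have cubic moments coded by the first component. -/
def setOk (n m : ℕ) (c : ℕ × List ℕ) : Bool :=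
  Nat.ble c.2.length n && c.2.all (fun a => Nat.blt a m) && !par c.2 (fun _ => true) &&
    (List.range 8).all fun k => (List.range 8).all (fun i => !mom c.2 i i k) &&
      (List.range k).all fun j => (List.range j).all fun i =>
        mom c.2 i j k == c.1.testBit (tix i j k)

lemma represents_of_setOk {n m : ℕ} {c : ℕ × List ℕ} (h : setOk n m c = true) :
    c.2.length ≤ n ∧ (∀ a ∈ c.2, a < m) ∧ Represents c.2 (bitsOf c.1) := by
  simp only [setOk, Bool.and_eq_true, List.all_eq_true, List.mem_range, Nat.ble_eq, Nat.blt_eq,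
    Bool.not_eq_true', beq_iff_eq] at h
  obtain ⟨⟨⟨h1, h2⟩, h3⟩, h4⟩ := h
  refine ⟨h1, h2, represents_of_lt h3 (fun i hi k hk => (h4 k hk).1 i hi) fun k hk j hj i hi => ?_⟩
  rw [(h4 k hk).2 j hj i hi, getD_bitsOf]
  exact tix_lt i (by omega) j (by omega) k hk ⟨by omega, by omega, by omega⟩

/-- The cubic moments `L` are those of at most `20` points of a hyperplane. -/
def GoodSeven (L : List Bool) : Prop :=
  ∃ A : List ℕ, A.length ≤ 20 ∧ (∀ a ∈ A, a < 128) ∧ Represents A L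

lemma goodSeven_of_tau {a b : ℕ} (ha : a < 7) (hb : b < 7) (hab : a ≠ b) {L : List Bool}
    (hL : L.length = 56) (h : GoodSeven (tau xor a b L)) : GoodSeven L := by
  obtain ⟨A, hA, hlt, hr⟩ := h
  refine ⟨A.map (tauPt a b), by simpa using hA, fun v hv => ?_,
    represents_tau (by omega) (by omega) hab hL hr⟩
  obtain ⟨u, hu, rfl⟩ := List.mem_map.mp hv
  unfold tauPt
  split_ifs
  · exact Nat.xor_lt_two_pow (n := 7) (hlt u hu)
      (Nat.pow_lt_pow_right (by norm_num) ha)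
  · exact hlt u hu

/-- Point sets representing the tensors `reps7`. -/
def sets7 : List (ℕ × List ℕ) :=
    [(0, []), (1, [0, 5, 7, 2, 4, 1, 3, 6]), (192, [0, 14, 25, 17, 10, 12, 26, 28, 16, 30, 9,
     1]), (81921, [108, 74, 99, 109, 67, 107, 96, 110, 115, 83, 64, 72, 111, 114, 82, 105]),
     (524289, [44, 18, 23, 12, 36, 19, 22, 4, 52, 17, 16, 21, 60, 28]), (22720, [34, 33, 30, 3,
     8, 11, 14, 44, 47, 50, 57, 27, 15, 51, 56, 25, 28, 1]), (1241513984, [67, 1, 65, 3, 18, 25,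
     122, 84, 123, 28, 20, 92, 59, 89, 82, 58]), (1241513985, [48, 73, 49, 77, 98, 52, 9, 117,
     34, 13, 115, 114, 33, 118, 55, 97, 67, 70, 3, 6]), (1610612737, [25, 119, 89, 49, 115, 117,
     1, 118, 9, 16, 65, 48, 73, 114, 80, 116]), (1090519232, [59, 57, 76, 119, 116, 77, 125, 54,
     13, 102, 45, 52, 43, 12, 46, 41, 103, 126]), (17202938048, [1, 17, 32, 36, 39, 41, 43, 49,
     65, 81, 98, 104, 106, 108, 109, 115, 117, 118, 126, 127]), (167854081, [0, 13, 71, 19, 65,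
     11, 5, 79, 75, 83, 16, 81, 48, 35, 45, 36, 49, 38, 34, 47])]

lemma goodSeven {L : List Bool} (hL : L.length = 56)
    (h0 : ∀ T < 56, 35 ≤ T → L.getD T false = false) : GoodSeven L :=
  classifies_seven L hL h0 GoodSeven
    (fun _ ha _ hb hab _ hL h => goodSeven_of_tau ha hb hab hL h) fun r hr => by
    have h1 : sets7.map Prod.fst = reps7 := by decide +kernel
    have h2 : sets7.all (setOk 20 128) = true := by decide +kernel
    rw [← h1] at hr
    obtain ⟨c, hc, rfl⟩ := List.mem_map.mp hr
    exact ⟨c.2, represents_of_setOk (List.all_eq_true.mp h2 c hc)⟩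

lemma good_of_stageOk {r : ℕ} {free : List ℕ} {pw : List (ℕ × List (ℕ × ℕ))}
    {gens : List (List (ℕ × ℕ))} {sets : List (ℕ × List ℕ)}
    (hok : (stageOk 8 r free pw gens (sets.map Prod.fst) && sets.all (setOk 26 256)) = true)
    (L : List Bool) (hL : L.length = 56) (hE : Extends 8 r L) : Good 26 L := by
  rw [Bool.and_eq_true] at hok
  refine stage_sound hok.1 (fun a ha b hb hab L hL h => good_of_tau ha hb hab hL h)
    (fun c hc => ?_) hL hE
  obtain ⟨d, hd, rfl⟩ := List.mem_map.mp hc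
  obtain ⟨h1, _, h3⟩ := represents_of_setOk (List.all_eq_true.mp hok.2 d hd)
  exact ⟨d.2, h1, h3⟩

lemma good_extends_6 (L : List Bool) (hL : L.length = 56) (hE : Extends 8 1241513984 L) :
    Good 26 L :=
  good_of_stageOk (free := [35, 36, 37, 38, 39, 40, 41, 42, 43, 44, 46, 47, 48, 49])
    (pw :=
      [(55, [(7, 0)]), (54, [(7, 1)]), (53, [(7, 2)]), (52, [(7, 3)]), (51, [(7, 4)]), (50, [(7,
       5)]), (45, [(7, 6)])])
    (gens :=
      [[(2, 3), (3, 2)], [(1, 4), (4, 1)], [(2, 1), (4, 3)], [(0, 5)], [(1, 4)], [(0, 2), (3,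
       5)], [(1, 3), (2, 4)], [(0, 1), (4, 5)], [(0, 4), (1, 5)], [(0, 5), (5, 0)], [(0, 3), (2,
       5)], [(4, 3), (2, 1), (5, 4), (1, 0)], [(3, 5), (1, 5), (0, 4), (5, 3), (0, 2), (6, 1),
       (2, 0)], [(1, 0), (5, 4)], [(2, 0), (5, 3)], [(1, 3), (2, 4), (4, 2), (3, 1)], [(2, 0),
       (5, 3), (5, 4), (1, 0)], [(0, 3), (0, 4), (1, 5), (2, 5)], [(0, 1), (4, 5), (0, 2), (3,
       5)]])
    (sets :=
      [(1241513984, [123, 89, 30, 120, 33, 16, 80, 97, 56, 94, 25, 59, 86, 35, 99, 22]),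
       (35601252352, [59, 205, 204, 115, 123, 207, 51, 206, 13, 79, 55, 78, 12, 61, 108, 47,
       119, 44, 125, 111]), (69960990720, [154, 130, 134, 136, 218, 199, 200, 195, 7, 2, 153, 6,
       3, 142, 253, 252, 217, 189, 206, 188]), (413558374400, [205, 82, 89, 83, 141, 154, 223,
       93, 230, 157, 167, 142, 151, 90, 217, 166, 211, 215, 206, 95, 146, 231]), (1100753141760,
       [75, 143, 87, 53, 139, 23, 117, 79, 5, 116, 84, 131, 135, 52, 20, 69, 67, 7]),
       (1135112880128, [145, 182, 190, 243, 240, 112, 1, 146, 122, 3, 51, 177, 118, 209, 126,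
       49, 186, 210, 67, 65]), (2337703723008, [195, 119, 100, 115, 131, 165, 244, 113, 248,
       177, 188, 130, 166, 101, 228, 184, 243, 230, 194, 116, 183, 252]), (10446601977856, [147,
       179, 26, 34, 22, 52, 202, 154, 142, 228, 78, 116, 211, 243, 10, 98, 16, 88, 214, 164,
       216, 144]), (79990712434688, [19, 23, 44, 46, 58, 60, 72, 73, 80, 87, 105, 110, 122, 123,
       136, 141, 169, 172, 201, 205, 208, 211, 251, 252])])
    (by decide +kernel) L hL hE

lemma good_extends_7 (L : List Bool) (hL : L.length = 56) (hE : Extends 8 1241513985 L) :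
    Good 26 L :=
  good_of_stageOk (free := [35, 36, 37, 38, 39, 40, 41, 42, 43, 44, 46, 47, 48, 49])
    (pw :=
      [(55, [(7, 0)]), (54, [(7, 1)]), (53, [(7, 2)]), (52, [(7, 3)]), (51, [(7, 4)]), (50, [(7,
       5)]), (45, [(7, 6)])])
    (gens :=
      [[(0, 5)], [(1, 4)], [(2, 3)], [(3, 4), (1, 2), (2, 1), (4, 3)], [(1, 0), (5, 4)], [(0,
       4), (1, 5)], [(0, 3), (2, 5)], [(4, 5), (0, 1), (5, 4), (1, 0)], [(6, 0), (3, 4), (2, 4),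
       (1, 2)], [(0, 2), (3, 5)], [(1, 3), (6, 0)], [(0, 2), (3, 5), (5, 3), (2, 0)], [(0, 1),
       (6, 4), (4, 5)], [(6, 3)], [(0, 4), (6, 2)], [(2, 0), (5, 3), (2, 1), (4, 3)], [(2, 1),
       (4, 3)], [(0, 2), (0, 1), (4, 5), (3, 5)], [(5, 3), (5, 4), (2, 0), (1, 0)], [(4, 5), (0,
       5), (5, 4), (4, 5), (2, 3), (0, 1), (1, 0), (0, 1)], [(4, 5), (6, 4), (2, 4), (6, 3), (0,
       3), (6, 1), (0, 1), (6, 0)]])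
    (sets :=
      [(1241513985, [0, 54, 104, 69, 115, 66, 51, 40, 118, 71, 43, 121, 1, 126, 67, 68, 57, 70,
       107, 62]), (35601252353, [144, 202, 201, 219, 208, 136, 155, 139, 14, 12, 157, 15, 13,
       212, 174, 175, 221, 238, 148, 239]), (276119420929, [181, 219, 198, 201, 152, 135, 136,
       252, 56, 141, 48, 143, 253, 140, 57, 131, 49, 155, 207, 180, 194, 216]), (413558374401,
       [139, 182, 176, 181, 203, 115, 125, 253, 223, 60, 156, 201, 57, 178, 49, 159, 52, 121,
       137, 252, 119, 220]), (1100753141761, [52, 30, 210, 85, 84, 16, 3, 53, 222, 1, 81, 23,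
       26, 116, 214, 83, 218, 117, 65, 67]), (2750020583425, [151, 90, 192, 148, 120, 13, 11,
       219, 5, 57, 70, 18, 72, 78, 158, 1, 56, 157, 17, 218, 67, 121, 193, 88]), (3299776397313,
       [0, 74, 241, 214, 81, 20, 128, 69, 142, 67, 240, 208, 78, 210, 23, 213, 176, 3, 138, 83,
       177, 133]), (10446601977857, [216, 152, 217, 153, 56, 255, 62, 166, 191, 246, 244, 162,
       107, 112, 252, 114, 109, 47, 186, 96, 100, 41]), (17593427558401, [0, 156, 117, 66, 30,
       70, 17, 88, 148, 84, 52, 78, 132, 90, 19, 23, 53, 85, 140, 10, 116, 72]),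
       (17730866511873, [86, 95, 78, 242, 216, 204, 154, 67, 139, 243, 211, 145, 92, 148, 179,
       137, 65, 68, 198, 93, 178, 156]), (79990712434689, [33, 201, 187, 76, 84, 254, 110, 195,
       253, 105, 174, 58, 65, 96, 169, 144, 36, 145, 67, 200, 101, 63, 193, 77, 85, 189]),
       (87962171736065, [0, 47, 6, 1, 229, 133, 255, 183, 127, 4, 239, 43, 98, 245, 37, 66, 181,
       34, 135, 67, 107, 119])])
    (by decide +kernel) L hL hE

lemma good_extends_8 (L : List Bool) (hL : L.length = 56) (hE : Extends 8 1610612737 L) :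
    Good 26 L :=
  good_of_stageOk (free := [37, 38, 39, 40, 41, 42, 43, 44, 46, 47, 48, 49, 51, 52])
    (pw :=
      [(55, [(7, 0)]), (36, [(7, 1)]), (35, [(7, 2)]), (54, [(7, 3)]), (53, [(7, 4)]), (50, [(7,
       5)]), (45, [(7, 6)])])
    (gens :=
      [[(1, 2), (2, 1)], [(3, 4), (4, 3)], [(3, 4)], [(0, 1)], [(1, 5), (6, 2)], [(0, 5)], [(1,
       2)], [(0, 2)], [(0, 3), (4, 5), (6, 4)], [(0, 4), (3, 5), (6, 3)], [(6, 3)], [(2, 5), (6,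
       1)], [(0, 6), (6, 5), (0, 5), (6, 4), (1, 4), (0, 4), (2, 3), (3, 2), (2, 3), (4, 1), (1,
       4), (6, 0), (0, 6)], [(0, 6), (3, 5), (2, 5), (1, 5), (0, 5), (2, 4), (1, 3), (6, 2), (4,
       2), (2, 4), (6, 1), (3, 1), (0, 1), (1, 3), (6, 0), (0, 6)]])
    (sets :=
      [(1610612737, [193, 199, 132, 188, 244, 229, 195, 236, 252, 194, 198, 192, 172, 133, 180,
       165]), (139049566209, [230, 226, 237, 244, 103, 173, 180, 99, 252, 205, 204, 224, 101,
       141, 140, 188, 97, 164]), (276488519681, [126, 87, 23, 58, 127, 30, 59, 94, 14, 70, 48,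
       6, 78, 60, 241, 249, 49, 240, 61, 248]), (413927473153, [88, 179, 54, 176, 185, 120, 65,
       81, 181, 9, 49, 184, 50, 24, 183, 121, 52, 17, 73, 1]), (551366426625, [30, 197, 110, 6,
       94, 45, 22, 163, 206, 160, 77, 86, 162, 204, 15, 161, 199, 44, 68, 111]), (688805380097,
       [57, 237, 110, 107, 99, 33, 73, 49, 227, 8, 105, 106, 239, 121, 108, 40, 225, 113, 72,
       9]), (2750389682177, [138, 103, 61, 36, 139, 117, 236, 230, 249, 238, 187, 203, 247, 125,
       52, 248, 45, 246, 202, 229, 111, 186]), (2887828635649, [0, 71, 185, 19, 89, 155, 193,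
       194, 69, 72, 184, 153, 196, 144, 147, 27, 248, 8, 198, 80, 249, 67]), (5499168751617,
       [217, 193, 22, 203, 93, 197, 82, 15, 205, 219, 67, 118, 73, 55, 54, 31, 119, 80, 7, 84]),
       (5636607705089, [76, 197, 93, 175, 209, 151, 219, 74, 67, 239, 83, 89, 142, 135, 238, 72,
       65, 159, 85, 206, 174, 78]), (17731235610625, [158, 64, 197, 167, 166, 142, 230, 86, 231,
       195, 66, 68, 150, 78, 94, 135, 193, 198]), (18280991424513, [225, 10, 43, 108, 99, 169,
       237, 75, 177, 113, 11, 42, 239, 104, 185, 121, 227, 110, 161, 74]), (23228793749505, [0,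
       221, 51, 6, 81, 5, 75, 84, 195, 73, 50, 27, 201, 18, 13, 14, 115, 8, 215, 88, 114, 94]),
       (70370354790401, [165, 117, 45, 4, 38, 100, 35, 135, 61, 34, 68, 7, 53, 167, 109, 69,
       125, 133, 32, 33]), (70507793743873, [111, 1, 128, 4, 71, 119, 70, 63, 5, 166, 164, 130,
       127, 55, 47, 36, 3, 102]), (70645232697345, [0, 249, 111, 129, 41, 32, 74, 9, 185, 232,
       108, 96, 241, 137, 202, 107, 110, 234, 177, 192, 109, 65]), (70782671650817, [102, 9, 47,
       71, 164, 237, 5, 11, 189, 253, 136, 174, 4, 44, 181, 245, 103, 70, 229, 138]),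
       (71469866418177, [75, 74, 171, 140, 45, 38, 143, 162, 13, 166, 173, 122, 107, 58, 50,
       136, 114, 98, 137, 14]), (71607305371649, [236, 140, 143, 49, 33, 225, 13, 108, 14, 113,
       101, 73, 232, 138, 121, 42, 72, 139, 229, 168, 57, 170]), (73668889673729, [0, 236, 197,
       2, 37, 134, 188, 52, 252, 196, 44, 40, 162, 181, 229, 129, 53, 34, 135, 131, 168, 244]),
       (73806328627201, [0, 6, 241, 200, 134, 240, 145, 216, 155, 50, 15, 52, 181, 24, 143, 192,
       27, 182, 51, 8, 55, 209]), (301267796623361, [190, 187, 201, 109, 41, 68, 24, 193, 128,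
       149, 137, 69, 191, 186, 17, 108, 216, 160, 32, 148, 168, 208]), (301954991390721, [57,
       184, 59, 186, 60, 54, 125, 197, 183, 230, 110, 12, 149, 111, 188, 231, 212, 221, 124,
       205, 4, 156]), (351845331501057, [114, 35, 91, 86, 59, 18, 84, 43, 209, 219, 107, 19, 87,
       80, 241, 251, 113, 85, 50, 99]), (352944843128833, [69, 99, 171, 187, 228, 231, 162, 78,
       106, 179, 196, 130, 109, 73, 243, 108, 72, 131, 207, 101, 251, 103]), (354044354756609,
       [177, 51, 145, 237, 43, 219, 106, 67, 200, 239, 233, 168, 113, 250, 238, 136, 3, 81, 27,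
       115, 236, 122]), (355143866384385, [0, 116, 162, 3, 180, 34, 69, 6, 77, 41, 117, 93, 29,
       132, 181, 130, 141, 20, 169, 129, 84, 7]), (360641424523265, [99, 89, 162, 233, 134, 194,
       141, 226, 129, 197, 93, 67, 105, 157, 217, 128, 213, 77, 135, 149, 132, 163]),
       (2252076302204929, [250, 70, 200, 25, 69, 136, 89, 177, 58, 192, 49, 131, 240, 129, 123,
       80, 112, 71, 130, 187, 16, 68]), (2255099959181313, [222, 142, 69, 31, 174, 21, 136, 138,
       92, 239, 221, 135, 9, 148, 150, 1, 238, 87, 70, 139, 129, 175, 68, 78])])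
    (by decide +kernel) L hL hE

lemma good_extends_9 (L : List Bool) (hL : L.length = 56) (hE : Extends 8 1090519232 L) :
    Good 26 L :=
  good_of_stageOk (free := [35, 36, 37, 39, 40, 41, 43, 44, 46, 47, 48, 49, 52, 54])
    (pw :=
      [(55, [(7, 0)]), (53, [(7, 1)]), (42, [(7, 2)]), (51, [(7, 3)]), (38, [(7, 4)]), (50, [(7,
       5)]), (45, [(7, 6)])])
    (gens :=
      [[(0, 5)], [(4, 2)], [(1, 2)], [(0, 6), (1, 4)], [(4, 2), (6, 5)], [(1, 4), (4, 1), (0,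
       6), (6, 0)], [(0, 3), (1, 5)], [(6, 4), (2, 3), (0, 1), (2, 5)], [(0, 2), (1, 3)], [(4,
       3), (6, 2)], [(4, 6), (2, 5), (6, 4), (4, 6), (5, 2), (2, 5), (0, 1), (1, 0), (0, 1)],
       [(1, 0), (5, 3), (4, 6), (5, 2)], [(4, 5), (6, 3)], [(0, 5), (6, 0), (4, 1)], [(0, 2),
       (1, 3), (1, 2)], [(6, 5)], [(0, 3), (1, 5), (0, 5)], [(4, 5), (6, 5), (6, 3)], [(0, 6),
       (2, 5), (0, 5), (6, 4), (1, 4), (2, 3), (4, 1), (0, 1), (6, 0)], [(6, 5), (4, 5), (2, 5),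
       (6, 4), (6, 3), (2, 3), (4, 1), (0, 1), (6, 0)], [(6, 5), (4, 5), (6, 3), (1, 3), (0, 2),
       (4, 1), (6, 0)], [(0, 5), (1, 4), (0, 6)], [(4, 6), (1, 6), (0, 6), (0, 5), (1, 4), (5,
       3), (5, 2), (4, 2), (1, 0)], [(0, 6), (6, 5), (1, 4), (1, 3), (0, 2), (4, 1), (6, 0)],
       [(2, 5), (1, 5), (6, 4), (2, 3), (1, 3), (1, 2), (0, 1)], [(0, 6), (1, 5), (1, 4), (0,
       3), (4, 1), (1, 4), (6, 0), (0, 6)]])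
    (sets :=
      [(1090519232, [149, 254, 132, 220, 137, 143, 255, 133, 214, 153, 155, 191, 150, 223, 140,
       212, 139, 190]), (35450257600, [158, 20, 30, 38, 68, 31, 39, 141, 194, 92, 208, 13, 143,
       94, 192, 102, 210, 23, 14, 156, 103, 71]), (69809995968, [25, 46, 127, 43, 24, 56, 54,
       117, 149, 119, 145, 93, 35, 58, 124, 148, 40, 34, 92, 53, 44, 144]), (138529472704, [115,
       250, 254, 33, 40, 43, 72, 122, 110, 9, 35, 97, 248, 114, 252, 98, 108, 123, 8, 73]),
       (688285286592, [60, 91, 115, 59, 99, 172, 56, 162, 96, 26, 27, 114, 160, 174, 62, 104,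
       90, 107]), (757004763328, [72, 100, 195, 123, 198, 189, 156, 193, 80, 226, 83, 188, 73,
       101, 159, 122, 92, 149, 197, 227, 151, 94]), (1100602147008, [0, 63, 199, 88, 14, 3, 69,
       13, 127, 22, 207, 67, 62, 89, 17, 74, 203, 18, 126, 20, 195, 76]), (1238041100480, [147,
       73, 223, 250, 221, 145, 251, 77, 207, 202, 71, 209, 186, 154, 199, 194, 210, 187, 153,
       67]), (1272400838848, [152, 153, 216, 217, 176, 242, 182, 47, 243, 229, 236, 32, 51, 230,
       187, 239, 53, 61, 188, 45, 34, 59]), (2200113774784, [148, 152, 11, 50, 150, 90, 132,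
       131, 219, 208, 115, 134, 211, 216, 114, 128, 155, 10, 51, 91]), (3299625402560, [147, 69,
       82, 73, 95, 205, 154, 197, 145, 195, 81, 186, 93, 187, 250, 79, 251, 202, 153, 66]),
       (3437064356032, [219, 78, 129, 233, 94, 88, 131, 220, 76, 232, 86, 139, 210, 66, 168,
       209, 65, 136, 81, 211, 169, 214]), (8831543279808, [0, 205, 186, 19, 73, 138, 210, 195,
       221, 74, 187, 154, 79, 145, 128, 25, 251, 10, 95, 66, 250, 81]), (8865903018176, [0, 156,
       118, 2, 12, 9, 85, 5, 141, 31, 55, 24, 152, 6, 86, 93, 119, 95, 137, 18, 54, 16]),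
       (9346939355328, [69, 203, 76, 117, 20, 29, 53, 73, 213, 23, 219, 92, 52, 207, 31, 221,
       68, 116, 215, 89]), (9415658832064, [28, 94, 22, 250, 201, 197, 217, 80, 145, 186, 154,
       138, 15, 206, 187, 128, 65, 5, 214, 79, 251, 204]), (17661996040384, [222, 81, 152, 82,
       154, 69, 204, 86, 215, 79, 144, 243, 147, 242, 179, 75, 178, 93, 196, 73]),
       (26423729324224, [25, 147, 202, 151, 152, 75, 135, 195, 33, 97, 144, 201, 21, 8, 32, 96,
       139, 5, 74, 192]), (26458089062592, [71, 5, 31, 105, 8, 221, 154, 210, 128, 41, 217, 75,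
       214, 132, 40, 19, 65, 142, 76, 150, 104, 134]), (70575993127104, [50, 19, 152, 213, 68,
       219, 66, 177, 217, 71, 45, 236, 44, 64, 237, 178, 143, 92, 17, 93, 142, 49, 214, 154]),
       (71469346324672, [0, 56, 139, 5, 16, 133, 120, 91, 121, 129, 59, 185, 159, 83, 19, 8, 81,
       157, 143, 13, 187, 88]), (79234647195840, [0, 9, 123, 81, 138, 187, 12, 30, 159, 121,
       153, 112, 51, 31, 26, 1, 28, 48, 185, 80, 115, 142]), (79784403009728, [0, 44, 101, 65,
       63, 116, 51, 112, 224, 230, 62, 202, 200, 50, 45, 66, 243, 9, 247, 3, 11, 98]),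
       (80265439346880, [55, 162, 39, 79, 70, 68, 54, 63, 8, 10, 184, 76, 111, 128, 130, 32,
       188, 14, 110, 164, 58, 15]), (96964272193728, [0, 167, 34, 210, 36, 35, 217, 137, 72, 96,
       165, 199, 69, 88, 38, 209, 203, 214, 97, 3, 84, 139]), (140738578874560, [115, 44, 110,
       20, 118, 37, 99, 21, 81, 63, 108, 209, 84, 241, 213, 62, 245, 47, 97, 38]),
       (140772938612928, [0, 82, 73, 8, 117, 71, 241, 208, 245, 75, 87, 25, 48, 211, 112, 3,
       210, 49, 69, 11, 24, 213]), (141838090502336, [78, 96, 122, 174, 56, 125, 51, 15, 41,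
       170, 53, 62, 71, 97, 130, 10, 44, 115, 116, 67, 134, 75]), (141872450240704, [0, 218, 71,
       13, 241, 68, 17, 52, 21, 77, 219, 151, 191, 59, 240, 15, 62, 186, 78, 2, 146, 53]),
       (142937602130112, [158, 241, 213, 83, 76, 12, 206, 209, 79, 15, 181, 67, 86, 180, 244, 5,
       117, 207, 6, 113, 65, 159]), (144037113757888, [63, 19, 100, 211, 102, 191, 162, 23, 40,
       241, 185, 151, 235, 242, 43, 56, 161, 233, 118, 210, 146, 116]), (159602075238592, [68,
       77, 192, 144, 88, 84, 152, 205, 75, 195, 198, 119, 219, 147, 154, 178, 214, 247, 242,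
       115, 179, 74]), (167298656633024, [246, 223, 128, 18, 157, 183, 29, 140, 16, 76, 79, 23,
       2, 222, 247, 148, 14, 68, 71, 50, 178, 54]), (432693275787456, [115, 244, 155, 33, 182,
       113, 45, 215, 54, 25, 89, 247, 23, 163, 36, 44, 91, 212, 148, 60, 167, 189]),
       (562985403678912, [242, 232, 48, 195, 166, 42, 81, 200, 74, 182, 121, 138, 98, 25, 128,
       18, 164, 177, 187, 218, 51, 180, 34, 203]), (563019763417280, [0, 244, 196, 128, 167, 5,
       255, 237, 191, 197, 164, 49, 163, 252, 247, 17, 236, 179, 4, 145, 33, 189]),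
       (589373682745536, [98, 114, 240, 224, 30, 205, 31, 109, 221, 116, 118, 110, 151, 37, 93,
       39, 150, 132, 76, 44, 47, 133]), (590095237251264, [196, 85, 232, 121, 214, 105, 134,
       211, 248, 79, 143, 67, 166, 77, 133, 141, 246, 167, 68, 64, 208, 247]),
       (5075381124071616, [166, 8, 112, 218, 157, 226, 172, 144, 50, 239, 236, 49, 1, 167, 175,
       78, 100, 31, 128, 89, 101, 243, 17, 139, 204, 98]), (18016632982995136, [78, 120, 79,
       102, 52, 122, 190, 104, 237, 14, 189, 238, 37, 106, 119, 15, 245, 164, 183, 230])])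
    (by decide +kernel) L hL hE

lemma good_extends_10 (L : List Bool) (hL : L.length = 56) (hE : Extends 8 17202938048 L) :
    Good 26 L :=
  good_of_stageOk (free := [35, 36, 37, 38, 39, 40, 41, 42, 43, 44, 45, 46, 47, 48])
    (pw :=
      [(52, [(7, 0)]), (53, [(7, 0), (7, 1)]), (51, [(7, 3)]), (50, [(7, 2), (7, 3)]), (55, [(7,
       4)]), (54, [(7, 5)]), (49, [(7, 6)])])
    (gens :=
      [[(4, 5)], [(0, 3), (1, 2)], [(2, 3), (3, 2), (0, 1), (1, 0)], [(6, 5)], [(2, 0), (3, 1),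
       (2, 1)], [(1, 2), (2, 1), (0, 3), (3, 0)], [(4, 0), (6, 1)], [(3, 5), (6, 0)], [(1, 5),
       (4, 3)], [(2, 5), (6, 1)], [(0, 2), (1, 3), (0, 3)], [(0, 1), (6, 4), (2, 3)], [(1, 5),
       (6, 2)], [(1, 5), (4, 5), (4, 2), (6, 3)], [(2, 5), (4, 0)], [(3, 2), (6, 4), (4, 6), (2,
       3)], [(1, 0), (6, 4), (3, 2)], [(3, 5), (6, 1), (4, 1)], [(0, 5), (6, 2), (4, 2)], [(3,
       5), (4, 1), (4, 0)], [(2, 5), (6, 1), (4, 3), (6, 2)], [(0, 1), (6, 4), (1, 0), (4, 6)],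
       [(1, 5), (6, 3), (4, 2)], [(6, 2), (6, 0), (1, 5), (3, 5)], [(6, 0), (3, 5), (3, 0), (2,
       1)], [(1, 2), (0, 3), (6, 1), (4, 0)], [(4, 6), (6, 5), (3, 5), (1, 5), (2, 3), (1, 3),
       (0, 3), (6, 2), (4, 2), (3, 2), (1, 2), (2, 3), (0, 1), (4, 0)]])
    (sets :=
      [(17202938048, [103, 89, 75, 13, 15, 74, 88, 119, 1, 68, 2, 85, 6, 23, 78, 39, 76, 55, 80,
       83]), (51562676416, [151, 28, 213, 217, 138, 29, 128, 31, 145, 198, 195, 210, 203, 30,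
       152, 132, 190, 174, 238, 254]), (85922414784, [0, 203, 98, 92, 83, 66, 69, 17, 207, 11,
       50, 70, 202, 93, 9, 23, 114, 75, 206, 72, 34, 20]), (429519798464, [170, 186, 156, 19,
       75, 88, 69, 76, 4, 129, 148, 24, 234, 250, 213, 83, 73, 223, 219, 193, 15, 153]),
       (463879536832, [213, 149, 133, 197, 180, 231, 39, 178, 167, 127, 62, 96, 104, 60, 246,
       125, 251, 250, 37, 177, 99, 105]), (498239275200, [72, 128, 151, 222, 153, 129, 214, 79,
       74, 221, 197, 181, 155, 229, 245, 76, 165, 67, 132, 66]), (2216226193600, [63, 79, 25,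
       212, 92, 9, 196, 109, 119, 72, 53, 75, 45, 8, 55, 197, 117, 31, 27, 127, 213, 12]),
       (3315737821376, [15, 5, 200, 75, 176, 194, 88, 157, 222, 224, 218, 89, 92, 198, 3, 16,
       240, 71, 29, 141, 4, 160, 216, 81]), (35201575026880, [122, 123, 91, 90, 155, 248, 218,
       161, 249, 228, 182, 178, 173, 167, 139, 245, 236, 191, 203, 227, 240, 254]),
       (35339013980352, [0, 223, 32, 16, 79, 96, 57, 249, 59, 114, 222, 173, 125, 168, 78, 81,
       171, 126, 50, 65, 174, 248]), (36301086654656, [183, 121, 248, 229, 112, 200, 136, 227,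
       88, 175, 217, 116, 189, 178, 124, 250, 166, 238, 152, 161, 89, 251])])
    (by decide +kernel) L hL hE

lemma good_extends_11 (L : List Bool) (hL : L.length = 56) (hE : Extends 8 167854081 L) :
    Good 26 L :=
  good_of_stageOk (free := [35, 36, 37, 38, 39, 40, 43, 44, 45, 46, 47, 48, 50, 55])
    (pw :=
      [(49, [(7, 0)]), (54, [(7, 1)]), (53, [(7, 2)]), (52, [(7, 3)]), (51, [(7, 4)]), (41, [(7,
       5)]), (42, [(7, 6)])])
    (gens :=
      [[(0, 4), (6, 2)], [(3, 6), (4, 5)], [(0, 5), (3, 2)], [(4, 5), (5, 4), (3, 6), (6, 3)],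
       [(5, 6), (2, 1), (2, 0), (4, 3)], [(3, 5), (3, 1), (4, 2), (0, 6)], [(2, 6), (4, 0)],
       [(2, 3), (5, 0)], [(3, 2), (0, 5), (5, 0), (2, 3)], [(2, 6), (4, 0), (0, 4), (6, 2)],
       [(0, 5), (3, 2), (4, 0), (2, 6)], [(2, 6), (2, 3), (6, 2), (5, 0), (4, 0), (0, 4)], [(6,
       2), (0, 4), (4, 0), (2, 6)], [(6, 2), (6, 3), (5, 4), (0, 4)], [(5, 6), (3, 6), (2, 6),
       (6, 5), (4, 5), (2, 5), (5, 6), (3, 4), (4, 3), (3, 4), (4, 2), (0, 2), (3, 1), (4, 0),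
       (2, 0), (0, 2)], [(3, 4), (0, 2), (0, 1), (6, 5)], [(2, 3), (3, 2), (5, 0), (0, 5)], [(2,
       6), (3, 2), (4, 0), (0, 5)], [(3, 6), (6, 5), (4, 5), (5, 6), (3, 4), (4, 3), (0, 2), (2,
       1), (0, 1), (2, 0)], [(6, 5), (0, 5), (5, 6), (2, 4), (6, 3), (4, 3), (0, 3), (4, 2), (3,
       2), (2, 3), (6, 1), (2, 1), (0, 1), (6, 0), (2, 0)], [(3, 6), (0, 6), (4, 5), (3, 5), (4,
       2), (3, 1)], [(0, 3), (5, 2), (6, 4), (6, 1)], [(4, 6), (3, 6), (4, 5), (2, 5), (3, 4),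
       (0, 4), (6, 2), (2, 6), (4, 1), (3, 1), (0, 1), (4, 0), (3, 0)], [(4, 5), (3, 2), (0, 5),
       (3, 6)], [(3, 0), (4, 1), (4, 6), (2, 5)], [(4, 6), (3, 6), (2, 6), (4, 5), (2, 5), (2,
       3), (4, 1), (5, 0), (4, 0), (3, 0), (2, 0)], [(5, 6), (6, 4), (4, 6), (6, 3), (5, 3), (0,
       3), (5, 2), (2, 5), (6, 1), (5, 1), (3, 0), (2, 0)], [(5, 6), (4, 6), (3, 6), (0, 6), (6,
       5), (0, 5), (6, 4), (4, 6), (6, 3), (0, 3), (3, 6), (6, 2), (5, 2), (4, 2), (0, 2), (2,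
       4), (6, 1), (3, 1), (6, 0)], [(4, 6), (2, 5), (3, 4), (0, 4), (6, 2), (4, 1), (3, 1), (0,
       1), (3, 0)], [(6, 5), (2, 5), (6, 4), (3, 4), (4, 6), (5, 3), (3, 5), (6, 1), (0, 1), (5,
       0), (2, 0), (0, 2)], [(4, 6), (0, 6), (6, 5), (4, 5), (3, 5), (2, 5), (0, 4), (6, 2), (4,
       2), (3, 2), (4, 1), (3, 0)], [(3, 6), (6, 5), (4, 5), (0, 5), (6, 4), (3, 4), (0, 3), (5,
       2), (3, 2), (2, 3), (6, 1), (0, 1), (5, 0)], [(4, 6), (2, 6), (2, 5), (0, 4), (4, 3), (0,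
       3), (3, 4), (6, 2), (2, 6), (4, 1), (3, 1), (0, 1), (4, 0), (3, 0), (0, 3)], [(2, 6), (0,
       6), (2, 5), (0, 5), (3, 4), (4, 3), (0, 3), (3, 4), (6, 2), (4, 2), (3, 2), (4, 1), (3,
       1), (4, 0), (3, 0), (0, 3)], [(5, 6), (2, 6), (0, 6), (6, 5), (3, 5), (6, 4), (3, 4), (0,
       4), (4, 6), (6, 3), (5, 3), (4, 3), (2, 3), (0, 3), (3, 4), (6, 2), (5, 2), (4, 2), (3,
       2), (2, 3), (6, 1), (0, 1), (3, 0)]])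
    (sets :=
      [(167854081, [0, 103, 53, 10, 119, 66, 55, 72, 85, 106, 69, 104, 33, 84, 78, 14, 4, 35,
       102, 116]), (34527592449, [0, 84, 215, 99, 49, 122, 9, 75, 20, 18, 213, 58, 28, 43, 105,
       112, 212, 19, 92, 32, 214, 67]), (68887330817, [68, 7, 111, 25, 116, 53, 89, 45, 63, 80,
       17, 211, 15, 214, 215, 100, 210, 77, 39, 127]), (103247069185, [81, 76, 47, 217, 124, 61,
       108, 17, 15, 216, 119, 103, 91, 69, 222, 25, 7, 37, 55, 90, 223, 89]), (275045761025,
       [87, 102, 64, 21, 229, 113, 18, 46, 33, 237, 98, 55, 81, 50, 14, 9, 228, 76, 117, 39, 67,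
       236, 73, 45]), (412484714497, [0, 135, 68, 5, 159, 74, 188, 175, 189, 78, 132, 201, 223,
       167, 156, 8, 165, 221, 64, 13, 203, 172]), (446844452865, [0, 76, 184, 19, 78, 178, 56,
       35, 44, 181, 86, 249, 241, 32, 84, 3, 46, 255, 191, 16, 247, 57]), (584283406337, [183,
       88, 231, 135, 166, 246, 134, 81, 176, 184, 90, 229, 148, 252, 250, 242, 165, 149, 188,
       83]), (1718154772481, [0, 83, 174, 14, 82, 172, 197, 200, 209, 182, 87, 229, 230, 192,
       86, 8, 208, 246, 180, 6, 245, 204]), (1924313202689, [93, 85, 82, 90, 150, 147, 132, 209,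
       155, 230, 255, 218, 183, 228, 133, 253, 165, 180, 159, 219, 208, 166]), (9620894597121,
       [120, 154, 85, 139, 176, 76, 241, 10, 78, 246, 249, 65, 28, 100, 254, 189, 121, 185, 26,
       158, 101, 64, 12, 143, 180, 86]), (36352771047425, [255, 167, 227, 220, 226, 230, 219,
       229, 26, 30, 165, 252, 105, 22, 18, 181, 211, 104, 77, 213, 183, 76]), (36490210000897,
       [161, 177, 164, 241, 13, 197, 91, 167, 6, 206, 122, 195, 243, 123, 179, 2, 238, 90, 9,
       237, 201, 160]), (36524569739265, [128, 201, 135, 213, 181, 151, 227, 131, 3, 33, 239,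
       148, 215, 233, 203, 2, 43, 229, 180, 47, 36, 134]), (44289870610433, [224, 255, 250, 180,
       237, 45, 23, 134, 57, 227, 60, 143, 141, 173, 178, 170, 241, 246, 41, 236, 22, 133]),
       (44358590087169, [190, 200, 1, 4, 210, 189, 211, 207, 20, 196, 221, 150, 16, 193, 183,
       142, 222, 145, 136, 46, 47, 181])])
    (by decide +kernel) L hL hE

/-- The eight points of the affine subspace through `t` spanned by `x` and the last two basis
vectors. -/
def flat (t x : ℕ) : List ℕ :=
  t :: [t ^^^ 64, t ^^^ 128, t ^^^ 192, t ^^^ x, t ^^^ x ^^^ 64, t ^^^ x ^^^ 128, t ^^^ x ^^^ 192]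

lemma mom_flat (t x i j k : ℕ) : mom (flat t x) i j k =
    (Nat.testBit 64 i && Nat.testBit 128 j && x.testBit k ^^
     Nat.testBit 64 i && Nat.testBit 128 k && x.testBit j ^^
     Nat.testBit 64 j && Nat.testBit 128 i && x.testBit k ^^
     Nat.testBit 64 j && Nat.testBit 128 k && x.testBit i ^^
     Nat.testBit 64 k && Nat.testBit 128 i && x.testBit j ^^
     Nat.testBit 64 k && Nat.testBit 128 j && x.testBit i) := by
  have h : ∀ l, Nat.testBit 192 l = (Nat.testBit 64 l ^^ Nat.testBit 128 l) := fun l => by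
    rw [← Nat.testBit_xor]; rfl
  simp only [mom, flat, par_cons, par_nil, Nat.testBit_xor, h]
  generalize t.testBit i = a1
  generalize t.testBit j = a2
  generalize t.testBit k = a3
  generalize x.testBit i = b1
  generalize x.testBit j = b2
  generalize x.testBit k = b3
  generalize Nat.testBit 64 i = c1
  generalize Nat.testBit 64 j = c2
  generalize Nat.testBit 64 k = c3
  generalize Nat.testBit 128 i = d1
  generalize Nat.testBit 128 j = d2
  generalize Nat.testBit 128 k = d3
  revert a1 a2 a3 b1 b2 b3 c1 c2 c3 d1 d2 d3
  decide +kernel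

/-- Exchange of the last two coordinates. -/
def swapIx (i : ℕ) : ℕ := if i = 6 then 7 else if i = 7 then 6 else i

/-- Exchange of the last two coordinates of a point. -/
def swapPt (v : ℕ) : ℕ := if v.testBit 6 = v.testBit 7 then v else v ^^^ 192

lemma testBit_swapPt (v i : ℕ) (hi : i < 8) : (swapPt v).testBit i = v.testBit (swapIx i) := by
  have h : ∀ i < 8, Nat.testBit 192 i = decide (6 ≤ i) := by decide
  unfold swapPt
  obtain h6 | rfl | rfl : i < 6 ∨ i = 6 ∨ i = 7 := by omega
  · have : swapIx i = i := by unfold swapIx; split_ifs <;> omega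
    rw [this]
    split_ifs
    · rfl
    · simp [Nat.testBit_xor, h i hi, not_le.mpr h6]
  · split_ifs with h1
    · exact h1
    · have e : swapIx 6 = 7 := rfl
      rw [Nat.testBit_xor, h 6 hi, e]
      revert h1
      generalize v.testBit 6 = a
      generalize v.testBit 7 = b
      revert a b; decide
  · split_ifs with h1
    · exact h1.symm
    · have e : swapIx 7 = 6 := rfl
      rw [Nat.testBit_xor, h 7 hi, e]
      revert h1
      generalize v.testBit 6 = a
      generalize v.testBit 7 = b
      revert a b; decide

lemma exists_add_flat {A : List ℕ} (hA : A.length ≤ 20) (x : ℕ) :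
    ∃ t, ∃ B : List ℕ, B.length ≤ 26 ∧ ∀ p, par B p = (par A p ^^ par (flat t x) p) := by
  cases A with
  | nil => exact ⟨0, flat 0 x, by simp [flat], fun p => by simp⟩
  | cons t A =>
    refine ⟨t, A ++ (flat t x).tail, ?_, fun p => ?_⟩
    · simp only [List.length_cons] at hA
      simp only [List.length_append, flat, List.tail_cons, List.length_cons, List.length_nil]
      omega
    · have : flat t x = t :: (flat t x).tail := rfl
      rw [par_append, this, par_cons, par_cons, List.tail_cons]
      generalize p t = a
      generalize par A p = b
      generalize par _ p = c
      revert a b c; decide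

lemma good_degenerate {L : List Bool} (h0 : ∀ T < 35, 20 ≤ T → L.getD T false = false) :
    Good 26 L := by
  let M : List Bool := (List.range 56).map fun T =>
    if T < 20 then L.getD T false else if T < 35 then L.getD (T + 15) false else false
  have hM : ∀ T < 56, M.getD T false =
      if T < 20 then L.getD T false else if T < 35 then L.getD (T + 15) false else false :=
    fun T hT => by simp [M, List.getD_eq_getElem?_getD, hT]
  obtain ⟨A, hA, -, hA0, hAm⟩ := goodSeven (L := M) (by simp [M]) fun T hT h => by
    rw [hM T hT, if_neg (by omega), if_neg (by omega)]
  let x : ℕ := Nat.ofBits fun i : Fin 6 => L.getD (50 + i) false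
  have hx : ∀ i < 6, x.testBit i = L.getD (50 + i) false := fun i hi =>
    Nat.testBit_ofBits_lt _ i hi
  have hx' : ∀ i, 6 ≤ i → x.testBit i = false := fun i hi => Nat.testBit_ofBits_ge _ i hi
  obtain ⟨t, B, hB, hpar⟩ := exists_add_flat (A := A.map swapPt) (by simpa using hA) x
  have hm : ∀ i < 8, ∀ j < 8, ∀ k < 8, mom B i j k =
      (ent M (swapIx i) (swapIx j) (swapIx k) ^^ mom (flat t x) i j k) := by
    intro i hi j hj k hk
    have hs : ∀ i < 8, swapIx i < 8 := by decide
    rw [← hAm _ (hs i hi) _ (hs j hj) _ (hs k hk)]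
    have : mom (A.map swapPt) i j k = mom A (swapIx i) (swapIx j) (swapIx k) := by
      simp only [mom, par_map, testBit_swapPt _ i hi, testBit_swapPt _ j hj, testBit_swapPt _ k hk]
    rw [← this]
    exact hpar _
  refine ⟨B, hB, represents_of_lt ?_ (fun i hi k hk => ?_) fun k hk j hj i hi => ?_⟩
  · rw [hpar, par_map, hA0]
    rfl
  · rw [hm i hi i hi k hk, ent_self, mom_flat]
    generalize x.testBit i = a1
    generalize x.testBit k = a2
    generalize Nat.testBit 64 i = b1
    generalize Nat.testBit 64 k = b2
    generalize Nat.testBit 128 i = c1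
    generalize Nat.testBit 128 k = c2
    revert a1 a2 b1 b2 c1 c2; decide
  · have h64 : ∀ i < 8, Nat.testBit 64 i = decide (i = 6) := by decide
    have h128 : ∀ i < 8, Nat.testBit 128 i = decide (i = 7) := by decide
    have hid : ∀ i < 6, swapIx i = i := by decide
    have h6 : swapIx 6 = 7 := rfl
    have h7 : swapIx 7 = 6 := rfl
    rw [hm i (by omega) j (by omega) k hk, mom_flat, h64 i (by omega), h64 j (by omega), h64 k hk,
      h128 i (by omega), h128 j (by omega), h128 k hk]
    have low : ∀ k < 6, ∀ j < k, ∀ i < j, tix i j k < 20 := by decide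
    have mid : ∀ j < 6, ∀ i < j, 20 ≤ tix i j 6 ∧ tix i j 6 < 35 ∧ tix i j 7 = tix i j 6 + 15 := by
      decide
    have top : ∀ i < 6, tix i 6 7 = 50 + i ∧ tix i 7 6 = 50 + i := by decide
    obtain hk6 | rfl | ⟨rfl, hj6⟩ | ⟨rfl, rfl⟩ : k < 6 ∨ k = 6 ∨ (k = 7 ∧ j < 6) ∨
        (k = 7 ∧ j = 6) := by omega
    · have := low k hk6 j hj i hi
      rw [hid i (by omega), hid j (by omega), hid k hk6, ent_of_ne M (by omega) (by omega)
        (by omega), hM _ (by omega), if_pos this]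
      have e1 : i ≠ 6 := by omega
      have e2 : j ≠ 6 := by omega
      have e3 : k ≠ 6 := by omega
      simp [e1, e2, e3]
    · obtain ⟨m1, m2, m3⟩ := mid j hj i hi
      rw [hid i (by omega), hid j hj, h6, ent_of_ne M (by omega) (by omega)
        (by omega), hM _ (by omega), if_neg (by omega), if_neg (by omega), h0 _ m2 m1]
      have e1 : i ≠ 7 := by omega
      have e2 : j ≠ 7 := by omega
      simp [e1, e2]
    · obtain ⟨m1, m2, m3⟩ := mid j hj6 i hi
      rw [hid i (by omega), hid j hj6, h7, ent_of_ne M (by omega) (by omega)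
        (by omega), hM _ (by omega), if_neg (by omega), if_pos m2, m3]
      have e1 : i ≠ 6 := by omega
      have e2 : j ≠ 6 := by omega
      simp [e1, e2]
    · obtain ⟨m1, m2⟩ := top i hi
      rw [hid i hi, h6, h7, ent_of_ne M (by omega) (by omega)
        (by omega), m2, hM _ (by omega), if_neg (by omega), if_neg (by omega), m1, ← hx i hi]
      have e1 : i ≠ 6 := by omega
      have e2 : i ≠ 7 := by omega
      simp [e1, e2]

theorem good {L : List Bool} (hL : L.length = 56) : Good 26 L := by
  have hstep : ∀ r ∈ reps7, ∀ L : List Bool, L.length = 56 →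
      (∀ T < 56, T < ch3 7 → L.getD T false = r.testBit T) → Good 26 L := by
    have hdeg : ∀ r < 2 ^ 20, ∀ L : List Bool, L.length = 56 →
        (∀ T < 56, T < ch3 7 → L.getD T false = r.testBit T) → Good 26 L :=
      fun r hr L _ h => good_degenerate fun T hT hT' => by
        rw [h T (by omega) hT]
        exact Nat.testBit_lt_two_pow (hr.trans_le (Nat.pow_le_pow_right (by norm_num) hT'))
    have hext : ∀ r, ∀ L : List Bool, (∀ T < 56, T < ch3 7 → L.getD T false = r.testBit T) →
        Extends 8 r L := fun r L h T hT hT' => by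
      rcases hT' with hT' | hT'
      · exact h T hT hT'
      · have : ch3 8 = 56 := rfl
        omega
    simp only [reps7, List.forall_mem_cons]
    exact ⟨hdeg _ (by norm_num), hdeg _ (by norm_num), hdeg _ (by norm_num),
      hdeg _ (by norm_num), hdeg _ (by norm_num), hdeg _ (by norm_num),
      fun L hL h => good_extends_6 L hL (hext _ L h),
      fun L hL h => good_extends_7 L hL (hext _ L h),
      fun L hL h => good_extends_8 L hL (hext _ L h),
      fun L hL h => good_extends_9 L hL (hext _ L h),
      fun L hL h => good_extends_10 L hL (hext _ L h),
      fun L hL h => good_extends_11 L hL (hext _ L h), by simp⟩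
  exact of_classifies (n := 8) (by norm_num) rfl classifies_seven
    (fun a ha b hb hab L hL h => good_of_tau ha hb hab hL h)
    (fun r hr L hL h _ => hstep r hr L hL h) L hL fun T hT h => absurd hT (not_lt.mpr h)

lemma getD_map_trips (g : ℕ × ℕ × ℕ → Bool) {i j k : ℕ} (hij : i < j) (hjk : j < k) (hk : k < 8) :
    (trips.map g).getD (tix i j k) false = g (i, j, k) := by
  have h : ∀ k < 8, ∀ j < k, ∀ i < j, trips.getD (tix i j k) (0, 0, 0) = (i, j, k) ∧
      tix i j k < trips.length := by decide +kernel
  obtain ⟨h1, h2⟩ := h k hk j hjk i hij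
  rw [List.getD_eq_getElem _ _ h2] at h1
  rw [List.getD_eq_getElem _ _ (by simpa using h2), List.getElem_map, h1]

theorem distRM_le {f : BF 8} (hf : deg f ≤ 5) : distRM 8 4 f ≤ 26 := by
  classical
  let x : ℕ → Fin 8 := fun i => Fin.ofNat 8 i
  let L : List Bool := trips.map fun t => decide (moment f {x t.1, x t.2.1, x t.2.2} = 1)
  obtain ⟨A, hA, hA0, hAm⟩ := good (L := L) (by rw [List.length_map]; decide +kernel)
  have h1 : ∀ i j k : ℕ, i < j → j < k → k < 8 →
      ent L i j k = decide (moment f {x i, x j, x k} = 1) := fun i j k hij hjk hk => by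
    rw [ent_of_ne L (by omega) (by omega) (by omega)]
    exact getD_map_trips _ hij hjk hk
  have h2 : ∀ i j k : ℕ, i ≠ j → j < k → i ≠ k → i < 8 → k < 8 →
      ent L i j k = decide (moment f {x i, x j, x k} = 1) := fun i j k hij hjk hik hi hk => by
    obtain h | h | h : i < j ∨ (j < i ∧ i < k) ∨ k < i := by omega
    · exact h1 i j k h hjk hk
    · rw [ent_swap12, h1 j i k h.1 h.2 hk, Finset.insert_comm]
    · rw [ent_swap12, ent_swap23, h1 j k i hjk h hi, Finset.insert_comm, Finset.pair_comm,
        Finset.insert_comm, Finset.pair_comm, Finset.insert_comm]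
  have h3 : ∀ i j k : ℕ, i ≠ j → j ≠ k → i ≠ k → i < 8 → j < 8 → k < 8 →
      ent L i j k = decide (moment f {x i, x j, x k} = 1) :=
    fun i j k hij hjk hik hi hj hk => by
    obtain h | h := lt_or_gt_of_ne hjk
    · exact h2 i j k hij h hik hi hk
    · rw [ent_swap23, h2 i k j hik h hij hi hj, Finset.pair_comm]
  have hx : ∀ i : Fin 8, x i = i := fun i => by simp [x]
  have hz : ∀ y : ZMod 2, y = ((decide (y = 1)).toNat : ZMod 2) := by decide
  have hmom : ∀ i j k : Fin 8, moment f {i, j, k} = ((mom A i j k).toNat : ZMod 2) := by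
    intro i j k
    rw [hAm i i.isLt j j.isLt k k.isLt]
    by_cases h : (i : ℕ) ≠ j ∧ (j : ℕ) ≠ k ∧ (i : ℕ) ≠ k
    · rw [h3 i j k h.1 h.2.1 h.2.2 i.isLt j.isLt k.isLt, ← hz, hx, hx, hx]
    · have h' : i = j ∨ j = k ∨ i = k := by
        simp only [Fin.ext_iff]; tauto
      have hent : ent L i j k = false := by
        rcases h' with rfl | rfl | rfl <;> simp [ent]
      rw [hent, moment_eq_zero hf]
      · rfl
      · have : ({i, j, k} : Finset (Fin 8)).card ≤ 2 := by
          rcases h' with rfl | rfl | rfl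
          · simpa using Finset.card_le_two (a := i) (b := k)
          · simpa using Finset.card_le_two (a := i) (b := j)
          · rw [Finset.insert_comm]
            simpa using Finset.card_le_two (a := j) (b := i)
        omega
  have hwt : wt (f + (f + ofPts 8 A)) ≤ 26 := by
    have h0 : f + f = 0 := funext fun v => CharTwo.add_self_eq_zero (f v)
    rw [← add_assoc, h0, zero_add]
    exact (wt_ofPts_le 8 A).trans hA
  have hdeg : deg (f + ofPts 8 A) ≤ 4 := by
    refine deg_le_of_moment fun T hT => ?_
    rw [moment_add]
    obtain rfl | hne := T.eq_empty_or_nonempty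
    · rw [moment_eq_zero hf (by simp), moment_ofPts_empty, hA0]
      rfl
    · obtain ⟨i, j, k, rfl, -⟩ := exists_prod_eq (T := T) (by omega) hne
      rw [hmom, ← sum_mul_triple (ofPts 8 A), sum_ofPts_mom, CharTwo.add_self_eq_zero]
  exact le_trans (Nat.sInf_le ⟨_, hdeg, rfl⟩) hwt

end UpperBound

section BooleanExpressions

/-- Boolean expressions. -/
inductive BExp
  | ff
  | tt
  | var (n : ℕ)
  | xor (p q : BExp)
  | and (p q : BExp)
  | or (p q : BExp)

namespace BExp

/-- The value of an expression when the variables take the values in the list `e`. -/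
def evalB (e : List Bool) : BExp → Bool
  | ff => false
  | tt => true
  | var n => e.getD n false
  | xor p q => evalB e p ^^ evalB e q
  | and p q => evalB e p && evalB e q
  | or p q => evalB e p || evalB e q

/-- Bitwise evaluation of an expression, where `m` stands for the constant `true`. -/
def evalN (m : ℕ) (L : List ℕ) : BExp → ℕ
  | ff => 0
  | tt => m
  | var n => L.getD n 0
  | xor p q => Nat.xor (evalN m L p) (evalN m L q)
  | and p q => Nat.land (evalN m L p) (evalN m L q)
  | or p q => Nat.lor (evalN m L p) (evalN m L q)

lemma testBit_evalN {m i : ℕ} (hm : m.testBit i = true) (L : List ℕ) (p : BExp) :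
    (evalN m L p).testBit i = evalB (L.map fun v => v.testBit i) p := by
  induction p with
  | ff => simp [evalN, evalB]
  | tt => simpa [evalN, evalB] using hm
  | var n =>
    simp only [evalN, evalB]
    obtain h | h := lt_or_ge n L.length
    · rw [List.getD_eq_getElem _ _ h, List.getD_eq_getElem _ _ (by simpa using h), List.getElem_map]
    · rw [List.getD_eq_default _ _ h, List.getD_eq_default _ _ (by simpa using h)]
      simp
  | xor p q hp hq => rw [evalN, evalB, ← hp, ← hq]; exact Nat.testBit_xor _ _ _
  | and p q hp hq => rw [evalN, evalB, ← hp, ← hq]; exact Nat.testBit_and _ _ _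
  | or p q hp hq => rw [evalN, evalB, ← hp, ← hq]; exact Nat.testBit_or _ _ _

/-- A constant expression. -/
def const (b : Bool) : BExp := bif b then tt else ff

@[simp] lemma evalB_const (e : List Bool) (b : Bool) : evalB e (const b) = b := by
  cases b <;> rfl

/-- The sum of the expressions `f i`, for `i` in the list `l`. -/
def sum (l : List ℕ) (f : ℕ → BExp) : BExp := l.foldr (fun i p => xor (f i) p) ff

@[simp] lemma evalB_sum (e : List Bool) (l : List ℕ) (f : ℕ → BExp) :
    evalB e (sum l f) = par l fun i => evalB e (f i) := by
  induction l with
  | nil => rfl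
  | cons i l ih => rw [par_cons, ← ih]; rfl

/-- The conjunction of the expressions `f i`, for `i` in the list `l`. -/
def all {ι : Type} (l : List ι) (f : ι → BExp) : BExp := l.foldr (fun i p => and (f i) p) tt

@[simp] lemma evalB_all {ι : Type} (e : List Bool) (l : List ι) (f : ι → BExp) :
    evalB e (all l f) = l.all fun i => evalB e (f i) := by
  induction l with
  | nil => rfl
  | cons i l ih => rw [List.all_cons, ← ih]; rfl

/-- The disjunction of the expressions `f i`, for `i` in the list `l`. -/
def any {ι : Type} (l : List ι) (f : ι → BExp) : BExp := l.foldr (fun i p => or (f i) p) ff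

@[simp] lemma evalB_any {ι : Type} (e : List Bool) (l : List ι) (f : ι → BExp) :
    evalB e (any l f) = l.any fun i => evalB e (f i) := by
  induction l with
  | nil => rfl
  | cons i l ih => rw [List.any_cons, ← ih]; rfl

@[simp] lemma evalB_cond (e : List Bool) (b : Bool) (p q : BExp) :
    evalB e (bif b then p else q) = bif b then evalB e p else evalB e q := by
  cases b <;> rfl

end BExp

lemma testBit_ones {k i : ℕ} (hi : i < k) : (2 ^ k - 1).testBit i = true := by
  rw [Nat.testBit_two_pow_sub_one]; simpa using hi

lemma evalB_eq_false {k : ℕ} {p : BExp}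
    (h : p.evalN (2 ^ 2 ^ k - 1) (truthCols k) = 0) {e : List Bool} (he : e.length = k) : p.evalB e = false := by
  obtain ⟨i, hi, rfl⟩ := exists_index e he
  rw [← BExp.testBit_evalN (testBit_ones hi), h, Nat.zero_testBit]

/-- Composition of bitwise evaluations. -/
lemma evalB_eq_false_of_subst {k : ℕ} {P : List BExp} {p : BExp}
    (h : p.evalN (2 ^ 2 ^ k - 1) (P.map fun q => q.evalN (2 ^ 2 ^ k - 1) (truthCols k)) = 0)
    {e : List Bool} (he : e.length = k) : p.evalB (P.map fun q => q.evalB e) = false := by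
  obtain ⟨i, hi, rfl⟩ := exists_index e he
  have : P.map (fun q => q.evalB ((truthCols k).map fun v => v.testBit i)) =
      (P.map fun q => q.evalN (2 ^ 2 ^ k - 1) (truthCols k)).map fun v => v.testBit i := by
    rw [List.map_map]
    exact List.map_congr_left fun q _ => (BExp.testBit_evalN (testBit_ones hi) _ _).symm
  rw [this, ← BExp.testBit_evalN (testBit_ones hi), h, Nat.zero_testBit]

end BooleanExpressions

section Forms

lemma par_false (A : List ℕ) : par A (fun _ => false) = false := by
  induction A with
  | nil => rfl
  | cons a A ih => simpa using ih

lemma par_and_left (A : List ℕ) (c : Bool) (p : ℕ → Bool) :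
    par A (fun a => c && p a) = (c && par A p) := by
  cases c
  · simpa using par_false A
  · simp

lemma par_comm (A B : List ℕ) (p : ℕ → ℕ → Bool) :
    par A (fun a => par B fun b => p a b) = par B fun b => par A fun a => p a b := by
  induction A with
  | nil => simp [par_false]
  | cons a A ih => simp only [par_cons, ih, par_xor]

lemma par_and_eq_filter (A : List ℕ) (p q : ℕ → Bool) :
    par A (fun a => q a && p a) = par (A.filter q) p := by
  induction A with
  | nil => rfl
  | cons a A ih => cases h : q a <;> simp [h, ih]

lemma exists_mem_of_par {A : List ℕ} {p : ℕ → Bool} (h : par A p = true) : ∃ a ∈ A, p a = true := by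
  by_contra! hc
  rw [par_congr (q := fun _ => false) fun a ha => by simpa using hc a ha, par_false] at h
  exact absurd h (by decide)

lemma par_true (A : List ℕ) : (par A fun _ => true) = decide (A.length % 2 = 1) := by
  induction A with
  | nil => rfl
  | cons a A ih =>
    rw [par_cons, ih, List.length_cons]
    obtain h | h := Nat.mod_two_eq_zero_or_one A.length <;> simp [h] <;> omega

/-- The linear form on `𝔽₂⁶` with coefficient vector `u`. -/
def lin (u a : ℕ) : Bool := par (List.range 6) fun i => u.testBit i && a.testBit i

lemma lin_xor (u v a : ℕ) : lin (u ^^^ v) a = (lin u a ^^ lin v a) := by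
  unfold lin
  rw [← par_xor]
  refine par_congr fun i _ => ?_
  rw [Nat.testBit_xor]
  generalize u.testBit i = x
  generalize v.testBit i = y
  generalize a.testBit i = z
  revert x y z; decide

/-- The position of the pair `{i, j}`, where `i ≠ j` and `i, j < 6`, in lexicographic order. -/
def pix (i j : ℕ) : ℕ := bif Nat.blt i j then i * (11 - i) / 2 + (j - i - 1)
  else j * (11 - j) / 2 + (i - j - 1)

/-- The alternating form on `𝔽₂⁶` coded by the bits of `g`. -/
def gb (g i j : ℕ) : Bool := bif i == j then false else g.testBit (pix i j)

/-- The value of the alternating form `g` at two vectors. -/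
def evalG (g u v : ℕ) : Bool :=
  par (List.range 6) fun i => u.testBit i && par (List.range 6) fun j => v.testBit j && gb g i j

/-- A list of points of `𝔽₂⁶` of even size and with sum zero, whose matrix of second moments
is the alternating form `g`. -/
structure HasGram (g : ℕ) (A : List ℕ) : Prop where
  even : (par A fun _ => true) = false
  gram : ∀ i < 6, ∀ j < 6, (par A fun a => a.testBit i && a.testBit j) = gb g i j

variable {g : ℕ} {A : List ℕ}

lemma HasGram.bit (h : HasGram g A) {i : ℕ} (hi : i < 6) :
    (par A fun a => a.testBit i) = false := by
  have := h.gram i hi i hi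
  simpa [gb] using this

lemma HasGram.lin_mul_bit (h : HasGram g A) (u : ℕ) {j : ℕ} (hj : j < 6) :
    (par A fun a => lin u a && a.testBit j) =
      par (List.range 6) fun i => u.testBit i && gb g i j := by
  have h1 : ∀ a : ℕ, (lin u a && a.testBit j) =
      par (List.range 6) fun i => u.testBit i && (a.testBit i && a.testBit j) := fun a => by
    rw [Bool.and_comm, lin, ← par_and_left]
    refine par_congr fun i _ => ?_
    generalize u.testBit i = x
    generalize a.testBit i = y
    generalize a.testBit j = z
    revert x y z; decide
  simp only [h1]
  rw [par_comm]
  refine par_congr fun i hi => ?_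
  rw [par_and_left, h.gram i (List.mem_range.mp hi) j hj]

lemma HasGram.sum_lin (h : HasGram g A) (u : ℕ) : par A (lin u) = false := by
  unfold lin
  rw [par_comm, par_congr (q := fun _ => false), par_false]
  intro i hi
  rw [par_and_left, h.bit (List.mem_range.mp hi), Bool.and_false]

lemma gb_symm (g i j : ℕ) : gb g i j = gb g j i := by
  obtain h | rfl | h := lt_trichotomy i j
  · have h1 : i.blt j = true := by simpa [Nat.blt_eq] using h
    have h2 : j.blt i = false := by
      rw [← Bool.not_eq_true, Nat.blt_eq]; omega
    have h3 : (i == j) = false := by simpa using h.ne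
    have h4 : (j == i) = false := by simpa using h.ne'
    simp [gb, pix, h1, h2, h3, h4]
  · rfl
  · have h1 : j.blt i = true := by simpa [Nat.blt_eq] using h
    have h2 : i.blt j = false := by
      rw [← Bool.not_eq_true, Nat.blt_eq]; omega
    have h3 : (j == i) = false := by simpa using h.ne
    have h4 : (i == j) = false := by simpa using h.ne'
    simp [gb, pix, h1, h2, h3, h4]

lemma HasGram.lin_mul_lin (h : HasGram g A) (u v : ℕ) :
    (par A fun a => lin u a && lin v a) = evalG g u v := by
  have h1 : ∀ a : ℕ, (lin u a && lin v a) =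
      par (List.range 6) fun i => u.testBit i && (lin v a && a.testBit i) := fun a => by
    rw [Bool.and_comm]
    nth_rewrite 2 [lin]
    rw [← par_and_left]
    refine par_congr fun i _ => ?_
    generalize u.testBit i = x
    generalize a.testBit i = y
    generalize lin v a = z
    revert x y z; decide
  simp only [h1]
  rw [par_comm]
  refine par_congr fun i hi => ?_
  rw [par_and_left, h.lin_mul_bit v (List.mem_range.mp hi)]
  simp only [gb_symm g i]

lemma HasGram.pad (h : HasGram g A) {n : ℕ} (hn : A.length ≤ 2 * n) :
    ∃ B, B.length = 2 * n ∧ HasGram g B := by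
  have h0 : A.length % 2 = 0 := by
    have := h.even
    rw [par_true] at this
    simpa using this
  have hp : ∀ p : ℕ → Bool, ∀ k, par (List.replicate (2 * k) 0 ++ A) p = par A p := by
    intro p k
    rw [par_append]
    induction k with
    | zero => simp
    | succ k ih => rw [Nat.mul_succ]; simpa [List.replicate_succ] using ih
  refine ⟨List.replicate (2 * (n - A.length / 2)) 0 ++ A, ?_, ?_⟩
  · rw [List.length_append, List.length_replicate]; omega
  · exact ⟨by rw [hp, h.even], fun i hi j hj => by rw [hp, h.gram i hi j hj]⟩

lemma HasGram.eq_false_of_length_le_two (h : HasGram g A) (hA : A.length ≤ 2) {i j : ℕ}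
    (hi : i < 6) (hj : j < 6) : gb g i j = false := by
  obtain ⟨B, hB, h⟩ := h.pad (n := 1) hA
  obtain ⟨a, b, rfl⟩ := List.length_eq_two.mp hB
  have h1 := h.bit hi
  have h2 := h.bit hj
  rw [← h.gram i hi j hj]
  simp only [par_cons, par_nil] at h1 h2 ⊢
  revert h1 h2
  generalize a.testBit i = x1
  generalize b.testBit i = x2
  generalize a.testBit j = y1
  generalize b.testBit j = y2
  revert x1 x2 y1 y2; decide

/-- The Pfaffian of a `4 × 4` principal submatrix. -/
def pfaff (g i j k l : ℕ) : Bool :=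
  (gb g i j && gb g k l) ^^ (gb g i k && gb g j l) ^^ (gb g i l && gb g j k)

lemma pfaff_aux : ∀ x1 x2 x3 y1 y2 y3 z1 z2 z3 w1 w2 w3 : Bool,
    ((((x1 && y1) ^^ ((x2 && y2) ^^ ((x3 && y3) ^^
      ((x1 ^^ x2 ^^ x3) && (y1 ^^ y2 ^^ y3))))) &&
      ((z1 && w1) ^^ ((z2 && w2) ^^ ((z3 && w3) ^^
      ((z1 ^^ z2 ^^ z3) && (w1 ^^ w2 ^^ w3)))))) ^^
    (((x1 && z1) ^^ ((x2 && z2) ^^ ((x3 && z3) ^^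
      ((x1 ^^ x2 ^^ x3) && (z1 ^^ z2 ^^ z3))))) &&
      ((y1 && w1) ^^ ((y2 && w2) ^^ ((y3 && w3) ^^
      ((y1 ^^ y2 ^^ y3) && (w1 ^^ w2 ^^ w3)))))) ^^
    (((x1 && w1) ^^ ((x2 && w2) ^^ ((x3 && w3) ^^
      ((x1 ^^ x2 ^^ x3) && (w1 ^^ w2 ^^ w3))))) &&
      ((y1 && z1) ^^ ((y2 && z2) ^^ ((y3 && z3) ^^
      ((y1 ^^ y2 ^^ y3) && (z1 ^^ z2 ^^ z3))))))) = false := by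
  decide +kernel

lemma HasGram.pfaff_eq_false (h : HasGram g A) (hA : A.length ≤ 4) {i j k l : ℕ}
    (hi : i < 6) (hj : j < 6) (hk : k < 6) (hl : l < 6) : pfaff g i j k l = false := by
  obtain ⟨B, hB, h⟩ := h.pad (n := 2) hA
  match B, hB with
  | [a, b, c, d], _ =>
    have h1 : ∀ i < 6, d.testBit i = (a.testBit i ^^ b.testBit i ^^ c.testBit i) := fun i hi => by
      have := h.bit hi
      simp only [par_cons, par_nil] at this
      revert this
      generalize a.testBit i = x1
      generalize b.testBit i = x2
      generalize c.testBit i = x3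
      generalize d.testBit i = x4
      revert x1 x2 x3 x4; decide
    rw [pfaff, ← h.gram i hi j hj, ← h.gram k hk l hl, ← h.gram i hi k hk, ← h.gram j hj l hl,
      ← h.gram i hi l hl, ← h.gram j hj k hk]
    simp only [par_cons, par_nil, h1 i hi, h1 j hj, h1 k hk, h1 l hl, Bool.xor_false]
    exact pfaff_aux _ _ _ _ _ _ _ _ _ _ _ _

/-- The vector `r` lies in the radical of the form `g`. -/
def inRad (g r : ℕ) : Bool :=
  (List.range 6).all fun j => !par (List.range 6) fun i => r.testBit i && gb g i j

lemma inRad_of_const (h : HasGram g A) {r : ℕ} {c : Bool} (hc : ∀ a ∈ A, lin r a = c) :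
    inRad g r = true := by
  rw [inRad, List.all_eq_true]
  intro j hj
  rw [← h.lin_mul_bit r (List.mem_range.mp hj),
    par_congr (q := fun a => c && a.testBit j) fun a ha => by rw [hc a ha], par_and_left,
    h.bit (List.mem_range.mp hj), Bool.and_false, Bool.not_false]

lemma HasGram.exists_inRad (h : HasGram g A) (hA : A.length ≤ 6) :
    ∃ r ∈ List.range' 1 63, inRad g r = true := by
  obtain ⟨B, hB, h⟩ := h.pad (n := 3) hA
  match B, hB with
  | [a, b, c, d, e, f], _ =>
    let F : ℕ → Bool × Bool × Bool × Bool := fun r =>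
      (lin r a ^^ lin r b, lin r a ^^ lin r c,
        lin r a ^^ lin r d, lin r a ^^ lin r e)
    obtain ⟨x, hx, y, hy, hxy, hF⟩ := Finset.exists_ne_map_eq_of_card_lt_of_maps_to
      (s := Finset.range 64) (t := Finset.univ) (f := F) (by decide) (by simp)
    rw [Finset.mem_range] at hx hy
    have hlt : x ^^^ y < 2 ^ 6 := Nat.xor_lt_two_pow hx hy
    have hne : x ^^^ y ≠ 0 := fun h0 => hxy (Nat.xor_eq_zero_iff.mp h0)
    refine ⟨x ^^^ y, by rw [List.mem_range'_1]; omega, ?_⟩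
    refine inRad_of_const h (c := lin (x ^^^ y) a) ?_
    have hl := h.sum_lin (x ^^^ y)
    simp only [par_cons, par_nil, lin_xor] at hl
    simp only [F, Prod.mk.injEq] at hF
    obtain ⟨h1, h2, h3, h4⟩ := hF
    simp only [List.mem_cons, List.not_mem_nil, or_false, lin_xor]
    have key : ∀ x1 x2 y1 y2 : Bool, (x1 ^^ x2) = (y1 ^^ y2) → (x2 ^^ y2) = (x1 ^^ y1) := by decide
    have hb := key _ _ _ _ h1
    have hc := key _ _ _ _ h2
    have hd := key _ _ _ _ h3
    have he := key _ _ _ _ h4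
    rintro z (rfl | rfl | rfl | rfl | rfl | rfl)
    · rfl
    · exact hb
    · exact hc
    · exact hd
    · exact he
    · rw [hb, hc, hd, he] at hl
      revert hl
      generalize (lin x a ^^ lin y a) = u
      generalize (lin x z ^^ lin y z) = v
      revert u v; decide

end Forms

section Levels

/-- The entry of the alternating form with coefficients the variables of the expression. -/
def gbE (i j : ℕ) : BExp := bif i == j then .ff else .var (pix i j)

/-- The bits of an alternating form. -/
def gramBits (g : ℕ) : List Bool := (List.range 15).map fun k => g.testBit k

lemma pix_lt : ∀ i < 6, ∀ j < 6, i ≠ j → pix i j < 15 := by decide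

lemma evalB_gbE {g : ℕ} {e : List Bool} (he : ∀ k < 15, e.getD k false = g.testBit k) {i j : ℕ}
    (hi : i < 6) (hj : j < 6) : (gbE i j).evalB e = gb g i j := by
  by_cases h : i = j
  · subst h; simp [gbE, gb, BExp.evalB]
  · have h1 : (i == j) = false := by simpa using h
    simp only [gbE, gb, h1, cond_false, BExp.evalB]
    exact he _ (pix_lt i hi j hj h)

lemma getD_gramBits (g : ℕ) : ∀ k < 15, (gramBits g).getD k false = g.testBit k := fun k hk => by
  rw [gramBits, List.getD_eq_getElem _ _ (by simpa using hk)]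
  simp

/-- The form is nonzero. -/
def nonzeroE : BExp := .any (List.range 6) fun j => .any (List.range j) fun i => gbE i j

/-- The form has rank at least `4`. -/
def pfaffE : BExp :=
  .any (List.range 6) fun l => .any (List.range l) fun k => .any (List.range k) fun j =>
    .any (List.range j) fun i => .xor (.xor (.and (gbE i j) (gbE k l)) (.and (gbE i k) (gbE j l)))
      (.and (gbE i l) (gbE j k))

/-- The Pfaffian of the form. -/
def nondegE : BExp :=
  let pf (i j k l : ℕ) : BExp := .xor (.xor (.and (gbE i j) (gbE k l)) (.and (gbE i k) (gbE j l)))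
    (.and (gbE i l) (gbE j k))
  .xor (.and (gbE 0 1) (pf 2 3 4 5)) (.xor (.and (gbE 0 2) (pf 1 3 4 5))
    (.xor (.and (gbE 0 3) (pf 1 2 4 5)) (.xor (.and (gbE 0 4) (pf 1 2 3 5))
      (.and (gbE 0 5) (pf 1 2 3 4)))))

/-- A sufficient condition for a set of points with second moments `g` to have at least `2 * k`
elements. -/
def lowE : ℕ → BExp
  | 0 => .tt
  | 2 => nonzeroE
  | 3 => pfaffE
  | 4 => nondegE
  | _ => .ff

/-- Evaluation of `lowE` at a form. -/
def low (k g : ℕ) : Bool := (lowE k).evalB (gramBits g)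

variable {g : ℕ} {A : List ℕ}

lemma evalB_nondegE {e e' : List Bool} (he : ∀ k < 15, e.getD k false = g.testBit k)
    (he' : ∀ k < 15, e'.getD k false = g.testBit k) : nondegE.evalB e = nondegE.evalB e' := by
  simp only [nondegE, BExp.evalB]
  have h : ∀ i < 6, ∀ j < 6, (gbE i j).evalB e = (gbE i j).evalB e' := fun i hi j hj => by
    rw [evalB_gbE he hi hj, evalB_gbE he' hi hj]
  simp only [h _ (show 0 < 6 by decide), h _ (show 1 < 6 by decide), h _ (show 2 < 6 by decide),
    h _ (show 3 < 6 by decide), h _ (show 4 < 6 by decide), Nat.reduceLT]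

/-- A form with nonzero Pfaffian has no nonzero vector in its radical. -/
def radE : BExp :=
  .and nondegE (.and (.any (List.range 6) fun i => .var (15 + i)) (.all (List.range 6) fun j =>
    .xor .tt (.sum (List.range 6) fun i => .and (.var (15 + i)) (gbE i j))))

lemma evalN_radE : radE.evalN (2 ^ 2 ^ 21 - 1) (truthCols 21) = 0 := by
  decide +kernel

lemma inRad_eq_false (hg : nondegE.evalB (gramBits g) = true) {r : ℕ}
    (hr : r ∈ List.range' 1 63) : inRad g r = false := by
  rw [← Bool.not_eq_true]
  intro hrad
  have h0 := evalB_eq_false evalN_radE (e := gramBits g ++ (List.range 6).map r.testBit)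
    (by simp [gramBits])
  have he : ∀ k < 15, (gramBits g ++ (List.range 6).map r.testBit).getD k false =
      g.testBit k := fun k hk => by
    rw [List.getD_append _ _ _ _ (by simpa [gramBits] using hk), getD_gramBits g k hk]
  have hv : ∀ i < 6, (gramBits g ++ (List.range 6).map r.testBit).getD (15 + i) false =
      r.testBit i := fun i hi => by
    rw [List.getD_append_right _ _ _ _ (by simp [gramBits]),
      List.getD_eq_getElem _ _ (by simpa [gramBits] using hi)]
    simp [gramBits]
  rw [← Bool.not_eq_true] at h0
  apply h0
  simp only [radE, BExp.evalB, BExp.evalB_any, BExp.evalB_all, BExp.evalB_sum, Bool.and_eq_true,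
    List.any_eq_true, List.all_eq_true, List.mem_range]
  refine ⟨by rw [evalB_nondegE he (getD_gramBits g), hg], ?_, fun j hj => ?_⟩
  · have h : ∀ r ∈ List.range' 1 63, ∃ i < 6, r.testBit i = true := by decide
    obtain ⟨i, hi, hri⟩ := h r hr
    exact ⟨i, hi, by rw [hv i hi, hri]⟩
  · rw [inRad, List.all_eq_true] at hrad
    have := hrad j (List.mem_range.mpr hj)
    rw [par_congr (q := fun i => r.testBit i && gb g i j)]
    · simpa using this
    · intro i hi
      rw [List.mem_range] at hi
      rw [hv i hi, evalB_gbE he hi hj]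

lemma HasGram.even_length (h : HasGram g A) : A.length % 2 = 0 := by
  have := h.even
  rw [par_true] at this
  simpa using this

lemma HasGram.le_length (h : HasGram g A) {k : ℕ} (hk : low k g = true) : 2 * k ≤ A.length := by
  have h0 := h.even_length
  match k, hk with
  | 0, _ => exact Nat.zero_le _
  | 2, hk =>
    by_contra hlt
    simp only [low, lowE, nonzeroE, BExp.evalB_any, List.any_eq_true, List.mem_range] at hk
    obtain ⟨j, hj, i, hi, hk⟩ := hk
    rw [evalB_gbE (getD_gramBits g) (hi.trans hj) hj,
      h.eq_false_of_length_le_two (by omega) (hi.trans hj) hj] at hk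
    exact absurd hk (by decide)
  | 3, hk =>
    by_contra hlt
    simp only [low, lowE, pfaffE, BExp.evalB_any, List.any_eq_true, List.mem_range,
      BExp.evalB] at hk
    obtain ⟨l, hl, k, hkl, j, hj, i, hi, hk⟩ := hk
    rw [evalB_gbE (getD_gramBits g) (by omega) (by omega),
      evalB_gbE (getD_gramBits g) (by omega) (by omega),
      evalB_gbE (getD_gramBits g) (by omega) (by omega),
      evalB_gbE (getD_gramBits g) (by omega) (by omega),
      evalB_gbE (getD_gramBits g) (by omega) (by omega),
      evalB_gbE (getD_gramBits g) (by omega) (by omega)] at hk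
    have := h.pfaff_eq_false (by omega) (i := i) (j := j) (k := k) (l := l)
      (by omega) (by omega) (by omega) hl
    rw [pfaff, hk] at this
    exact absurd this (by decide)
  | 4, hk =>
    by_contra hlt
    obtain ⟨r, hr, hrad⟩ := h.exists_inRad (by omega)
    rw [inRad_eq_false hk hr] at hrad
    exact absurd hrad (by decide)

end Levels

section Decomposition

variable {g : ℕ} {A : List ℕ}

lemma par_split (A : List ℕ) (q p : ℕ → Bool) :
    par A p = (par (A.filter q) p ^^ par (A.filter fun a => !q a) p) := by
  induction A with
  | nil => rfl
  | cons a A ih => cases h : q a <;> simp [h, ih, Bool.xor_left_comm]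

lemma HasGram.filter_eq_nil (h : HasGram g A) {k : ℕ} (hk : low k g = true)
    (hA : A.length ≤ 2 * k) {q : ℕ → Bool} (hq : par A q = false)
    (hqi : ∀ i < 6, (par A fun a => q a && a.testBit i) = false)
    (hlen : (A.filter q).length ≤ 3) : A.filter q = [] := by
  by_contra hne
  have h0 : (A.filter q).length % 2 = 0 := by
    have h1 := par_and_eq_filter A (fun _ => true) q
    simp only [Bool.and_true] at h1
    have h2 : par A (fun a => q a) = false := hq
    rw [h2, par_true] at h1
    have := h1.symm
    simpa using this
  have hpos : 0 < (A.filter q).length := List.length_pos_iff.mpr hne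
  have hlen2 : (A.filter q).length + (A.filter fun a => !q a).length = A.length := by
    have := List.length_eq_length_filter_add (l := A) q
    simpa using this.symm
  have hprod : ∀ i < 6, ∀ j < 6,
      (par (A.filter q) fun a => a.testBit i && a.testBit j) = false := by
    intro i hi j hj
    have h1 := hqi i hi
    have h2 := hqi j hj
    rw [par_and_eq_filter] at h1 h2
    obtain ⟨a, b, hab⟩ := List.length_eq_two.mp (show (A.filter q).length = 2 by omega)
    rw [hab] at h1 h2 ⊢
    simp only [par_cons, par_nil] at h1 h2 ⊢
    revert h1 h2
    generalize a.testBit i = x1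
    generalize b.testBit i = x2
    generalize a.testBit j = y1
    generalize b.testBit j = y2
    revert x1 x2 y1 y2; decide
  have hB : HasGram g (A.filter fun a => !q a) := by
    constructor
    · have h1 := par_split A q fun _ => true
      rw [h.even, par_true (A.filter q), h0] at h1
      simpa using h1.symm
    · intro i hi j hj
      have h1 := par_split A q fun a => a.testBit i && a.testBit j
      rw [h.gram i hi j hj, hprod i hi j hj, Bool.false_xor] at h1
      exact h1.symm
  have := hB.le_length hk
  omega

lemma HasGram.lin_const (h : HasGram g A) {k : ℕ} (hk : low k g = true) (hk3 : k ≤ 3)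
    (hA : A.length ≤ 2 * k) {r : ℕ} (hr : inRad g r = true) : ∃ c, ∀ a ∈ A, lin r a = c := by
  have hrad : ∀ i < 6, (par A fun a => lin r a && a.testBit i) = false := fun i hi => by
    rw [h.lin_mul_bit r hi]
    rw [inRad, List.all_eq_true] at hr
    simpa using hr i (List.mem_range.mpr hi)
  have hlen : (A.filter (lin r)).length + (A.filter fun a => !lin r a).length =
      A.length := by
    have := List.length_eq_length_filter_add (l := A) (lin r)
    simpa using this.symm
  have hxor : ∀ a : ℕ, (!lin r a) = (true ^^ lin r a) := fun a => by simp
  obtain h1 | h1 : (A.filter (lin r)).length ≤ 3 ∨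
      (A.filter fun a => !lin r a).length ≤ 3 := by omega
  · refine ⟨false, fun a ha => ?_⟩
    have := h.filter_eq_nil hk hA (h.sum_lin r) hrad h1
    rw [List.filter_eq_nil_iff] at this
    simpa using this a ha
  · refine ⟨true, fun a ha => ?_⟩
    have := h.filter_eq_nil hk hA (q := fun a => !lin r a) ?_ ?_ h1
    · rw [List.filter_eq_nil_iff] at this
      simpa using this a ha
    · simp only [hxor]
      rw [par_xor, h.even]
      simpa using h.sum_lin r
    · intro i hi
      have : ∀ a : ℕ, (!lin r a && a.testBit i) =
          (a.testBit i ^^ (lin r a && a.testBit i)) := fun a => by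
        generalize lin r a = x
        generalize a.testBit i = y
        revert x y; decide
      simp only [this]
      rw [par_xor, h.bit hi, hrad i hi]
      rfl

/-- The quadratic monomials in six variables, in the order: products of two variables,
variables, the constant. -/
def qmon (k : ℕ) (X : ℕ → Bool) : Bool :=
  bif Nat.blt k 15 then
    X ([0, 0, 0, 0, 0, 1, 1, 1, 1, 2, 2, 2, 3, 3, 4].getD k 0) &&
    X ([1, 2, 3, 4, 5, 2, 3, 4, 5, 3, 4, 5, 4, 5, 5].getD k 0)
  else bif Nat.blt k 21 then X (k - 15) else true

/-- The quadratic polynomial in six variables coded by the bits of `c`. -/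
def quad (c a : ℕ) : Bool := par (List.range 22) fun k => c.testBit k && qmon k a.testBit

/-- The sum of the values of a quadratic polynomial over a set with second moments `g`. -/
def quadSum (c g : ℕ) : Bool := par (List.range 15) fun k => c.testBit k && g.testBit k

lemma HasGram.sum_quad (h : HasGram g A) (c : ℕ) : par A (quad c) = quadSum c g := by
  unfold quad
  rw [par_comm]
  have key : ∀ k < 22, (par A fun a => qmon k a.testBit) = (Nat.blt k 15 && g.testBit k) := by
    intro k hk
    obtain h15 | h15 := lt_or_ge k 15
    · have h1 : Nat.blt k 15 = true := by rwa [Nat.blt_eq]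
      simp only [qmon, h1, cond_true, Bool.true_and]
      rw [h.gram _ ?_ _ ?_]
      · clear hk h1
        interval_cases k <;> rfl
      · clear hk h1
        revert k; decide
      · clear hk h1
        revert k; decide
    · have h1 : Nat.blt k 15 = false := by rw [← Bool.not_eq_true, Nat.blt_eq]; omega
      simp only [qmon, h1, cond_false, Bool.false_and]
      obtain h21 | h21 := lt_or_ge k 21
      · have h2 : Nat.blt k 21 = true := by rwa [Nat.blt_eq]
        simp only [h2, cond_true]
        exact h.bit (by omega)
      · have h2 : Nat.blt k 21 = false := by rw [← Bool.not_eq_true, Nat.blt_eq]; omega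
        simp only [h2, cond_false]
        exact h.even
  rw [par_congr (q := fun k => c.testBit k && (Nat.blt k 15 && g.testBit k))]
  · rw [show List.range 22 = List.range 15 ++ List.range' 15 7 by rfl, par_append]
    rw [par_congr (A := List.range' 15 7) (q := fun _ => false), par_false, Bool.xor_false]
    · refine par_congr fun k hk => ?_
      have : Nat.blt k 15 = true := by rw [Nat.blt_eq]; exact List.mem_range.mp hk
      rw [this, Bool.true_and]
    · intro k hk
      rw [List.mem_range'_1] at hk
      have : Nat.blt k 15 = false := by rw [← Bool.not_eq_true, Nat.blt_eq]; omega
      rw [this, Bool.false_and, Bool.and_false]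
  · intro k hk
    rw [par_and_left, key k (List.mem_range.mp hk)]

/-- Bases of the annihilators of nine three-dimensional subspaces of `𝔽₂⁶`. -/
def bas (t i : ℕ) : ℕ :=
  [8, 16, 32, 9, 18, 36, 10, 22, 33, 11, 20, 37, 12, 17, 35, 13, 19, 39, 14, 23, 34, 15, 21, 38,
    1, 2, 4].getD (3 * t + i) 0

/-- The product of three linear forms, the indicator function of an affine subspace. -/
def tri (t a : ℕ) : Bool := lin (bas t 0) a && (lin (bas t 1) a && lin (bas t 2) a)

/-- The expression for a linear form at the point with coordinates `X`. -/
def linE (X : ℕ → BExp) (u : ℕ) : BExp :=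
  .sum (List.range 6) fun i => bif u.testBit i then X i else .ff

/-- The expression for `tri t` at the point with coordinates `X`. -/
def triE (X : ℕ → BExp) (t : ℕ) : BExp :=
  .and (linE X (bas t 0)) (.and (linE X (bas t 1)) (linE X (bas t 2)))

/-- The expression for a quadratic polynomial. -/
def quadE (X : ℕ → BExp) (c : ℕ) : BExp :=
  .sum (List.range 22) fun k => bif c.testBit k then
    (bif Nat.blt k 15 then
      .and (X ([0, 0, 0, 0, 0, 1, 1, 1, 1, 2, 2, 2, 3, 3, 4].getD k 0))
        (X ([1, 2, 3, 4, 5, 2, 3, 4, 5, 3, 4, 5, 4, 5, 5].getD k 0))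
    else bif Nat.blt k 21 then X (k - 15) else .tt) else .ff

variable {e : List Bool} {X : ℕ → BExp} {a : ℕ}

lemma evalB_linE (hX : ∀ i < 6, (X i).evalB e = a.testBit i) (u : ℕ) :
    (linE X u).evalB e = lin u a := by
  rw [linE, BExp.evalB_sum, lin]
  refine par_congr fun i hi => ?_
  rw [BExp.evalB_cond, hX i (List.mem_range.mp hi)]
  cases u.testBit i <;> rfl

lemma evalB_triE (hX : ∀ i < 6, (X i).evalB e = a.testBit i) (t : ℕ) :
    (triE X t).evalB e = tri t a := by
  simp only [triE, BExp.evalB, evalB_linE hX, tri]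

lemma evalB_quadE (hX : ∀ i < 6, (X i).evalB e = a.testBit i) (c : ℕ) :
    (quadE X c).evalB e = quad c a := by
  rw [quadE, BExp.evalB_sum, quad]
  refine par_congr fun k hk => ?_
  rw [List.mem_range] at hk
  cases c.testBit k with
  | false => rfl
  | true =>
    simp only [cond_true, Bool.true_and, qmon]
    obtain h15 | h15 := lt_or_ge k 15
    · have h1 : Nat.blt k 15 = true := by rwa [Nat.blt_eq]
      simp only [h1, cond_true, BExp.evalB]
      rw [hX, hX]
      · clear hk h1
        revert k; decide
      · clear hk h1
        revert k; decide
    · have h1 : Nat.blt k 15 = false := by rw [← Bool.not_eq_true, Nat.blt_eq]; omega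
      simp only [h1, cond_false]
      obtain h21 | h21 := lt_or_ge k 21
      · have h2 : Nat.blt k 21 = true := by rwa [Nat.blt_eq]
        simp only [h2, cond_true]
        exact hX _ (by omega)
      · have h2 : Nat.blt k 21 = false := by rw [← Bool.not_eq_true, Nat.blt_eq]; omega
        simp only [h2, cond_false, BExp.evalB]

/-- Certificate check: on a set of `2 * k` points with second moments `g`, the sum of the functions
`tri t`, for `t` in `J`, has the same sum as the quadratic polynomial `q`. The list `bs` holds the
products of linear and quadratic polynomials by which they differ. -/
def decOk (J : List ℕ) (k g q : ℕ) (bs : List ℕ) : Bool :=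
  low k g && (J.isEmpty && bs.isEmpty && Nat.beq q 0 ||
  Nat.ble k 3 && bs.all (fun b => inRad g (b % 64) && !quadSum (b / 64) g) &&
  Nat.beq 0 ((BExp.xor (.sum J (triE .var)) (.xor (quadE .var q) (.sum bs fun b =>
    .and (linE .var (b % 64)) (quadE .var (b / 64))))).evalN (2 ^ 2 ^ 6 - 1) (truthCols 6)))

lemma HasGram.sum_tri (h : HasGram g A) {J bs : List ℕ} {k q : ℕ}
    (hd : decOk J k g q bs = true) (hA : A.length ≤ 2 * k) :
    (par A fun a => par J fun t => tri t a) = quadSum q g := by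
  rw [decOk, Bool.and_eq_true, Bool.or_eq_true] at hd
  obtain ⟨hk, hd | hd⟩ := hd
  · simp only [Bool.and_eq_true, List.isEmpty_iff] at hd
    obtain ⟨⟨rfl, rfl⟩, hq⟩ := hd
    obtain rfl := Nat.eq_of_beq_eq_true hq
    simp [par_false, quadSum]
  · simp only [Bool.and_eq_true] at hd
    obtain ⟨⟨hk3, hbs⟩, h0⟩ := hd
    have hk3 := Nat.le_of_ble_eq_true hk3
    have h0 := (Nat.eq_of_beq_eq_true h0).symm
    have hpt : ∀ a : ℕ, (par J fun t => tri t a) =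
        (quad q a ^^ par bs fun b => lin (b % 64) a && quad (b / 64) a) := by
      intro a
      have hX : ∀ i < 6, (BExp.var i).evalB ((List.range 6).map a.testBit) = a.testBit i := by
        intro i hi
        simp only [BExp.evalB]
        rw [List.getD_eq_getElem _ _ (by simpa using hi)]
        simp
      have := evalB_eq_false (k := 6) h0 (e := (List.range 6).map a.testBit) (by simp)
      simp only [BExp.evalB, BExp.evalB_sum, evalB_triE hX, evalB_linE hX, evalB_quadE hX] at this
      revert this
      generalize (par J fun t => tri t a) = x
      generalize quad q a = y
      generalize (par bs fun b => lin (b % 64) a && quad (b / 64) a) = z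
      revert x y z; decide
    simp only [hpt]
    rw [par_xor, h.sum_quad, par_comm, par_congr (q := fun _ => false), par_false, Bool.xor_false]
    intro b hb
    rw [List.all_eq_true] at hbs
    have hb := hbs b hb
    rw [Bool.and_eq_true, Bool.not_eq_true'] at hb
    obtain ⟨c, hc⟩ := h.lin_const hk hk3 hA hb.1
    rw [par_congr (q := fun a => c && quad (b / 64) a) fun a ha => by rw [hc a ha],
      par_and_left, h.sum_quad, hb.2, Bool.and_false]

end Decomposition

section EightPoints

variable {g : ℕ} {A : List ℕ}

/-- The alternating form `g` vanishes on the span of the basis `bas t`. -/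
def isRoot (g t : ℕ) : Bool :=
  !evalG g (bas t 0) (bas t 1) && !evalG g (bas t 0) (bas t 2) && !evalG g (bas t 1) (bas t 2)

lemma HasGram.exists_mem (h : HasGram g A) {t : ℕ} (ht : isRoot g t = true)
    (hI : par A (tri t) = true) (p : ℕ) : ∃ a ∈ A, ∀ i < 3, lin (bas t i) a = p.testBit i := by
  have key : ∀ x y z a b c : Bool, ((!a ^^ x) && (!b ^^ y) && (!c ^^ z)) =
      ((x && (y && z)) ^^ (!c && (x && y)) ^^ (!b && (x && z)) ^^ (!a && (y && z)) ^^
        ((!b && !c) && x) ^^ ((!a && !c) && y) ^^ ((!a && !b) && z) ^^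
          (!a && !b && !c && true)) := by
    decide
  have hsum : (par A fun a =>
      (!p.testBit 0 ^^ lin (bas t 0) a) && (!p.testBit 1 ^^ lin (bas t 1) a) &&
      (!p.testBit 2 ^^ lin (bas t 2) a)) = true := by
    simp only [key]
    have hI' : (par A fun a => lin (bas t 0) a && (lin (bas t 1) a && lin (bas t 2) a)) = true := hI
    simp only [isRoot, Bool.and_eq_true, Bool.not_eq_true'] at ht
    have hl : ∀ u, (par A fun a => lin u a) = false := h.sum_lin
    simp only [par_xor, par_and_left A (!p.testBit 2), par_and_left A (!p.testBit 1),
      par_and_left A (!p.testBit 0), par_and_left A (!p.testBit 1 && !p.testBit 2),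
      par_and_left A (!p.testBit 0 && !p.testBit 2), par_and_left A (!p.testBit 0 && !p.testBit 1),
      par_and_left A (!p.testBit 0 && !p.testBit 1 && !p.testBit 2), h.lin_mul_lin, ht.1.1, ht.1.2,
      ht.2, hI', hl, h.even]
    simp
  obtain ⟨a, ha, hpa⟩ := exists_mem_of_par hsum
  simp only [Bool.and_eq_true] at hpa
  have hx : ∀ x y : Bool, (!x ^^ y) = true → y = x := by decide
  refine ⟨a, ha, fun i hi => ?_⟩
  obtain rfl | rfl | rfl : i = 0 ∨ i = 1 ∨ i = 2 := by omega
  · exact hx _ _ hpa.1.1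
  · exact hx _ _ hpa.1.2
  · exact hx _ _ hpa.2

lemma HasGram.exists_subperm (h : HasGram g A) {t : ℕ} (ht : isRoot g t = true)
    (hI : par A (tri t) = true) : ∃ a : ℕ → ℕ, ((List.range 8).map a).Subperm A ∧
      ∀ p < 8, ∀ i < 3, lin (bas t i) (a p) = p.testBit i := by
  choose a ha hb using h.exists_mem ht hI
  refine ⟨a, List.subperm_of_subset ?_ ?_, fun p _ => hb p⟩
  · refine List.Nodup.map_on ?_ List.nodup_range
    intro p hp q hq hpq
    rw [List.mem_range] at hp hq
    have h3 : ∀ i < 3, p.testBit i = q.testBit i := fun i hi => by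
      rw [← hb p i hi, ← hb q i hi, hpq]
    have hdec : ∀ p < 8, ∀ q < 8, (∀ i < 3, p.testBit i = q.testBit i) → p = q := by decide
    exact hdec p hp q hq h3
  · intro x hx
    obtain ⟨p, _, rfl⟩ := List.mem_map.mp hx
    exact ha p

lemma HasGram.eight_le (h : HasGram g A) {t : ℕ} (ht : isRoot g t = true)
    (hI : par A (tri t) = true) : 8 ≤ A.length := by
  obtain ⟨a, ha, -⟩ := h.exists_subperm ht hI
  simpa using ha.length_le

lemma HasGram.exists_perm (h : HasGram g A) {t : ℕ} (ht : isRoot g t = true)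
    (hI : par A (tri t) = true) (hA : A.length ≤ 8) : ∃ a : ℕ → ℕ, ((List.range 8).map a).Perm A ∧
      ∀ p < 8, ∀ i < 3, lin (bas t i) (a p) = p.testBit i := by
  obtain ⟨a, ha, hb⟩ := h.exists_subperm ht hI
  exact ⟨a, ha.perm_of_length_le (by simpa using hA), hb⟩

/-- The coordinates `0, 1, 2` of eight points, in terms of those of the points `0, 1, 2, 4`. -/
def lowerE (g s p j : ℕ) : BExp :=
  let M (i : ℕ) : BExp := .const (evalG g (bas s i) (2 ^ j))
  match p with
  | 0 => .var j
  | 1 => .var (3 + j)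
  | 2 => .var (6 + j)
  | 3 => .xor (M 2) (.xor (.var j) (.xor (.var (3 + j)) (.var (6 + j))))
  | 4 => .var (9 + j)
  | 5 => .xor (M 1) (.xor (.var j) (.xor (.var (3 + j)) (.var (9 + j))))
  | 6 => .xor (M 0) (.xor (.var j) (.xor (.var (6 + j)) (.var (9 + j))))
  | _ => .xor (M 0) (.xor (M 1) (.xor (M 2) (.xor (.var (3 + j)) (.xor (.var (6 + j))
    (.var (9 + j))))))

/-- All coordinates of eight points whose values under the basis `bas s` are prescribed. -/
def coordE (g s p j : ℕ) : BExp :=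
  bif Nat.blt j 3 then lowerE g s p j
  else .xor (.const (p.testBit (j - 3))) (.sum (List.range 3) fun l =>
    bif (bas s (j - 3)).testBit l then lowerE g s p l else .ff)

/-- The first three coordinates of the points `0, 1, 2, 4`. -/
def freeBits (a : ℕ → ℕ) : List Bool :=
  (List.range 12).map fun n => (a ([0, 1, 2, 4].getD (n / 3) 0)).testBit (n % 3)

lemma lin_two_pow (a : ℕ) {j : ℕ} (hj : j < 6) : lin (2 ^ j) a = a.testBit j := by
  simp only [lin, Nat.testBit_two_pow]
  interval_cases j <;> simp [List.range_succ]

lemma evalB_lowerE {a : ℕ → ℕ} (h : HasGram g ((List.range 8).map a)) {s : ℕ}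
    (hb : ∀ p < 8, ∀ i < 3, lin (bas s i) (a p) = p.testBit i) {p j : ℕ} (hp : p < 8) (hj : j < 3) :
    (lowerE g s p j).evalB (freeBits a) = (a p).testBit j := by
  have hv : ∀ n < 12, (freeBits a).getD n false =
      (a ([0, 1, 2, 4].getD (n / 3) 0)).testBit (n % 3) := fun n hn => by
    rw [freeBits, List.getD_eq_getElem _ _ (by simpa using hn)]
    simp
  have v0 : (freeBits a).getD j false = (a 0).testBit j := by
    rw [hv _ (by omega)]; interval_cases j <;> rfl
  have v1 : (freeBits a).getD (3 + j) false = (a 1).testBit j := by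
    rw [hv _ (by omega)]; interval_cases j <;> rfl
  have v2 : (freeBits a).getD (6 + j) false = (a 2).testBit j := by
    rw [hv _ (by omega)]; interval_cases j <;> rfl
  have v4 : (freeBits a).getD (9 + j) false = (a 4).testBit j := by
    rw [hv _ (by omega)]; interval_cases j <;> rfl
  have hM : ∀ i < 3, evalG g (bas s i) (2 ^ j) =
      par (List.range 8) fun p => p.testBit i && (a p).testBit j := fun i hi => by
    rw [← h.lin_mul_lin, par_map]
    refine par_congr fun p hp => ?_
    rw [hb p (List.mem_range.mp hp) i hi, lin_two_pow _ (by omega)]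
  have M0 := hM 0 (by decide)
  have M1 := hM 1 (by decide)
  have M2 := hM 2 (by decide)
  have he := h.bit (i := j) (by omega)
  rw [par_map] at he
  rw [show List.range 8 = [0, 1, 2, 3, 4, 5, 6, 7] by rfl] at M0 M1 M2 he
  simp only [par_cons, par_nil] at M0 M1 M2 he
  have t (p i : ℕ) (b : Bool) (hb : p.testBit i = b := by rfl) : p.testBit i = b := hb
  rw [t 0 0 false, t 1 0 true, t 2 0 false, t 3 0 true, t 4 0 false, t 5 0 true, t 6 0 false,
    t 7 0 true] at M0
  rw [t 0 1 false, t 1 1 false, t 2 1 true, t 3 1 true, t 4 1 false, t 5 1 false, t 6 1 true,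
    t 7 1 true] at M1
  rw [t 0 2 false, t 1 2 false, t 2 2 false, t 3 2 false, t 4 2 true, t 5 2 true, t 6 2 true,
    t 7 2 true] at M2
  have key : ∀ y0 y1 y2 y3 y4 y5 y6 y7 m0 m1 m2 : Bool,
      (y0 ^^ (y1 ^^ (y2 ^^ (y3 ^^ (y4 ^^ (y5 ^^ (y6 ^^ (y7 ^^ false)))))))) = false →
      m0 = (false && y0 ^^ (true && y1 ^^ (false && y2 ^^ (true && y3 ^^ (false && y4 ^^
        (true && y5 ^^ (false && y6 ^^ (true && y7 ^^ false)))))))) →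
      m1 = (false && y0 ^^ (false && y1 ^^ (true && y2 ^^ (true && y3 ^^ (false && y4 ^^
        (false && y5 ^^ (true && y6 ^^ (true && y7 ^^ false)))))))) →
      m2 = (false && y0 ^^ (false && y1 ^^ (false && y2 ^^ (false && y3 ^^ (true && y4 ^^
        (true && y5 ^^ (true && y6 ^^ (true && y7 ^^ false)))))))) →
      (m2 ^^ (y0 ^^ (y1 ^^ y2))) = y3 ∧ (m1 ^^ (y0 ^^ (y1 ^^ y4))) = y5 ∧
      (m0 ^^ (y0 ^^ (y2 ^^ y4))) = y6 ∧ (m0 ^^ (m1 ^^ (m2 ^^ (y1 ^^ (y2 ^^ y4))))) = y7 := by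
    intro y0 y1 y2 y3 y4 y5 y6 y7 m0 m1 m2 h h0 h1 h2
    subst h0 h1 h2
    revert h
    revert y0 y1 y2 y3 y4 y5 y6 y7
    decide +kernel
  obtain ⟨k3, k5, k6, k7⟩ := key _ _ _ _ _ _ _ _ _ _ _ he M0 M1 M2
  interval_cases p <;>
    simp only [lowerE, BExp.evalB, BExp.evalB_const, v0, v1, v2, v4, k3, k5, k6, k7]

lemma testBit_bas : ∀ s < 8, ∀ i < 3, ∀ j < 3, (bas s i).testBit (3 + j) = (i == j) := by decide

lemma evalB_coordE {a : ℕ → ℕ} (h : HasGram g ((List.range 8).map a)) {s : ℕ} (hs : s < 8)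
    (hb : ∀ p < 8, ∀ i < 3, lin (bas s i) (a p) = p.testBit i) {p j : ℕ} (hp : p < 8) (hj : j < 6) :
    (coordE g s p j).evalB (freeBits a) = (a p).testBit j := by
  obtain h3 | h3 := lt_or_ge j 3
  · have h1 : Nat.blt j 3 = true := by rwa [Nat.blt_eq]
    rw [coordE, h1, cond_true, evalB_lowerE h hb hp h3]
  · have h1 : Nat.blt j 3 = false := by rw [← Bool.not_eq_true, Nat.blt_eq]; omega
    obtain ⟨i, rfl⟩ := Nat.exists_eq_add_of_le h3
    have hi : i < 3 := by omega
    have h2 := hb p hp i hi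
    have h4 := testBit_bas s hs i hi
    rw [lin, show List.range 6 = List.range 3 ++ [3 + 0, 3 + 1, 3 + 2] by rfl, par_append] at h2
    simp only [par_cons, par_nil] at h2
    rw [h4 0 (by decide), h4 1 (by decide), h4 2 (by decide)] at h2
    rw [coordE, h1, cond_false, Nat.add_sub_cancel_left, BExp.evalB, BExp.evalB_const,
      BExp.evalB_sum, par_congr (q := fun l => (bas s i).testBit l && (a p).testBit l)]
    · rw [← h2]
      generalize (par (List.range 3) fun l => (bas s i).testBit l && (a p).testBit l) = x
      have hx : ∀ x y : Bool, (x ^^ (y ^^ x)) = y := by decide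
      interval_cases i <;> simp [hx]
    · intro l hl
      rw [BExp.evalB_cond, evalB_lowerE h hb hp (List.mem_range.mp hl)]
      cases (bas s i).testBit l <;> rfl

/-- The sum of `tri t` over eight points. -/
def sumTriE (g s t : ℕ) : BExp := .sum (List.range 8) fun p => triE (coordE g s p) t

/-- The second moments of eight points in the first three coordinates are those of `g`. -/
def gramE (g s : ℕ) : BExp :=
  .all (List.range 3) fun j => .all (List.range j) fun i => .xor (.const (!gb g i j))
    (.sum (List.range 8) fun p => .and (coordE g s p i) (coordE g s p j))

/-- Certificate check: no set of eight points with second moments `g` on which `tri s` has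
sum `1` satisfies the condition `P`. -/
def refutes (g s : ℕ) (P : BExp) : Bool :=
  Nat.beq 0 ((BExp.and (gramE g s) P).evalN (2 ^ 2 ^ 12 - 1) (truthCols 12))

lemma HasGram.exists_bits (h : HasGram g A) {s : ℕ} (hs : s < 8) (hr : isRoot g s = true)
    (hI : par A (tri s) = true) (hA : A.length ≤ 8) :
    ∃ e : List Bool, (∀ t, (sumTriE g s t).evalB e = par A (tri t)) ∧
      ∀ P, refutes g s P = true → P.evalB e = false := by
  obtain ⟨a, hp, hb⟩ := h.exists_perm hr hI hA
  have h' : HasGram g ((List.range 8).map a) :=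
    ⟨by rw [par_perm hp, h.even], fun i hi j hj => by rw [par_perm hp, h.gram i hi j hj]⟩
  refine ⟨freeBits a, fun t => ?_, fun P hP => ?_⟩
  · rw [sumTriE, BExp.evalB_sum, ← par_perm hp, par_map]
    exact par_congr fun p hp =>
      evalB_triE (fun i hi => evalB_coordE h' hs hb (List.mem_range.mp hp) hi) t
  · have h0 := evalB_eq_false (Nat.eq_of_beq_eq_true hP).symm (e := freeBits a)
      (by simp [freeBits])
    rw [BExp.evalB] at h0
    have hg : (gramE g s).evalB (freeBits a) = true := by
      simp only [gramE, BExp.evalB_all, List.all_eq_true, List.mem_range, BExp.evalB,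
        BExp.evalB_const, BExp.evalB_sum]
      intro j hj i hi
      rw [par_congr (q := fun p => (a p).testBit i && (a p).testBit j)]
      · have := h'.gram i (by omega) j (by omega)
        rw [par_map] at this
        rw [this]
        cases gb g i j <;> rfl
      · intro p hp
        rw [List.mem_range] at hp
        rw [evalB_coordE h' hs hb hp (by omega), evalB_coordE h' hs hb hp (by omega)]
    rwa [hg, Bool.true_and] at h0

end EightPoints

section FourParts

/-- The alternating forms `g ^^^ tz z`, for `z < 4`, are the second moments of the four parts of a
set of points of `𝔽₂⁸`, where `g` is that of the part with index zero. -/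
def tz (z : ℕ) : ℕ := [0, 656, 3332, 3988].getD z 0

lemma tz_xor : ∀ z < 4, ∀ w < 4, tz w ^^^ tz z = tz (z ^^^ w) := by decide

lemma gb_xor (g h i j : ℕ) : gb (g ^^^ h) i j = (gb g i j ^^ gb h i j) := by
  unfold gb
  cases i == j <;> simp

lemma evalG_xor (g h u v : ℕ) : evalG (g ^^^ h) u v = (evalG g u v ^^ evalG h u v) := by
  unfold evalG
  simp only [gb_xor, Bool.and_xor_distrib_left, par_xor]

lemma evalG_tz : ∀ z < 4, ∀ t < 9, evalG (tz z) (bas t 0) (bas t 1) = false ∧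
    evalG (tz z) (bas t 0) (bas t 2) = false ∧ evalG (tz z) (bas t 1) (bas t 2) = false := by
  decide +kernel

lemma isRoot_xor_tz (g : ℕ) {z t : ℕ} (hz : z < 4) (ht : t < 9) :
    isRoot (g ^^^ tz z) t = isRoot g t := by
  obtain ⟨h0, h1, h2⟩ := evalG_tz z hz t ht
  simp only [isRoot, evalG_xor, h0, h1, h2, Bool.xor_false]

/-- Half of a lower bound for the size of a set with second moments `g`. -/
def lev (g : ℕ) : ℕ := bif low 4 g then 4 else bif low 3 g then 3 else bif low 2 g then 2 else 0

lemma low_lev (g : ℕ) : low (lev g) g = true := by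
  unfold lev
  cases h4 : low 4 g
  · cases h3 : low 3 g
    · cases h2 : low 2 g
      · rfl
      · exact h2
    · exact h3
  · exact h4

lemma lev_mem (g : ℕ) : lev g ∈ [0, 2, 3, 4] := by
  unfold lev
  cases low 4 g <;> cases low 3 g <;> cases low 2 g <;> decide

lemma lev_le (g : ℕ) : lev g ≤ 4 := by
  have h : ∀ k ∈ [0, 2, 3, 4], k ≤ 4 := by decide
  exact h _ (lev_mem g)

/-- Four lists of points with the given second moments, of total size at most `24`, with prescribed
sums of the functions `tri t`. -/
structure Quad (g : ℕ) (A : ℕ → List ℕ) : Prop where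
  gram : ∀ z < 4, HasGram (g ^^^ tz z) (A z)
  len : (A 0).length + (A 1).length + (A 2).length + (A 3).length ≤ 24
  sum_tri : ∀ t < 9, (par (List.range 4) fun z => par (A z) (tri t)) = !(t == 8)

variable {g : ℕ} {A : ℕ → List ℕ}

lemma par_range_four_xor (p : ℕ → Bool) : ∀ w < 4,
    (par (List.range 4) fun z => p (z ^^^ w)) = par (List.range 4) p := by
  have key : ∀ x y z w : Bool,
      (y ^^ (x ^^ (w ^^ (z ^^ false)))) = (x ^^ (y ^^ (z ^^ (w ^^ false)))) ∧
      (z ^^ (w ^^ (x ^^ (y ^^ false)))) = (x ^^ (y ^^ (z ^^ (w ^^ false)))) ∧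
      (w ^^ (z ^^ (y ^^ (x ^^ false)))) = (x ^^ (y ^^ (z ^^ (w ^^ false)))) := by decide
  obtain ⟨h1, h2, h3⟩ := key (p 0) (p 1) (p 2) (p 3)
  intro w hw
  interval_cases w
  · rfl
  · exact h1
  · exact h2
  · exact h3

lemma Quad.permute (h : Quad g A) {w : ℕ} (hw : w < 4) :
    Quad (g ^^^ tz w) fun z => A (z ^^^ w) where
  gram z hz := by
    rw [Nat.xor_assoc, tz_xor z hz w hw]
    exact h.gram _ (Nat.xor_lt_two_pow (n := 2) hz hw)
  len := by
    have := h.len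
    interval_cases w <;> simp <;> omega
  sum_tri t ht := by
    rw [← h.sum_tri t ht]
    exact par_range_four_xor (fun z => par (A z) (tri t)) w hw

/-- Half of a lower bound for the size of the part `w`, if the part `z` has at least eight
points. -/
def levUp (g z w : ℕ) : ℕ := bif w == z then max 4 (lev (g ^^^ tz w)) else lev (g ^^^ tz w)

/-- The sum of `f w` for `w < 4`. -/
def sumFour (f : ℕ → ℕ) : ℕ := f 0 + f 1 + f 2 + f 3

lemma Quad.le_length (h : Quad g A) {w : ℕ} (hw : w < 4) :
    2 * lev (g ^^^ tz w) ≤ (A w).length := (h.gram w hw).le_length (low_lev _)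

lemma Quad.levUp_le (h : Quad g A) {z : ℕ} (hz : 8 ≤ (A z).length) {w : ℕ} (hw : w < 4) :
    2 * levUp g z w ≤ (A w).length := by
  have := h.le_length hw
  unfold levUp
  by_cases hwz : w = z
  · subst hwz
    simp only [BEq.rfl, cond_true]
    omega
  · have h1 : (w == z) = false := by simpa using hwz
    rwa [h1, cond_false]

lemma length_eq_of_sumFour {f : ℕ → ℕ} (hf : ∀ w < 4, 2 * f w ≤ (A w).length)
    (hA : (A 0).length + (A 1).length + (A 2).length + (A 3).length ≤ 24) (h : 12 ≤ sumFour f) :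
    sumFour f = 12 ∧ ∀ w < 4, (A w).length = 2 * f w := by
  have h0 := hf 0 (by decide)
  have h1 := hf 1 (by decide)
  have h2 := hf 2 (by decide)
  have h3 := hf 3 (by decide)
  unfold sumFour at *
  refine ⟨by omega, fun w hw => ?_⟩
  interval_cases w <;> omega

/-- A certificate: an alternating form, the code of a set of indices, and four pairs of
polynomial data as in `decOk`. -/
abbrev Cert : Type := ℕ × ℕ × List (ℕ × List ℕ)

/-- The elements of a set of indices less than `9`. -/
def idxs (J : ℕ) : List ℕ := (List.range 9).filter fun t => J.testBit t

/-- The validity of the polynomial data in the certificate for the part `w`. -/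
def partOk (c : Cert) (w : ℕ) : Bool :=
  decOk (idxs c.2.1) (lev (c.1 ^^^ tz w)) (c.1 ^^^ tz w) (c.2.2.getD w (0, [])).1
    (c.2.2.getD w (0, [])).2

/-- The sum over the part `w` given by the certificate. -/
def partSum (c : Cert) (w : ℕ) : Bool := quadSum (c.2.2.getD w (0, [])).1 (c.1 ^^^ tz w)

/-- The conditions satisfied by the points in the part `z`. -/
def condE (c : Cert) (s z : ℕ) : BExp :=
  .and (.all (List.range 9) fun t => bif isRoot c.1 t then
      .xor (sumTriE (c.1 ^^^ tz z) s t) (.const (t == 8)) else .tt)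
    (.xor (.sum (idxs c.2.1) (sumTriE (c.1 ^^^ tz z) s)) (.const
      (!((par (idxs c.2.1) fun t => !(t == 8)) ^^
        par (List.range 4) fun w => !(w == z) && partSum c w))))

/-- The check of the case in which `tri s` has sum `1` on the part `z`. -/
def caseOk (c : Cert) (s z : ℕ) : Bool :=
  Nat.ble 13 (sumFour (levUp c.1 z)) ||
  (Nat.ble 12 (sumFour (levUp c.1 z)) &&
    (List.range 4).all (fun w => w == z || (Nat.ble (lev (c.1 ^^^ tz w)) 3 && partOk c w)) &&
    refutes (c.1 ^^^ tz z) s (condE c s z))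

/-- The check of a certificate for a form with a root. -/
def rootCertOk (c : Cert) : Bool :=
  (List.range 8).any fun s => isRoot c.1 s && (List.range 4).all fun z => caseOk c s z

/-- The check of a certificate for a form of minimal level. -/
def sumCertOk (c : Cert) : Bool :=
  Nat.ble 12 (sumFour fun w => lev (c.1 ^^^ tz w)) && (List.range 4).all (partOk c) &&
  ((par (idxs c.2.1) fun t => !(t == 8)) ^^ par (List.range 4) (partSum c))

lemma idxs_lt {J t : ℕ} (ht : t ∈ idxs J) : t < 9 :=
  List.mem_range.mp (List.mem_filter.mp ht).1

lemma Quad.sum_idxs (h : Quad g A) (J : ℕ) :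
    (par (List.range 4) fun w => par (idxs J) fun t => par (A w) (tri t)) =
      par (idxs J) fun t => !(t == 8) := by
  rw [par_comm]
  exact par_congr fun t ht => h.sum_tri t (idxs_lt ht)

lemma Quad.partSum_eq {c : Cert} (h : Quad c.1 A) {w : ℕ} (hw : w < 4) (hp : partOk c w = true)
    (hl : (A w).length = 2 * lev (c.1 ^^^ tz w)) :
    (par (idxs c.2.1) fun t => par (A w) (tri t)) = partSum c w := by
  rw [← par_comm]
  exact (h.gram w hw).sum_tri hp hl.le

lemma not_quad_of_sumCertOk {c : Cert} (hc : sumCertOk c = true) : ¬Quad c.1 A := by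
  intro h
  simp only [sumCertOk, Bool.and_eq_true, List.all_eq_true] at hc
  obtain ⟨⟨h12, hp⟩, hs⟩ := hc
  obtain ⟨-, hl⟩ := length_eq_of_sumFour (fun w hw => h.le_length hw) h.len
    (Nat.le_of_ble_eq_true h12)
  have h1 := h.sum_idxs c.2.1
  rw [par_congr (q := partSum c) fun w hw => h.partSum_eq (List.mem_range.mp hw) (hp w hw)
    (hl w (List.mem_range.mp hw))] at h1
  rw [h1, Bool.xor_self] at hs
  exact absurd hs (by decide)

lemma par_range_four_eq {p q : ℕ → Bool} {z : ℕ} (hz : z < 4)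
    (h : ∀ w < 4, w ≠ z → p w = q w) :
    par (List.range 4) p = (p z ^^ par (List.range 4) fun w => !(w == z) && q w) := by
  have h1 : ∀ w < 4, p w = ((w == z && p w) ^^ (!(w == z) && q w)) := fun w hw => by
    by_cases hwz : w = z
    · subst hwz; simp
    · rw [h w hw hwz]
      have : (w == z) = false := by simpa using hwz
      simp [this]
  rw [par_congr (q := fun w => (w == z && p w) ^^ (!(w == z) && q w))
    fun w hw => h1 w (List.mem_range.mp hw), par_xor]
  congr 1
  interval_cases z <;> simp [List.range_succ]

lemma not_quad_of_rootCertOk {c : Cert} (hc : rootCertOk c = true) : ¬Quad c.1 A := by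
  intro h
  simp only [rootCertOk, List.any_eq_true, Bool.and_eq_true, List.mem_range, List.all_eq_true] at hc
  obtain ⟨s, hs, hr, hc⟩ := hc
  have hroot : ∀ t < 9, ∀ w < 4, isRoot c.1 t = true → isRoot (c.1 ^^^ tz w) t = true :=
    fun t ht w hw hrt => by rwa [isRoot_xor_tz _ hw ht]
  obtain ⟨z, hz, hI⟩ := exists_mem_of_par ((h.sum_tri s (by omega)).trans (by simp; omega))
  rw [List.mem_range] at hz
  have hz8 := (h.gram z hz).eight_le (hroot s (by omega) z hz hr) hI
  have hc := hc z hz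
  simp only [caseOk, Bool.or_eq_true, Bool.and_eq_true, List.all_eq_true, List.mem_range,
    beq_iff_eq] at hc
  obtain hc | ⟨⟨h12, hp⟩, hP⟩ := hc
  · have hc := Nat.le_of_ble_eq_true hc
    have := (length_eq_of_sumFour (f := levUp c.1 z)
      (fun w hw => h.levUp_le hz8 hw) h.len (by omega)).1
    omega
  · obtain ⟨-, hl⟩ := length_eq_of_sumFour (f := levUp c.1 z) (fun w hw => h.levUp_le hz8 hw)
      h.len
      (Nat.le_of_ble_eq_true h12)
    have hlz : (A z).length ≤ 8 := by
      rw [hl z hz, levUp]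
      simp only [BEq.rfl, cond_true]
      have := lev_le (c.1 ^^^ tz z)
      omega
    have hlw : ∀ w < 4, w ≠ z → (A w).length = 2 * lev (c.1 ^^^ tz w) := fun w hw hwz => by
      have h1 : (w == z) = false := by simpa using hwz
      rw [hl w hw, levUp, h1, cond_false]
    have hpw : ∀ w < 4, w ≠ z → lev (c.1 ^^^ tz w) ≤ 3 ∧ partOk c w = true := fun w hw hwz => by
      have := (hp w hw).resolve_left hwz
      exact ⟨Nat.le_of_ble_eq_true this.1, this.2⟩
    obtain ⟨e, he, hR⟩ := (h.gram z hz).exists_bits hs (hroot s (by omega) z hz hr) hI hlz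
    have h0 := hR _ hP
    have hz1 : ∀ t < 9, isRoot c.1 t = true → par (A z) (tri t) = !(t == 8) := by
      intro t ht hrt
      rw [← h.sum_tri t ht, par_range_four_eq hz (q := fun _ => false)]
      · simp [par_false]
      · intro w hw hwz
        by_contra hne
        have := (h.gram w hw).eight_le (hroot t ht w hw hrt) (by simpa using hne)
        have := hlw w hw hwz
        have := (hpw w hw hwz).1
        omega
    have hJ : (par (idxs c.2.1) fun t => par (A z) (tri t)) =
        ((par (idxs c.2.1) fun t => !(t == 8)) ^^
          par (List.range 4) fun w => !(w == z) && partSum c w) := by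
      rw [← h.sum_idxs, par_range_four_eq hz (q := partSum c) fun w hw hwz =>
        h.partSum_eq hw (hpw w hw hwz).2 (hlw w hw hwz)]
      rw [Bool.xor_assoc, Bool.xor_self, Bool.xor_false]
    rw [condE, BExp.evalB, Bool.and_eq_false_iff] at h0
    obtain h0 | h0 := h0
    · rw [BExp.evalB_all, ← Bool.not_eq_true, List.all_eq_true] at h0
      apply h0
      intro t ht
      rw [List.mem_range] at ht
      rw [BExp.evalB_cond]
      cases hrt : isRoot c.1 t
      · rfl
      · rw [cond_true, BExp.evalB, he, hz1 t ht hrt, BExp.evalB_const]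
        cases t == 8 <;> rfl
    · rw [BExp.evalB, BExp.evalB_sum, BExp.evalB_const] at h0
      simp only [he] at h0
      rw [hJ] at h0
      revert h0
      generalize ((par (idxs c.2.1) fun t => !(t == 8)) ^^
          par (List.range 4) fun w => !(w == z) && partSum c w) = x
      revert x; decide

lemma Quad.isRoot_eq_false (h : Quad g A) (h3 : ∀ w < 4, lev (g ^^^ tz w) ≤ 3)
    (h12 : 12 ≤ sumFour fun w => lev (g ^^^ tz w)) {s : ℕ} (hs : s < 8) : isRoot g s = false := by
  rw [← Bool.not_eq_true]
  intro hr
  obtain ⟨z, hz, hI⟩ := exists_mem_of_par ((h.sum_tri s (by omega)).trans (by simp; omega))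
  rw [List.mem_range] at hz
  have hz8 := (h.gram z hz).eight_le (by rwa [isRoot_xor_tz _ hz (by omega)]) hI
  have hl := (length_eq_of_sumFour (fun w hw => h.le_length hw) h.len h12).2 z hz
  have := h3 z hz
  omega

/-- There are two indices different from `s` whose functions `tri` have sum `1`. -/
def pairE (g s : ℕ) : BExp :=
  .any (List.range 8) fun t => .any (List.range t) fun u =>
    bif t == s || u == s then .ff else .and (sumTriE g s t) (sumTriE g s u)

lemma refutes_pairE : ∀ z < 4, z ≠ 0 → ∀ s < 8, refutes (tz z) s (pairE (tz z) s) = true := by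
  decide +kernel

lemma card_filter_le_two {z : ℕ} (hz : z < 4) (hz0 : z ≠ 0) {B : List ℕ} (h : HasGram (tz z) B)
    (hB : B.length ≤ 8) (hr : ∀ t < 9, isRoot (tz z) t = true) :
    ((Finset.range 8).filter fun t => par B (tri t) = true).card ≤ 2 := by
  by_contra hcard
  obtain ⟨s, hs, t, ht, u, hu, hst, hsu, htu⟩ := Finset.two_lt_card.mp (not_le.mp hcard)
  simp only [Finset.mem_filter, Finset.mem_range] at hs ht hu
  obtain ⟨e, he, hR⟩ := h.exists_bits hs.1 (hr s (by omega)) hs.2 hB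
  have h0 := hR _ (refutes_pairE z hz hz0 s hs.1)
  have key : ∀ t < 8, ∀ u < t, t ≠ s → u ≠ s → par B (tri t) = true → par B (tri u) = true →
      False := by
    intro t ht u hu hts hus h1 h2
    rw [← Bool.not_eq_true] at h0
    apply h0
    simp only [pairE, BExp.evalB_any, List.any_eq_true, List.mem_range]
    refine ⟨t, ht, u, hu, ?_⟩
    have e1 : (t == s) = false := by simpa using hts
    have e2 : (u == s) = false := by simpa using hus
    rw [e1, e2, Bool.or_self, cond_false, BExp.evalB, he, he, h1, h2]
    rfl
  obtain hlt | hlt := htu.lt_or_gt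
  · exact key u hu.1 t hlt hsu.symm hst.symm hu.2 ht.2
  · exact key t ht.1 u hlt hst.symm hsu.symm ht.2 hu.2

lemma not_quad_zero : ¬Quad 0 A := by
  intro h
  have hlev : 12 ≤ sumFour fun w => lev (0 ^^^ tz w) := by decide +kernel
  have hl := (length_eq_of_sumFour (fun w hw => h.le_length hw) h.len hlev).2
  have h8 : ∀ w < 4, lev (0 ^^^ tz w) ≤ 4 := fun w _ => lev_le _
  have hl0 : A 0 = [] := by
    have h0 : lev (0 ^^^ tz 0) = 0 := by decide +kernel
    rw [← List.length_eq_zero_iff, hl 0 (by decide), h0]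
  have hr : ∀ w < 4, ∀ t < 9, isRoot (tz w) t = true := by decide +kernel
  have hc : ∀ w < 4, w ≠ 0 →
      ((Finset.range 8).filter fun t => par (A w) (tri t) = true).card ≤ 2 := fun w hw hw0 => by
    have hg := h.gram w hw
    rw [Nat.zero_xor] at hg
    refine card_filter_le_two hw hw0 hg ?_ (hr w hw)
    have := hl w hw
    have := h8 w hw
    omega
  have h1 := hc 1 (by decide) (by decide)
  have h2 := hc 2 (by decide) (by decide)
  have h3 := hc 3 (by decide) (by decide)
  have hsub : Finset.range 8 ⊆ ((Finset.range 8).filter fun t => par (A 1) (tri t) = true) ∪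
      (((Finset.range 8).filter fun t => par (A 2) (tri t) = true) ∪
      ((Finset.range 8).filter fun t => par (A 3) (tri t) = true)) := by
    intro t ht
    rw [Finset.mem_range] at ht
    obtain ⟨z, hz, hI⟩ := exists_mem_of_par ((h.sum_tri t (by omega)).trans (by simp; omega))
    rw [List.mem_range] at hz
    simp only [Finset.mem_union, Finset.mem_filter, Finset.mem_range, ht, true_and]
    interval_cases z
    · simp [hl0] at hI
    · exact Or.inl hI
    · exact Or.inr (Or.inl hI)
    · exact Or.inr (Or.inr hI)
  have := Finset.card_le_card hsub
  have := Finset.card_union_le ((Finset.range 8).filter fun t => par (A 1) (tri t) = true)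
    (((Finset.range 8).filter fun t => par (A 2) (tri t) = true) ∪
      ((Finset.range 8).filter fun t => par (A 3) (tri t) = true))
  have := Finset.card_union_le ((Finset.range 8).filter fun t => par (A 2) (tri t) = true)
    ((Finset.range 8).filter fun t => par (A 3) (tri t) = true)
  rw [Finset.card_range] at *
  omega

end FourParts

section Certificates

/-- Forms for which the conditions at the roots are contradictory. -/
def plainForms : List ℕ := [
  13, 14, 15, 17, 18, 19, 21, 22, 23, 29, 30, 31, 69, 75, 87, 102, 103, 105, 106, 116, 119, 129,
  135, 137, 146, 150, 159, 160, 161, 164, 167, 170, 171, 176, 178, 181, 183, 189, 190, 193, 215,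
  224, 225, 245, 246, 257, 273, 286, 288, 289, 306, 307, 317, 319, 341, 374, 375, 385, 406, 416,
  417, 436, 438, 1026, 1047, 1056, 1058, 1077, 1078, 1155, 1170, 1182, 1184, 1187, 1200, 1202,
  1213, 1215, 1239, 1268, 1271, 1410, 1441, 1443, 4144, 4219, 4237, 4254, 4293, 4297, 4315, 4319,
  5181, 5207, 5225, 5255, 5263, 5274, 5351, 5353, 5358, 5360, 5366, 5371, 8277, 8391, 8529, 8610,
  8624, 8688, 8693, 9235, 9316, 9333, 9395, 9396, 9415, 9474, 9490, 9587, 9589, 9618, 9714, 9716,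
  12334, 12367, 12377, 12381, 12419, 12430, 12516, 12591, 12644, 12651, 12654, 12661, 12667, 12669,
  12677, 12686, 12690, 12701, 12741, 12788, 16445, 16527, 16529, 16654, 16662, 16665, 16814, 17423,
  17426, 17434, 17439, 17583, 17694, 17714, 17824, 17828, 17833, 17838, 17843, 17855, 20713, 20724,
  20771, 20777, 20809, 20894, 20937, 20949, 21534, 21601, 21610, 21663, 21727, 21793, 21822, 21878,
  21887, 21918, 21984, 21993, 24647, 24763, 24861, 24935, 24937, 24954, 25037, 25679, 25730, 25828,
  25835, 25850, 25882, 25955, 26031, 26032, 26045, 26084, 26090, 26101, 28779, 28786, 28889, 28946,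
  29017, 29069, 29156, 29162, 29729, 29742, 29767, 29771, 29915, 29994, 30000, 30063, 30068, 30106,
  30182, 30205]

/-- Certificates for forms with a root. -/
def rootCerts : List Cert := [
  (12, 42, [(42615, [1310850, 1835012, 525336]), (0, []), (34423, [1835079, 1065480]), (37493,
  [1310851, 360752])]), (16, 50, [(33881, [131970, 260, 1048584]), (33881, [47105, 264224]), (0,
  []), (38237, [16711, 262256])]), (20, 82, [(68071, [1048706, 786436, 525584]), (68070, [786501,
  271136]), (68069, [1048707, 1245704]), (72039, [1312769, 303152])]), (28, 28, [(9003, [786562,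
  1310724, 525592]), (815, [262215, 332576]), (814, [1310789, 1074184]), (0, [])]), (68, 28, [(813,
  [786563, 1310724, 525328]), (0, []), (1903, [1837057, 331832]), (9002, [1310790, 541976])]), (72,
  100, [(101567, [262212, 266784]), (0, []), (102063, [524359, 295992]), (109753, [524419, 262149,
  525592])]), (84, 82, [(68071, [786500, 541968]), (68070, [786501, 271136]), (0, []), (76199,
  [1312769, 786438, 544792])]), (128, 100, [(101567, [1050625, 262148, 1064968]), (101567, [524418,
  558096]), (105654, [262214, 266800]), (0, [])]), (132, 100, [(101567, [262212, 266784]), (101567,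
  [524418, 558096]), (101567, [1050625, 262150, 1073160]), (110269, [524419, 558104])]), (136, 104,
  [(102288, [65923, 1028, 1048584]), (106390, [65922, 262320]), (102167, [9798, 262264]), (110479,
  [9797, 524376])]), (144, 104, [(102294, [9796, 1048648]), (102294, [202753, 65538, 524304]),
  (102167, [9798, 262264]), (0, [])]), (148, 14, [(4905, [13380, 262248]), (825, [99714, 1029,
  524304]), (1000, [13382, 1048648]), (9001, [153601, 526360])]), (156, 14, [(4905, [13380,
  262248]), (809, [99714, 262304]), (803, [99715, 1797, 1048584]), (0, [])]), (192, 50, [(42073,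
  [47105, 16388, 524312]), (34136, [16710, 524368]), (38237, [16711, 262256]), (37975, [131971,
  262312])]), (212, 42, [(34619, [1835076, 283448]), (34421, [1310851, 1835013, 525328]), (0, []),
  (38007, [1574913, 368680])]), (256, 104, [(102294, [202753, 8196, 1048584]), (0, []), (106390,
  [65922, 262320]), (106254, [9799, 262248])]), (272, 82, [(68069, [1048707, 786436, 1049096]),
  (72039, [1312769, 303152]), (68591, [1048706, 295480]), (0, [])]), (284, 50, [(42073, [16708,
  524376]), (0, []), (33885, [131970, 261, 1048584]), (37975, [131971, 262312])]), (340, 14, [(831,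
  [99715, 1796, 524304]), (4920, [13381, 262256]), (0, []), (9001, [153601, 526360])]), (384, 28,
  [(815, [1837057, 1310724, 1073160]), (813, [786563, 689168]), (0, []), (4907, [786562,
  328488])]), (404, 42, [(34555, [1835076, 271160]), (34422, [1835077, 545040]), (34423, [1835079,
  1065480]), (42103, [1574913, 1310722, 688152])]), (1024, 50, [(33881, [47105, 131074, 1048584]),
  (0, []), (34136, [16710, 524368]), (33884, [16709, 262264])]), (1044, 28, [(4907, [786562,
  328488]), (815, [1310791, 274720]), (813, [786563, 1310725, 1049096]), (1903, [1837057,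
  331832])]), (1152, 42, [(34423, [1574913, 1835014, 1064968]), (42103, [1310850, 689176]), (0,
  []), (34422, [1835077, 545040])]), (1168, 14, [(1000, [13382, 1048648]), (9001, [153601, 98306,
  524312]), (0, []), (1017, [13383, 524368])]), (1180, 82, [(72102, [786502, 274984]), (76263,
  [1048706, 786437, 525336]), (68069, [1048707, 1245704]), (0, [])]), (1236, 104, [(0, []),
  (102288, [65923, 262304]), (110479, [9797, 524376]), (102166, [202753, 8198, 524304])]), (1408,
  100, [(101567, [1050625, 1130504]), (110269, [524419, 558104]), (0, []), (101567, [524418,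
  262149, 525584])]), (4108, 21, [(8455, [2032130, 1574660, 524313]), (0, []), (154, [1599239,
  1056841]), (8459, [2032131, 1573173])]), (4164, 44, [(34664, [427907, 1050116, 524305]), (0, []),
  (34678, [915457, 1058878]), (50727, [1069894, 1053979])]), (4224, 98, [(101566, [391169, 544772,
  1064970]), (101820, [1738626, 524692]), (109690, [545606, 532849]), (0, [])]), (4232, 73,
  [(68565, [952067, 1312260, 1048585]), (76225, [952066, 623412]), (68168, [1331974, 537977]),
  (76741, [1331973, 528475])]), (4240, 41, [(34807, [1577476, 1074186]), (36471, [606209, 1867778,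
  655380]), (34359, [1577478, 528507]), (0, [])]), (4244, 7, [(16640, [807684, 1049194]), (285,
  [1214210, 787205, 525329]), (8409, [807686, 1582603]), (8193, [1437697, 573470])]), (4288, 49,
  [(42073, [1175553, 282628, 524314]), (34137, [283398, 529426]), (42837, [574215, 557617]),
  (49221, [689923, 1114541])]), (4308, 69, [(67813, [1078532, 528762]), (67808, [493059, 1049093,
  525329]), (0, []), (84064, [974849, 1058862])]), (5120, 35, [(33887, [1024001, 458754, 1048588]),
  (0, []), (34267, [1074950, 545041]), (33859, [1074949, 529019])]), (5248, 81, [(68007, [344065,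
  528390, 1048586]), (76257, [1606658, 524700]), (0, []), (84475, [528901, 1574163])]), (5264, 11,
  [(1001, [554246, 1049162]), (8744, [450561, 1802242, 524316]), (0, []), (1016, [554247,
  540945])]), (5276, 26, [(17386, [1594182, 1057130]), (8754, [2000770, 1573637, 525337]), (8744,
  [2000771, 1574413]), (0, [])]), (8208, 49, [(33881, [689922, 262916, 1048585]), (33913, [1175553,
  268324]), (0, []), (38165, [283399, 266801])]), (8212, 88, [(68559, [755330, 263428, 525328]),
  (68562, [292165, 266785]), (68549, [755331, 1115145]), (72591, [1239041, 268342])]), (8260, 52,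
  [(34122, [1082499, 787204, 524560]), (0, []), (34648, [1394689, 303162]), (50520, [791110,
  1069401])]), (8336, 73, [(68560, [1331972, 1074761]), (68553, [1961985, 950274, 688144]), (68168,
  [1331974, 275321]), (0, [])]), (8340, 13, [(4961, [271876, 266793]), (817, [590082, 263685,
  525584]), (936, [271878, 1073225]), (16393, [1249281, 1099802])]), (8404, 81, [(67815, [528900,
  278585]), (68091, [1606659, 525061, 525584]), (0, []), (72551, [344065, 307242])]), (8448, 22,
  [(391, [1763329, 1863684, 1056778]), (0, []), (5377, [1541762, 361393]), (4242, [1865031,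
  266345])]), (8464, 26, [(568, [2000771, 1574404, 1049097]), (4238, [653313, 374836]), (1070,
  [2000770, 360761]), (0, [])]), (8532, 7, [(285, [1214211, 787972, 524560]), (4489, [807685,
  271153]), (0, []), (18689, [1437697, 1445918])]), (9236, 56, [(38003, [1672578, 295081]), (34469,
  [537671, 270625]), (34419, [1672579, 526085, 1049097]), (34481, [415745, 307260])]), (9428, 41,
  [(0, []), (34415, [1868803, 360993]), (50751, [1577477, 1069081]), (34359, [606209, 1576966,
  528400])]), (9600, 25, [(6702, [1617921, 1441806]), (16434, [1442563, 1213721]), (0, []), (554,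
  [1442562, 1835269, 524560])]), (12316, 44, [(51046, [427906, 1049348, 1049881]), (33342, [86855,
  327971]), (34659, [1069893, 1058313]), (0, [])]), (12356, 56, [(34419, [1672579, 526084,
  525585]), (0, []), (34481, [415745, 1159228]), (50868, [537670, 1048858])]), (12360, 25, [(686,
  [1851652, 271138]), (0, []), (810, [1097991, 1090619]), (16950, [1442563, 1836293, 1048601])]),
  (12372, 88, [(68558, [292164, 525394]), (68562, [292165, 266785]), (0, []), (84751, [1239041,
  290822, 1069082])]), (12420, 98, [(101823, [545604, 274529]), (101820, [1738626, 524692]),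
  (101630, [391169, 544774, 1048586]), (116134, [1738627, 1181084])]), (12432, 22, [(407, [1865028,
  1057803]), (2823, [1763329, 1540098, 688148]), (202, [1865030, 1061690]), (0, [])]), (12436, 11,
  [(16928, [554244, 1053291]), (568, [1803778, 525573, 524561]), (1001, [554246, 1049162]), (18952,
  [450561, 1198108])]), (12444, 13, [(17257, [271876, 1052713]), (811, [590082, 262820]), (805,
  [590083, 263173, 1050121]), (0, [])]), (12500, 21, [(263, [1599236, 1053499]), (271, [2032131,
  1573125, 524561]), (0, []), (16743, [761857, 1095724])]), (12572, 35, [(50190, [1074948,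
  1054041]), (0, []), (33883, [459266, 1050373, 1050121]), (50259, [459267, 1048876])]), (12672,
  52, [(34136, [1394689, 790532, 1048586]), (34632, [1082499, 557460]), (0, []), (49496, [1082498,
  1147436])]), (12692, 69, [(67813, [1078532, 1057146]), (67808, [1078533, 529681]), (68012,
  [1078535, 1058315]), (84192, [974849, 491522, 1048604])]), (16400, 35, [(33887, [459266, 1050372,
  1050120]), (33919, [1024001, 329762]), (0, []), (38347, [1074951, 271154])]), (16512, 70,
  [(67808, [2074625, 1335300, 1073160]), (67830, [983682, 689553]), (71976, [1337158, 275314]), (0,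
  [])]), (16516, 25, [(686, [1851652, 271138]), (6714, [1442562, 918805]), (814, [1617921, 1851398,
  1064968]), (8226, [1442563, 688409])]), (16520, 22, [(285, [1541763, 1835524, 1050120]), (5377,
  [1541762, 361393]), (215, [1865030, 267386]), (8214, [1865029, 545050])]), (16540, 7, [(4480,
  [807684, 270954]), (8461, [1214210, 787237]), (261, [1214211, 787973, 1049608]), (0, [])]),
  (16640, 73, [(68553, [1961985, 1331204, 1073160]), (0, []), (72641, [952066, 328500]), (72193,
  [1331975, 274730])]), (16656, 37, [(34122, [1410307, 1836804, 1050120]), (37214, [1724417,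
  368690]), (34128, [1410306, 361404]), (0, [])]), (16668, 19, [(8194, [1324036, 529690]), (0, []),
  (22, [886018, 1311749, 1049608]), (4120, [886019, 328361])]), (16768, 44, [(34678, [915457,
  1069060, 1056776]), (34666, [427907, 655505]), (0, []), (37750, [427906, 327981])]), (17408, 49,
  [(33881, [1175553, 688130, 1114120]), (0, []), (34137, [283398, 529426]), (33885, [283397,
  266810])]), (17428, 52, [(38232, [1082498, 295468]), (34257, [791111, 275298]), (34118, [1082499,
  787205, 1049608]), (34648, [1394689, 303162])]), (17536, 21, [(135, [761857, 1597446, 1056776]),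
  (8453, [2032130, 655513]), (0, []), (91, [1599237, 545810])]), (20500, 26, [(558, [2000770,
  1573636, 524305]), (739, [1594181, 274978]), (8744, [2000771, 1574413]), (8846, [653313,
  604212])]), (20508, 52, [(42312, [1082498, 786948, 525593]), (33113, [1904711, 332130]), (34113,
  [791109, 1049675]), (0, [])]), (20552, 98, [(101823, [545604, 274529]), (0, []), (102066,
  [279367, 565306]), (109992, [1738627, 525829, 525593])]), (20564, 37, [(34126, [1848324,
  545809]), (34254, [1848325, 270435]), (0, []), (42398, [1724417, 1847302, 524314])]), (20608, 25,
  [(686, [1617921, 1851396, 1056778]), (2110, [1442562, 689173]), (9006, [1851654, 524851]), (0,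
  [])]), (20616, 41, [(34415, [1868803, 1573636, 1049097]), (42615, [1868802, 589877]), (34359,
  [1577478, 528507]), (42543, [1577477, 545817])]), (20820, 11, [(548, [1803779, 524804, 525585]),
  (8764, [554245, 532786]), (0, []), (8712, [450561, 542748])]), (20884, 81, [(67878, [528900,
  536953]), (67819, [528901, 540947]), (68014, [528903, 1050186]), (76263, [344065, 1605634,
  524316])]), (21504, 19, [(1030, [1986561, 884738, 1114124]), (0, []), (466, [1324038, 541971]),
  (87, [1324037, 528505])]), (21632, 69, [(68000, [974849, 1077254, 1056778]), (73952, [493058,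
  655645]), (0, []), (67808, [1078533, 529681])]), (21716, 22, [(0, []), (9501, [1541763, 852005]),
  (8214, [1865029, 545050]), (199, [1763329, 1863686, 524306])]), (21888, 70, [(68832, [2074625,
  1138700]), (73978, [983683, 689181]), (0, []), (67836, [983682, 1312517, 524305])]), (24588, 81,
  [(76259, [1606658, 524804, 524568]), (0, []), (68014, [528903, 1050186]), (72703, [1606659,
  295732])]), (24592, 19, [(30, [886018, 1311748, 1050121]), (1094, [1986561, 331814]), (0, []),
  (4242, [1324039, 274739])]), (24604, 56, [(42613, [1672578, 525316, 524568]), (33325, [1643591,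
  328481]), (34656, [537669, 1066506]), (0, [])]), (24648, 70, [(67756, [1337156, 267043]), (0,
  []), (68600, [1599047, 303161]), (76010, [983683, 1310981, 524568])]), (24660, 26, [(4906,
  [1594180, 803155]), (739, [1594181, 274978]), (0, []), (9006, [653313, 1593350, 528408])]),
  (24768, 35, [(42015, [1024001, 1073156, 528408]), (34267, [1074950, 545041]), (38347, [1074951,
  271154]), (36947, [459267, 327980])]), (24832, 41, [(34807, [606209, 1576964, 1073162]), (0, []),
  (38003, [1868802, 360757]), (38455, [1577479, 262763])]), (24848, 88, [(68549, [755331, 262660,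
  1049609]), (72591, [1239041, 268342]), (68559, [755330, 262845]), (0, [])]), (24980, 21, [(263,
  [1599236, 274747]), (91, [1599237, 545810]), (154, [1599239, 1056841]), (8455, [761857, 2031618,
  655384])]), (25620, 44, [(37750, [427906, 327981]), (34486, [1069895, 271139]), (34656, [427907,
  1050117, 1049609]), (34678, [915457, 329790])]), (25744, 13, [(936, [271878, 1073225]), (8489,
  [1249281, 589826, 557080]), (0, []), (1009, [271879, 529682])]), (25756, 37, [(38358, [1848326,
  267049]), (42314, [1410306, 1836037, 524568]), (35144, [1410307, 1246860]), (0, [])]), (28684,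
  69, [(76000, [493058, 1049860, 524569]), (0, []), (68012, [1078535, 1058315]), (72956, [493059,
  327985])]), (28692, 37, [(34126, [1410306, 1836036, 525329]), (34254, [1848325, 270435]), (35144,
  [1410307, 1246860]), (37214, [1724417, 368690])]), (28804, 70, [(67756, [1337156, 267043]),
  (67830, [983682, 689553]), (67680, [2074625, 1335302, 1064970]), (73978, [983683, 689181])]),
  (28828, 11, [(4776, [554244, 274539]), (554, [1803778, 295073]), (560, [1803779, 524805,
  1049097]), (0, [])]), (28864, 19, [(8198, [1986561, 1323012, 528410]), (466, [1324038, 541971]),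
  (4242, [1582343, 303155]), (4120, [886019, 328361])]), (28956, 49, [(42057, [283396, 525403]),
  (0, []), (33885, [689922, 262917, 1049097]), (37965, [689923, 263085])]), (29012, 13, [(829,
  [590083, 263172, 525329]), (4977, [271877, 266803]), (0, []), (8457, [1249281, 559130])]),
  (29056, 56, [(34673, [415745, 536580, 1064970]), (34419, [1672579, 525717]), (0, []), (38003,
  [1672578, 295081])]), (29840, 7, [(457, [807686, 1073675]), (8449, [1437697, 1212418, 557084]),
  (0, []), (285, [807687, 545811])]), (29852, 88, [(72198, [292166, 266795]), (76747, [755330,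
  263429, 525593]), (68549, [755331, 1115145]), (0, [])]), (29908, 73, [(0, []), (69591, [952067,
  328356]), (76741, [1331973, 528475]), (68489, [1961985, 1331206, 540690])]), (30080, 98,
  [(101534, [391169, 1198090]), (109990, [1738627, 525724]), (0, []), (101814, [1738626, 525061,
  524561])])]

/-- Certificates for forms of minimal level. -/
def sumCerts : List Cert := [
  (4116, 90, [(68559, [197122, 1796]), (68563, [26373, 96]), (68551, [197123, 141]), (68559,
  [237569, 2102])]), (4228, 102, [(101567, [4612, 96]), (101565, [33794, 148]), (101631, [81921,
  4102]), (101551, [33795, 157])]), (4500, 85, [(67814, [21316, 123]), (67818, [21317, 81]),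
  (68011, [21319, 74]), (67814, [129025, 163842])]), (5140, 60, [(34674, [230914, 172]), (34468,
  [29959, 96]), (34656, [230915, 517]), (34672, [188417, 2110])]), (8324, 102, [(101566, [4612,
  97]), (101567, [33794, 144]), (101631, [81921, 4102]), (101549, [33795, 153])]), (8328, 105,
  [(102288, [65923, 1028]), (102292, [65922, 180]), (102167, [9798, 123]), (102286, [9797, 90])]),
  (8384, 51, [(33881, [47105, 16388]), (34136, [16710, 80]), (34140, [16711, 113]), (33877,
  [131971, 169])]), (8596, 85, [(67815, [21316, 121]), (67819, [21317, 80]), (68011, [21319, 73]),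
  (67814, [129025, 163842])]), (12308, 90, [(68559, [197122, 1796]), (68562, [26373, 97]), (68549,
  [197123, 140]), (68559, [237569, 2096])]), (12424, 105, [(102288, [65923, 1028]), (102294,
  [65922, 176]), (102166, [9798, 122]), (102286, [9797, 89])]), (12480, 51, [(33881, [47105,
  16388]), (34137, [16710, 82]), (34141, [16711, 112]), (33877, [131971, 172])]), (13332, 60,
  [(34672, [230914, 173]), (34469, [29959, 97]), (34656, [230915, 517]), (34640, [188417, 2106])]),
  (16404, 90, [(68559, [197122, 1796]), (68562, [26373, 98]), (68551, [197123, 136]), (68591,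
  [237569, 2098])]), (16532, 15, [(808, [13380, 106]), (825, [99714, 1029]), (1000, [13382, 72]),
  (777, [153601, 2074])]), (16576, 51, [(33881, [47105, 16388]), (34137, [16710, 81]), (34141,
  [16711, 115]), (33879, [131971, 173])]), (16788, 85, [(67815, [21316, 122]), (67818, [21317,
  82]), (68010, [21319, 72]), (67814, [129025, 163842])]), (20612, 102, [(101566, [4612, 98]),
  (101565, [33794, 145]), (101631, [81921, 4102]), (101549, [33795, 156])]), (20628, 15, [(809,
  [13380, 104]), (825, [99714, 1029]), (1000, [13382, 75]), (777, [153601, 2076])]), (20672, 51,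
  [(33881, [47105, 16388]), (34136, [16710, 83]), (34140, [16711, 114]), (33879, [131971, 168])]),
  (21524, 60, [(34672, [230914, 168]), (34469, [29959, 98]), (34656, [230915, 517]), (34640,
  [188417, 2108])]), (24596, 90, [(68559, [197122, 1796]), (68563, [26373, 99]), (68549, [197123,
  137]), (68591, [237569, 2100])]), (24708, 102, [(101567, [4612, 99]), (101567, [33794, 149]),
  (101631, [81921, 4102]), (101551, [33795, 152])]), (24712, 105, [(102288, [65923, 1028]),
  (102294, [65922, 181]), (102166, [9798, 121]), (102287, [9797, 88])]), (24724, 15, [(809, [13380,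
  107]), (825, [99714, 1029]), (1001, [13382, 73]), (809, [153601, 2072])]), (28808, 105, [(102288,
  [65923, 1028]), (102292, [65922, 177]), (102167, [9798, 120]), (102287, [9797, 91])]), (28820,
  15, [(808, [13380, 105]), (825, [99714, 1029]), (1001, [13382, 74]), (809, [153601, 2078])]),
  (29076, 85, [(67814, [21316, 120]), (67819, [21317, 83]), (68010, [21319, 75]), (67814, [129025,
  163842])]), (29716, 60, [(34674, [230914, 169]), (34468, [29959, 99]), (34656, [230915, 517]),
  (34672, [188417, 2104])])]

lemma plainForms_ok : (plainForms.all fun g => rootCertOk (g, 0, [])) = true := by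
  decide +kernel

lemma rootCerts_ok : rootCerts.all rootCertOk = true := by
  decide +kernel

lemma sumCerts_ok : sumCerts.all sumCertOk = true := by
  decide +kernel

/-- All forms that require a certificate, up to permutation. -/
def forms : List ℕ := 0 :: (plainForms ++ (rootCerts ++ sumCerts).map Prod.fst)

lemma not_quad_of_mem_forms {g : ℕ} (hg : g ∈ forms) {A : ℕ → List ℕ} : ¬Quad g A := by
  have h1 := plainForms_ok
  have h2 := rootCerts_ok
  have h3 := sumCerts_ok
  rw [List.all_eq_true] at h1 h2 h3
  simp only [forms, List.mem_cons, List.mem_append, List.mem_map] at hg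
  obtain rfl | hg | ⟨c, hc | hc, rfl⟩ := hg
  · exact not_quad_zero
  · exact not_quad_of_rootCertOk (h1 g hg)
  · exact not_quad_of_rootCertOk (h2 c hc)
  · exact not_quad_of_sumCertOk (h3 c hc)

end Certificates

section Coverage

namespace BExp

/-- Substitution of expressions for the variables. -/
def subst (S : List BExp) : BExp → BExp
  | ff => ff
  | tt => tt
  | var n => S.getD n ff
  | xor p q => xor (subst S p) (subst S q)
  | and p q => and (subst S p) (subst S q)
  | or p q => or (subst S p) (subst S q)

lemma evalB_subst (e : List Bool) (S : List BExp) (p : BExp) :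
    evalB e (subst S p) = evalB (S.map (evalB e)) p := by
  induction p with
  | ff => rfl
  | tt => rfl
  | var n =>
    simp only [subst, evalB]
    obtain h | h := lt_or_ge n S.length
    · rw [List.getD_eq_getElem _ _ h, List.getD_eq_getElem _ _ (by simpa using h), List.getElem_map]
    · rw [List.getD_eq_default _ _ h, List.getD_eq_default _ _ (by simpa using h)]
      rfl
  | xor p q hp hq => rw [subst, evalB, evalB, hp, hq]
  | and p q hp hq => rw [subst, evalB, evalB, hp, hq]
  | or p q hp hq => rw [subst, evalB, evalB, hp, hq]

end BExp

/-- The form shifted by `tz z`. -/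
def shiftE (z : ℕ) : List BExp :=
  (List.range 15).map fun k => bif (tz z).testBit k then .xor .tt (.var k) else .var k

/-- The form has level `k`. -/
def levE : ℕ → BExp
  | 4 => nondegE
  | 3 => .and pfaffE (.xor .tt nondegE)
  | 2 => .and nonzeroE (.xor .tt (.or pfaffE nondegE))
  | _ => .xor .tt (.or nonzeroE (.or pfaffE nondegE))

/-- The value of the form at two vectors. -/
def evalGE (u v : ℕ) : BExp :=
  .sum (List.range 6) fun i => bif u.testBit i then
    .sum (List.range 6) fun j => bif v.testBit j then gbE i j else .ff else .ff

/-- The form has no root with index less than `8`. -/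
def noRootE : BExp :=
  .all (List.range 8) fun t => .or (evalGE (bas t 0) (bas t 1))
    (.or (evalGE (bas t 0) (bas t 2)) (evalGE (bas t 1) (bas t 2)))

/-- The form is that coded by `c`. -/
def eqE (c : ℕ) : BExp :=
  .all (List.range 15) fun k => bif c.testBit k then .var k else .xor .tt (.var k)

/-- The form or one of its shifts is in the list `forms`. -/
def formsE : BExp := .any (List.range 4) fun z => .any forms fun c => eqE (c ^^^ tz z)

/-- The sixteen conditions on the levels of the four shifts of a form. -/
def levelsE : List BExp :=
  (List.range 16).map fun n => (levE ([0, 2, 3, 4].getD (n % 4) 0)).subst (shiftE (n / 4))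

/-- The admissible patterns of levels do not occur outside the list of forms. -/
def coverE : BExp :=
  .and (.xor .tt (.var 17)) (.any (List.range 4) fun a => .any (List.range 4) fun b =>
    .any (List.range 4) fun c => .any (List.range 4) fun d =>
      let v (n : ℕ) : ℕ := [0, 2, 3, 4].getD n 0
      bif Nat.ble 13 (v a + v b + v c + v d) then .ff else
        .and (.var a) (.and (.var (4 + b)) (.and (.var (8 + c)) (.and (.var (12 + d))
          (bif Nat.beq (v a + v b + v c + v d) 12 && !(a == 3 || b == 3 || c == 3 || d == 3)
            then .var 16 else .tt)))))

lemma evalN_coverE : coverE.evalN (2 ^ 2 ^ 15 - 1)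
    ((levelsE ++ [noRootE, formsE]).map fun q => q.evalN (2 ^ 2 ^ 15 - 1) (truthCols 15)) = 0 := by
  decide +kernel

variable {g : ℕ} {A : ℕ → List ℕ}

lemma evalB_shiftE (g z : ℕ) :
    (shiftE z).map (BExp.evalB (gramBits g)) = gramBits (g ^^^ tz z) := by
  rw [shiftE, List.map_map, gramBits]
  refine List.map_congr_left fun k hk => ?_
  rw [List.mem_range] at hk
  simp only [Function.comp, BExp.evalB_cond, BExp.evalB]
  rw [← gramBits, getD_gramBits g k hk, Nat.testBit_xor]
  cases (tz z).testBit k <;> simp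

lemma evalB_levE (g : ℕ) : (levE (lev g)).evalB (gramBits g) = true := by
  unfold lev low
  cases h4 : (lowE 4).evalB (gramBits g)
  · simp only [lowE] at h4
    cases h3 : (lowE 3).evalB (gramBits g)
    · simp only [lowE] at h3
      cases h2 : (lowE 2).evalB (gramBits g)
      · simp only [lowE] at h2
        simp [levE, BExp.evalB, h2, h3, h4]
      · simp only [lowE] at h2
        simp [levE, BExp.evalB, h2, h3, h4]
    · simp only [lowE] at h3
      simp [levE, BExp.evalB, h3, h4]
  · exact h4

lemma evalB_evalGE (g u v : ℕ) : (evalGE u v).evalB (gramBits g) = evalG g u v := by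
  rw [evalGE, BExp.evalB_sum, evalG]
  refine par_congr fun i hi => ?_
  rw [BExp.evalB_cond, BExp.evalB_sum]
  rw [par_congr (q := fun j => v.testBit j && gb g i j)]
  · cases u.testBit i <;> rfl
  · intro j hj
    rw [BExp.evalB_cond, evalB_gbE (getD_gramBits g) (List.mem_range.mp hi) (List.mem_range.mp hj)]
    cases v.testBit j <;> rfl

lemma evalB_noRootE (h : ∀ t < 8, isRoot g t = false) : noRootE.evalB (gramBits g) = true := by
  rw [noRootE, BExp.evalB_all, List.all_eq_true]
  intro t ht
  have := h t (List.mem_range.mp ht)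
  simp only [BExp.evalB, evalB_evalGE]
  unfold isRoot at this
  revert this
  generalize evalG g (bas t 0) (bas t 1) = x
  generalize evalG g (bas t 0) (bas t 2) = y
  generalize evalG g (bas t 1) (bas t 2) = z
  revert x y z; decide

lemma eq_of_evalB_eqE {c : ℕ} (hg : g < 2 ^ 15) (hc : c < 2 ^ 15)
    (h : (eqE c).evalB (gramBits g) = true) : g = c := by
  refine Nat.eq_of_testBit_eq fun k => ?_
  obtain hk | hk := lt_or_ge k 15
  · rw [eqE, BExp.evalB_all, List.all_eq_true] at h
    have := h k (List.mem_range.mpr hk)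
    simp only [BExp.evalB_cond, BExp.evalB, getD_gramBits g k hk] at this
    revert this
    generalize g.testBit k = x
    generalize c.testBit k = y
    revert x y; decide
  · have h2 := Nat.pow_le_pow_right (n := 2) (by decide) hk
    rw [Nat.testBit_lt_two_pow (hg.trans_le h2), Nat.testBit_lt_two_pow (hc.trans_le h2)]

lemma tz_lt : ∀ z < 4, tz z < 2 ^ 15 := by decide

lemma forms_lt : ∀ c ∈ forms, c < 2 ^ 15 := by decide +kernel

lemma Quad.evalB_formsE (h : Quad g A) (hg : g < 2 ^ 15) : formsE.evalB (gramBits g) = false := by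
  rw [← Bool.not_eq_true]
  intro hf
  simp only [formsE, BExp.evalB_any, List.any_eq_true, List.mem_range] at hf
  obtain ⟨z, hz, c, hc, hf⟩ := hf
  obtain rfl := eq_of_evalB_eqE hg (Nat.xor_lt_two_pow (forms_lt c hc) (tz_lt z hz)) hf
  have := h.permute hz
  rw [Nat.xor_assoc, Nat.xor_self, Nat.xor_zero] at this
  exact not_quad_of_mem_forms hc this

lemma exists_level (g : ℕ) : ∃ a < 4, lev g = [0, 2, 3, 4].getD a 0 := by
  have h : ∀ k ∈ [0, 2, 3, 4], ∃ a < 4, k = [0, 2, 3, 4].getD a 0 := by decide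
  exact h _ (lev_mem g)

theorem not_quad (hg : g < 2 ^ 15) : ¬Quad g A := by
  intro h
  have h0 := evalB_eq_false_of_subst evalN_coverE (e := gramBits g) (by simp [gramBits])
  set e := (levelsE ++ [noRootE, formsE]).map fun q => q.evalB (gramBits g) with he
  have hlev : ∀ z < 4, ∀ a < 4, lev (g ^^^ tz z) = [0, 2, 3, 4].getD a 0 →
      e.getD (4 * z + a) false = true := by
    intro z hz a ha hl
    rw [he, List.map_append, List.getD_append _ _ _ _ (by simp [levelsE]; omega),
      List.getD_eq_getElem _ _ (by simp [levelsE]; omega)]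
    simp only [levelsE, List.getElem_map, List.getElem_range, BExp.evalB_subst]
    rw [show (4 * z + a) % 4 = a by omega, show (4 * z + a) / 4 = z by omega, ← hl, evalB_shiftE,
      evalB_levE]
  have e16 : e.getD 16 false = noRootE.evalB (gramBits g) := rfl
  have e17 : e.getD 17 false = formsE.evalB (gramBits g) := rfl
  obtain ⟨a, ha, hla⟩ := exists_level (g ^^^ tz 0)
  obtain ⟨b, hb, hlb⟩ := exists_level (g ^^^ tz 1)
  obtain ⟨c, hc, hlc⟩ := exists_level (g ^^^ tz 2)
  obtain ⟨d, hd, hld⟩ := exists_level (g ^^^ tz 3)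
  have va := hlev 0 (by decide) a ha hla
  have vb := hlev 1 (by decide) b hb hlb
  have vc := hlev 2 (by decide) c hc hlc
  have vd := hlev 3 (by decide) d hd hld
  rw [← Bool.not_eq_true] at h0
  apply h0
  simp only [coverE, BExp.evalB, BExp.evalB_any, Bool.and_eq_true, List.any_eq_true, List.mem_range]
  refine ⟨by rw [e17, h.evalB_formsE hg]; rfl, a, ha, b, hb, c, hc, d, hd, ?_⟩
  have hsum : ¬13 ≤ [0, 2, 3, 4].getD a 0 + [0, 2, 3, 4].getD b 0 + [0, 2, 3, 4].getD c 0 +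
      [0, 2, 3, 4].getD d 0 := by
    rw [← hla, ← hlb, ← hlc, ← hld]
    intro h13
    have := (length_eq_of_sumFour (f := fun w => lev (g ^^^ tz w))
      (fun w hw => h.le_length hw) h.len
      (by dsimp only [sumFour]; omega)).1
    dsimp only [sumFour] at this
    omega
  have h1 : Nat.ble 13 ([0, 2, 3, 4].getD a 0 + [0, 2, 3, 4].getD b 0 + [0, 2, 3, 4].getD c 0 +
      [0, 2, 3, 4].getD d 0) = false := by
    rw [← Bool.not_eq_true, Nat.ble_eq]; exact hsum
  rw [h1, cond_false]
  simp only [BExp.evalB, BExp.evalB_cond, Bool.and_eq_true]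
  refine ⟨by simpa using va, vb, vc, vd, ?_⟩
  cases hX : (Nat.beq ([0, 2, 3, 4].getD a 0 + [0, 2, 3, 4].getD b 0 + [0, 2, 3, 4].getD c 0 +
      [0, 2, 3, 4].getD d 0) 12 && !(a == 3 || b == 3 || c == 3 || d == 3))
  · rfl
  · simp only [Bool.and_eq_true, Bool.not_eq_true', Bool.or_eq_false_iff, beq_eq_false_iff_ne] at hX
    obtain ⟨h12, ⟨⟨ha3, hb3⟩, hc3⟩, hd3⟩ := hX
    have h12 := Nat.eq_of_beq_eq_true h12
    rw [cond_true, e16]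
    have hle : ∀ a < 4, a ≠ 3 → [0, 2, 3, 4].getD a 0 ≤ 3 := by decide
    refine evalB_noRootE fun t ht => h.isRoot_eq_false ?_ ?_ ht
    · intro w hw
      interval_cases w
      · rw [hla]; exact hle a ha ha3
      · rw [hlb]; exact hle b hb hb3
      · rw [hlc]; exact hle c hc hc3
      · rw [hld]; exact hle d hd hd3
    · dsimp only [sumFour]
      rw [hla, hlb, hlc, hld]
      exact h12.ge

end Coverage

section LowerBound

/-- The pair of indices with the given position in lexicographic order. -/
def pairAt (k : ℕ) : ℕ × ℕ :=
  [(0, 1), (0, 2), (0, 3), (0, 4), (0, 5), (1, 2), (1, 3), (1, 4), (1, 5), (2, 3), (2, 4), (2, 5),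
    (3, 4), (3, 5), (4, 5)].getD k (0, 0)

lemma pairAt_pix : ∀ i < 6, ∀ j < 6, i ≠ j →
    pix i j < 15 ∧ (pairAt (pix i j) = (i, j) ∨ pairAt (pix i j) = (j, i)) := by decide

lemma exists_hasGram {A : List ℕ} (h0 : (par A fun _ => true) = false)
    (h1 : ∀ i < 6, (par A fun a => a.testBit i) = false) : ∃ g < 2 ^ 15, HasGram g A := by
  refine ⟨Nat.ofBits fun k : Fin 15 =>
    par A fun a => a.testBit (pairAt k).1 && a.testBit (pairAt k).2,
    Nat.ofBits_lt_two_pow _, h0, fun i hi j hj => ?_⟩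
  by_cases hij : i = j
  · subst hij
    simpa [gb] using h1 i hi
  · obtain ⟨hk, h | h⟩ := pairAt_pix i hi j hj hij
    · simp [gb, hij, Nat.testBit_ofBits_lt _ _ hk, h]
    · simp [gb, hij, Nat.testBit_ofBits_lt _ _ hk, h, Bool.and_comm]

/-- The membership in the part `z` of a set of points of `𝔽₂⁸`, determined by the last two
coordinates. -/
def inPart (z a : ℕ) : Bool := (a.testBit 6 ^^ z.testBit 0) && (a.testBit 7 ^^ z.testBit 1)

lemma par_part (S : List ℕ) (p : ℕ → Bool) : ∀ z < 4, par (S.filter (inPart z)) p =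
    ((par S fun a => a.testBit 6 && (a.testBit 7 && p a)) ^^
      (z.testBit 1 && par S fun a => a.testBit 6 && p a) ^^
      (z.testBit 0 && par S fun a => a.testBit 7 && p a) ^^
      (z.testBit 0 && (z.testBit 1 && par S p))) := by
  intro z _
  rw [← par_and_eq_filter]
  simp only [← par_and_left, ← par_xor]
  refine par_congr fun a _ => ?_
  unfold inPart
  generalize a.testBit 6 = x
  generalize a.testBit 7 = y
  generalize z.testBit 0 = u
  generalize z.testBit 1 = v
  generalize p a = w
  revert x y u v w; decide

lemma par_parts (S : List ℕ) (p : ℕ → Bool) :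
    (par (List.range 4) fun z => par (S.filter (inPart z)) p) = par S p := by
  simp only [← par_and_eq_filter]
  rw [par_comm]
  refine par_congr fun a _ => ?_
  change ((inPart 0 a && p a) ^^ ((inPart 1 a && p a) ^^ ((inPart 2 a && p a) ^^
    ((inPart 3 a && p a) ^^ false)))) = p a
  simp only [inPart, show Nat.testBit 0 0 = false by decide, show Nat.testBit 0 1 = false by decide,
    show Nat.testBit 1 0 = true by decide, show Nat.testBit 1 1 = false by decide,
    show Nat.testBit 2 0 = false by decide, show Nat.testBit 2 1 = true by decide,
    show Nat.testBit 3 0 = true by decide, show Nat.testBit 3 1 = true by decide]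
  generalize a.testBit 6 = x
  generalize a.testBit 7 = y
  generalize p a = w
  revert x y w; decide

lemma length_parts (S : List ℕ) : (S.filter (inPart 0)).length + (S.filter (inPart 1)).length +
    (S.filter (inPart 2)).length + (S.filter (inPart 3)).length = S.length := by
  induction S with
  | nil => rfl
  | cons a S ih =>
    simp only [List.filter_cons, inPart, show Nat.testBit 0 0 = false by decide,
      show Nat.testBit 0 1 = false by decide, show Nat.testBit 1 0 = true by decide,
      show Nat.testBit 1 1 = false by decide, show Nat.testBit 2 0 = false by decide,
      show Nat.testBit 2 1 = true by decide, show Nat.testBit 3 0 = true by decide,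
      show Nat.testBit 3 1 = true by decide] at ih ⊢
    cases a.testBit 6 <;> cases a.testBit 7 <;> simp at ih ⊢ <;> omega

lemma par_lin_mul (S : List ℕ) (u : ℕ) (p : ℕ → Bool) : (par S fun a => lin u a && p a) =
    par (List.range 6) fun i => u.testBit i && par S fun a => a.testBit i && p a := by
  simp only [← par_and_left]
  rw [par_comm]
  refine par_congr fun a _ => ?_
  rw [Bool.and_comm, lin, ← par_and_left]
  refine par_congr fun i _ => ?_
  generalize u.testBit i = x
  generalize a.testBit i = y
  generalize p a = w
  revert x y w; decide

lemma par_tri (S : List ℕ) (t : ℕ) : par S (tri t) = par (List.range 6) fun i =>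
    (bas t 0).testBit i && par (List.range 6) fun j => (bas t 1).testBit j &&
      par (List.range 6) fun k => (bas t 2).testBit k && mom S i j k := by
  unfold tri
  rw [par_lin_mul]
  refine par_congr fun i _ => ?_
  have h1 : ∀ a : ℕ, (a.testBit i && (lin (bas t 1) a && lin (bas t 2) a)) =
      (lin (bas t 1) a && (a.testBit i && lin (bas t 2) a)) := fun a => Bool.and_left_comm _ _ _
  simp only [h1]
  rw [par_lin_mul]
  congr 1
  refine par_congr fun j _ => ?_
  have h2 : ∀ a : ℕ, (a.testBit j && (a.testBit i && lin (bas t 2) a)) =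
      (lin (bas t 2) a && (a.testBit i && a.testBit j)) := fun a => by
    rw [← Bool.and_assoc, Bool.and_comm, Bool.and_comm (a.testBit j)]
  simp only [h2]
  rw [par_lin_mul]
  congr 1
  refine par_congr fun k _ => ?_
  congr 1
  refine par_congr fun a _ => ?_
  rw [Bool.and_comm]

/-- The points of the coordinate subspaces spanned by `e i`, `e j`, `e k`, for the triples
`i, j, k` of a cubic form. -/
def farPts : List ℕ :=
  [(0, 3, 6), (0, 5, 7), (2, 4, 6), (1, 5, 6), (2, 5, 6), (3, 4, 5), (2, 3, 7), (1, 4, 7)].flatMap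
    fun t => (List.range 8).map fun c =>
      (c.testBit 0).toNat * 2 ^ t.1 + (c.testBit 1).toNat * 2 ^ t.2.1 +
        (c.testBit 2).toNat * 2 ^ t.2.2

lemma mom_farPts : ∀ i < 8, ∀ j < 8, ∀ k < 8, i = j ∨ j = k ∨ i = k →
    mom farPts i j k = false := by decide +kernel

lemma par_farPts : (par farPts fun _ => true) = false := by decide +kernel

lemma mom_farPts_six_seven : ∀ i < 6, mom farPts 6 7 i = false := by decide +kernel

lemma mom_farPts_gram : ∀ z < 4, ∀ i < 6, ∀ j < 6, gb (tz z) i j =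
    ((z.testBit 1 && mom farPts 6 i j) ^^ (z.testBit 0 && mom farPts 7 i j)) := by decide +kernel

lemma sum_tri_farPts : ∀ t < 9, par farPts (tri t) = !(t == 8) := by decide +kernel

lemma quad_of_mom {S : List ℕ} (hlen : S.length ≤ 24) (h0 : (par S fun _ => true) = false)
    (hS : ∀ i < 8, ∀ j < 8, ∀ k < 8, mom S i j k = mom farPts i j k) :
    ∃ g < 2 ^ 15, Quad g fun z => S.filter (inPart z) := by
  have hd : ∀ i < 8, ∀ j < 8, mom S i j j = false := fun i hi j hj => by
    rw [hS i hi j hj j hj, mom_farPts i hi j hj j hj (by simp)]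
  have h1 : ∀ i < 8, (par S fun a => a.testBit i) = false := fun i hi => by
    simpa [mom] using hd i hi i hi
  have h2 : ∀ i < 8, ∀ j < 8, (par S fun a => a.testBit i && a.testBit j) = false :=
    fun i hi j hj => by simpa [mom, Bool.and_assoc] using hd i hi j hj
  have h3 : ∀ i j k, (par S fun a => a.testBit i && (a.testBit j && a.testBit k)) = mom S i j k :=
    fun i j k => by simp only [mom, Bool.and_assoc]
  have even : ∀ z < 4, (par (S.filter (inPart z)) fun _ => true) = false := fun z hz => by
    rw [par_part S _ z hz, h0]
    simp only [Bool.and_true]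
    rw [h2 6 (by decide) 7 (by decide), h1 6 (by decide), h1 7 (by decide)]
    simp
  obtain ⟨g, hg, hgr⟩ := exists_hasGram (even 0 (by decide)) fun i hi => by
    rw [par_part S _ 0 (by decide), h3, hS 6 (by decide) 7 (by decide) i (by omega),
      mom_farPts_six_seven i hi]
    simp
  refine ⟨g, hg, fun z hz => ⟨even z hz, fun i hi j hj => ?_⟩, ?_, fun t ht => ?_⟩
  · have hij := hgr.gram i hi j hj
    rw [par_part S _ 0 (by decide)] at hij
    simp only [Nat.zero_testBit, Bool.false_and, Bool.xor_false] at hij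
    rw [par_part S _ z hz, hij, h3, h3, h2 i (by omega) j (by omega), gb_xor,
      mom_farPts_gram z hz i hi j hj, hS 6 (by decide) i (by omega) j (by omega),
      hS 7 (by decide) i (by omega) j (by omega)]
    simp
  · rw [length_parts]
    exact hlen
  · rw [par_parts, ← sum_tri_farPts t ht, par_tri, par_tri]
    refine par_congr fun i hi => ?_
    congr 1
    refine par_congr fun j hj => ?_
    congr 1
    refine par_congr fun k hk => ?_
    rw [List.mem_range] at hi hj hk
    rw [hS i (by omega) j (by omega) k (by omega)]

lemma exists_ofPts (h : BF 8) : ∃ S : List ℕ, S.length = wt h ∧ ofPts 8 S = h := by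
  classical
  let code : (Fin 8 → ZMod 2) → ℕ := fun v => Nat.ofBits fun i => decide (v i = 1)
  have hc : ∀ v, pt 8 (code v) = v := fun v => funext fun i => by
    have hz : ∀ y : ZMod 2, ((decide (y = 1)).toNat : ZMod 2) = y := by decide
    simp only [pt, code, Nat.testBit_ofBits_lt _ _ i.isLt]
    exact hz _
  refine ⟨(Finset.univ.filter fun v => h v = 1).toList.map code, by simp [wt], ?_⟩
  funext v
  simp only [ofPts, List.map_map, Function.comp_def, hc]
  rw [Finset.sum_map_toList, Finset.sum_ite_eq]
  have hz : ∀ y : ZMod 2, (if y = 1 then (1 : ZMod 2) else 0) = y := by decide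
  simpa using hz (h v)

lemma deg_farPts : deg (ofPts 8 farPts) ≤ 5 := by
  refine deg_le_of_moment fun T hT => ?_
  obtain rfl | hne := T.eq_empty_or_nonempty
  · rw [moment_ofPts_empty, par_farPts]
    rfl
  · obtain ⟨i, j, k, rfl, -⟩ := exists_prod_eq (T := T) (by omega) hne
    rw [← sum_mul_triple, sum_ofPts_mom, mom_farPts i i.isLt j j.isLt k k.isLt]
    · rfl
    · by_contra! hc
      have : ({i, j, k} : Finset (Fin 8)).card = 3 := Finset.card_eq_three.mpr
        ⟨i, j, k, fun h => hc.1 (by rw [h]), fun h => hc.2.2 (by rw [h]),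
          fun h => hc.2.1 (by rw [h]), rfl⟩
      omega

theorem le_distRM_farPts : 26 ≤ distRM 8 4 (ofPts 8 farPts) := by
  refine le_csInf ⟨_, 0, deg_le_of_moment fun T _ => by simp [moment], rfl⟩ ?_
  rintro _ ⟨p, hp, rfl⟩
  by_contra! hw
  obtain ⟨S, hS, hSp⟩ := exists_ofPts (ofPts 8 farPts + p)
  have inj : ∀ b c : Bool, ((b.toNat : ZMod 2) = (c.toNat : ZMod 2)) → b = c := by decide
  have hm : ∀ T : Finset (Fin 8), T.card ≤ 3 →
      moment (ofPts 8 S) T = moment (ofPts 8 farPts) T := fun T hT => by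
    rw [hSp, moment_add, moment_eq_zero hp (by omega), add_zero]
  have h0 : (par S fun _ => true) = false := by
    rw [← par_farPts]
    apply inj
    rw [← moment_ofPts_empty, ← moment_ofPts_empty, hm _ (by simp)]
  have hlen : S.length ≤ 24 := by
    have := h0
    rw [par_true] at this
    simp only [decide_eq_false_iff_not] at this
    omega
  obtain ⟨g, hg, hq⟩ := quad_of_mom hlen h0 fun i hi j hj k hk => by
    apply inj
    have h1 := sum_ofPts_mom S ⟨i, hi⟩ ⟨j, hj⟩ ⟨k, hk⟩
    have h2 := sum_ofPts_mom farPts ⟨i, hi⟩ ⟨j, hj⟩ ⟨k, hk⟩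
    rw [sum_mul_triple] at h1 h2
    rw [← h1, ← h2, hm _ Finset.card_le_three]
  exact not_quad hg hq

end LowerBound

/-- The covering radius of `RM(4,8)` in `RM(5,8)` equals 26. -/
theorem stmt7 :
    (∀ f : BF 8, deg f ≤ 5 → distRM 8 4 f ≤ 26) ∧
      (∃ f : BF 8, deg f ≤ 5 ∧ distRM 8 4 f = 26) := by
  exact ⟨fun f hf => distRM_le hf, ofPts 8 farPts, deg_farPts,
    le_antisymm (distRM_le deg_farPts) le_distRM_farPts⟩
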